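/- arXiv:1509.02577 — 3 statements merged into one kernel-verified Lean document; each statement's English description precedes it below -/
import Mathlib

section
/- Whenever constants satisfy the hierarchy 0 < 1/n ≪ φ ≪ γ ≪ 1, the following holds: every 3-graph H on n vertices with δ₂(H) ≥ (1/2 − γ)n contains a K₄⁻-tiling covering all but at most φn vertices of H. -/
open Finset

/-- `H` is the edge set of a 3-uniform hypergraph (3-graph) on `Fin n`. -/
def Is3Graph (n : ℕ) (H : Finset (Finset (Fin n))) : Prop :=
  ∀ e ∈ H, e.card = 3

/-- `degOn H x y U` : number of `z ∈ U` with `{x,y,z} ∈ H`, i.e. `deg_H(xy, U)`. -/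
def degOn {n : ℕ} (H : Finset (Finset (Fin n))) (x y : Fin n) (U : Finset (Fin n)) : ℕ :=
  (U.filter fun z => ({x, y, z} : Finset (Fin n)) ∈ H).card

/-- The minimum codegree `δ₂(H)` is at least `t`. -/
def CodegLB {n : ℕ} (H : Finset (Finset (Fin n))) (t : ℝ) : Prop :=
  ∀ x y : Fin n, x ≠ y → t ≤ (degOn H x y Finset.univ : ℝ)

/-- `S` spans a copy of `K₄⁻` in `H`: it has 4 vertices and at least 3 of its
four 3-subsets are edges. -/
def SpansK4m {n : ℕ} (H : Finset (Finset (Fin n))) (S : Finset (Fin n)) : Prop :=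
  S.card = 4 ∧ 3 ≤ ((S.powersetCard 3).filter (· ∈ H)).card

/-- `S` spans a copy of `K₄³` (the complete 3-graph on 4 vertices) in `H`. -/
def SpansK43 {n : ℕ} (H : Finset (Finset (Fin n))) (S : Finset (Fin n)) : Prop :=
  S.card = 4 ∧ ((S.powersetCard 3).filter (· ∈ H)).card = 4

/-- The induced subgraph `H[X]` contains a `K₄⁻`-factor. -/
def HasK4mFactorOn {n : ℕ} (H : Finset (Finset (Fin n))) (X : Finset (Fin n)) : Prop :=
  ∃ P : Finset (Finset (Fin n)),
    (∀ S ∈ P, SpansK4m H S) ∧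
    (∀ S ∈ P, ∀ T ∈ P, S ≠ T → Disjoint S T) ∧
    P.biUnion id = X

/-- `S` is an `(x,y)`-connector of length `c` in `H`. -/
def IsConnector {n : ℕ} (H : Finset (Finset (Fin n))) (c : ℕ) (x y : Fin n)
    (S : Finset (Fin n)) : Prop :=
  x ∉ S ∧ y ∉ S ∧ S.card = 4 * c - 1 ∧
    HasK4mFactorOn H (insert x S) ∧ HasK4mFactorOn H (insert y S)

/-- `x` and `y` are `(c,η)`-close in `H` (a 3-graph on `n` vertices). -/
def Close {n : ℕ} (H : Finset (Finset (Fin n))) (c : ℕ) (η : ℝ) (x y : Fin n) : Prop :=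
  η * (n : ℝ) ^ (4 * c - 1) ≤ ({S : Finset (Fin n) | IsConnector H c x y S}.ncard : ℝ)

/-- `U` is `(c,η)`-closed in `H`. -/
def ClosedOn {n : ℕ} (H : Finset (Finset (Fin n))) (c : ℕ) (η : ℝ)
    (U : Finset (Fin n)) : Prop :=
  ∀ x ∈ U, ∀ y ∈ U, x ≠ y → Close H c η x y

/-- The number of `(X,Y)`-bridges `(x,y,S)` of length `c` in `H`. -/
noncomputable def BridgeCount {n : ℕ} (H : Finset (Finset (Fin n))) (c : ℕ)
    (X Y : Finset (Fin n)) : ℕ :=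
  {t : Fin n × Fin n × Finset (Fin n) |
    t.1 ∈ X ∧ t.2.1 ∈ Y ∧ IsConnector H c t.1 t.2.1 t.2.2}.ncard

/-- The 3-graph `𝓑[A,B]`: all triples in `A ∪ B` containing an odd number of
vertices of `A`. -/
def BGraph {n : ℕ} (A B : Finset (Fin n)) : Finset (Finset (Fin n)) :=
  ((A ∪ B).powersetCard 3).filter fun e => (e ∩ A).card % 2 = 1

/-- `H` (a 3-graph on `n` vertices) is `γ`-extremal. -/
def IsExtremal {n : ℕ} (H : Finset (Finset (Fin n))) (γ : ℝ) : Prop :=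
  ∃ A B : Finset (Fin n), Disjoint A B ∧ A ∪ B = Finset.univ ∧
    A.card = n / 2 ∧ B.card = n - n / 2 ∧
    ((BGraph A B \ H).card : ℝ) ≤ γ * (n : ℝ) ^ 3

/-- The number of `V₁V₂V₃`-edges of `H`. -/
def eCount {n : ℕ} (H : Finset (Finset (Fin n))) (A B C : Finset (Fin n)) : ℕ :=
  (H.filter fun e => ∃ a ∈ A, ∃ b ∈ B, ∃ c ∈ C, e = {a, b, c}).card

/-- `Ñ_{c,η}(x)` : the set of vertices `(c,η)`-close to `x` in `H`. -/
def Ntilde {n : ℕ} (H : Finset (Finset (Fin n))) (c : ℕ) (η : ℝ) (x : Fin n) :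
    Set (Fin n) :=
  {y | y ≠ x ∧ Close H c η x y}

/-- The triple `{x,x',y}` is `(ρ,X,Y)`-typical. -/
def TypicalTriple {n : ℕ} (H : Finset (Finset (Fin n))) (ρ : ℝ) (X Y : Finset (Fin n))
    (x x' y : Fin n) : Prop :=
  (Y.card : ℝ) - ρ * n ≤ (degOn H x x' Y : ℝ) ∧
  (((X.filter fun z => ({x, y, z} : Finset (Fin n)) ∈ H ∧
      ({x', y, z} : Finset (Fin n)) ∈ H).card : ℝ) ≤ ρ * n) ∧
  (X.card : ℝ) - ρ * n ≤ (degOn H x y X : ℝ) + (degOn H x' y X : ℝ)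

/-- `Q` spans an `(X,Y)`-bridge of length 1, i.e. `Q = {a,b} ∪ S` for some
`(X,Y)`-bridge `(a,b,S)` of length 1. -/
def SpansBridge1 {n : ℕ} (H : Finset (Finset (Fin n))) (X Y Q : Finset (Fin n)) : Prop :=
  ∃ a ∈ X, ∃ b ∈ Y, ∃ S : Finset (Fin n), IsConnector H 1 a b S ∧
    Q = insert a (insert b S)


/-- A symmetric, irreflexive ternary relation. -/
structure Sym3 {α : Type*} (E : α → α → α → Prop) : Prop where
  s1 : ∀ x y z, E x y z → E y x z
  s2 : ∀ x y z, E x y z → E x z y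
  ne : ∀ x y z, E x y z → x ≠ y

set_option maxHeartbeats 4000000 in
theorem graph_lemma {α : Type*} [DecidableEq α] (L : Finset α) (G : α → α → Prop)
    [DecidableRel G] (hs : ∀ u w, G u w → G w u)
    (htf : ∀ u ∈ L, ∀ v ∈ L, ∀ w ∈ L, G u v → G v w → G u w → False)
    (M ε : ℝ) (hM : 0 < M) (hε : 0 < ε) (hε1 : ε ≤ 1 / 10000000)
    (hL1 : (1 - ε) * M ≤ #L) (hL2 : (#L : ℝ) ≤ M)
    (hd1 : ∀ u ∈ L, (1 / 3 - ε) * M ≤ #(L.filter (G u)))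
    (hd2 : ∀ u ∈ L, (#(L.filter (G u)) : ℝ) ≤ (1 / 3 + ε) * M)
    (e : α → α → ℝ) (he0 : ∀ u w, 0 ≤ e u w)
    (he : ∀ u ∈ L, ∀ w ∈ L, ¬ G u w → M / 6 - #(L.filter (G u) ∩ L.filter (G w)) ≤ e u w)
    (hsum : ∑ u ∈ L, ∑ w ∈ L, e u w ≤ 2 * ε * M ^ 3) : False := by
  have hLM : M / 2 ≤ #L := by nlinarith
  have hLpos : (0 : ℝ) < #L := by linarith
  have hLne : L.Nonempty := by
    rw [← Finset.card_pos]; exact_mod_cast hLpos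
  -- choose y1
  obtain ⟨y1, hy1, hD1⟩ : ∃ y ∈ L, ∑ w ∈ L, e y w ≤ 4 * ε * M ^ 2 := by
    apply Finset.exists_le_of_sum_le hLne
    rw [Finset.sum_const, nsmul_eq_mul]
    have : 0 ≤ 4 * ε * M ^ 2 := by positivity
    nlinarith
  -- the nonneighbours of y1
  set S := L.filter (fun w => ¬ G y1 w) with hS
  have hSc : (#(L.filter (G y1)) : ℝ) + #S = #L := by
    exact_mod_cast Finset.card_filter_add_card_filter_not (s := L) (G y1)
  have hS1 : (2 / 3 - 2 * ε) * M ≤ #S := by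
    have := hd2 y1 hy1
    nlinarith
  have hSne : S.Nonempty := by
    rw [← Finset.card_pos]
    have : (0 : ℝ) < #S := by nlinarith
    exact_mod_cast this
  have hcod : ∑ w ∈ S, (#(L.filter (G y1) ∩ L.filter (G w)) : ℝ) ≤ (1 / 3 + ε) ^ 2 * M ^ 2 := by
    have h1 : ∑ w ∈ S, (#(L.filter (G y1) ∩ L.filter (G w)) : ℝ)
        ≤ ∑ w ∈ L, (#(L.filter (G y1) ∩ L.filter (G w)) : ℝ) :=
      Finset.sum_le_sum_of_subset_of_nonneg (Finset.filter_subset _ _) (fun _ _ _ => by positivity)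
    have h2 : ∑ w ∈ L, #(L.filter (G y1) ∩ L.filter (G w))
        = ∑ z ∈ L.filter (G y1), #(L.filter (G z)) := by
      have h3 : ∀ w ∈ L, L.filter (G y1) ∩ L.filter (G w) = (L.filter (G y1)).filter (G w) := by
        intro w _; ext z; simp only [mem_inter, mem_filter]; tauto
      rw [Finset.sum_congr rfl (fun w hw => by rw [h3 w hw])]
      have := Finset.sum_card_bipartiteAbove_eq_sum_card_bipartiteBelow (s := L)
        (t := L.filter (G y1)) G
      simp only [Finset.bipartiteAbove, Finset.bipartiteBelow] at this
      rw [this]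
      refine Finset.sum_congr rfl fun z _ => ?_
      congr 1; ext w; simp only [mem_filter]
      exact ⟨fun h => ⟨h.1, hs _ _ h.2⟩, fun h => ⟨h.1, hs _ _ h.2⟩⟩
    have h4 : ∑ w ∈ L, (#(L.filter (G y1) ∩ L.filter (G w)) : ℝ)
        = ∑ z ∈ L.filter (G y1), (#(L.filter (G z)) : ℝ) := by exact_mod_cast h2
    have h5 : ∑ z ∈ L.filter (G y1), (#(L.filter (G z)) : ℝ)
        ≤ ∑ z ∈ L.filter (G y1), (1 / 3 + ε) * M :=
      Finset.sum_le_sum fun z hz => hd2 z (Finset.mem_filter.1 hz).1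
    rw [Finset.sum_const, nsmul_eq_mul] at h5
    have h6 := hd2 y1 hy1
    have : 0 ≤ (1 / 3 + ε) * M := by positivity
    nlinarith
  obtain ⟨y2, hy2S, hF⟩ : ∃ y ∈ S, (∑ w ∈ L, e y w) / M
      + ((#(L.filter (G y1) ∩ L.filter (G y)) : ℝ) - M / 6) + 2 * e y1 y ≤ 24 * ε * M := by
    apply Finset.exists_le_of_sum_le hSne
    rw [Finset.sum_const, nsmul_eq_mul, Finset.sum_add_distrib, Finset.sum_add_distrib,
      ← Finset.sum_div, Finset.sum_sub_distrib, Finset.sum_const, nsmul_eq_mul, ← Finset.mul_sum]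
    have h1 : ∑ u ∈ S, ∑ w ∈ L, e u w ≤ 2 * ε * M ^ 3 :=
      (Finset.sum_le_sum_of_subset_of_nonneg (Finset.filter_subset _ _)
        (fun _ _ _ => Finset.sum_nonneg fun _ _ => he0 _ _)).trans hsum
    have h2 : ∑ u ∈ S, e y1 u ≤ 4 * ε * M ^ 2 :=
      (Finset.sum_le_sum_of_subset_of_nonneg (Finset.filter_subset _ _)
        (fun _ _ _ => he0 _ _)).trans hD1
    have h3 : (∑ u ∈ S, ∑ w ∈ L, e u w) / M ≤ 2 * ε * M ^ 2 := by
      rw [div_le_iff₀ hM]; nlinarith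
    have h4 : (2 / 3 - 2 * ε) * M * (M / 6) ≤ #S * (M / 6) := by gcongr
    have h5 : (2 / 3 - 2 * ε) * M * (24 * ε * M) ≤ #S * (24 * ε * M) := by gcongr
    have h6 : ε * (M * M) ≤ 1 / 10000000 * (M * M) := by gcongr
    have h7 : 0 ≤ ε * (M * M) := by positivity
    have h8 : ε * (ε * (M * M)) ≤ 1 / 10000000 * (ε * (M * M)) := by gcongr
    have h9 : 0 ≤ ε * (ε * (M * M)) := by positivity
    nlinarith
  have hy2 : y2 ∈ L := (Finset.mem_filter.1 hy2S).1
  have hn12 : ¬ G y1 y2 := (Finset.mem_filter.1 hy2S).2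
  set C := L.filter (G y1) ∩ L.filter (G y2) with hC
  have hD2nn : 0 ≤ (∑ w ∈ L, e y2 w) / M :=
    div_nonneg (Finset.sum_nonneg fun _ _ => he0 _ _) hM.le
  have he12 := he y1 hy1 y2 hy2 hn12
  have he12' := he0 y1 y2
  rw [← hC] at he12
  have hCu : (#C : ℝ) ≤ M / 6 + 24 * ε * M := by linarith
  have hCl : M / 6 - 24 * ε * M ≤ (#C : ℝ) := by linarith
  have hD2 : ∑ w ∈ L, e y2 w ≤ 24 * ε * M ^ 2 := by
    have : (∑ w ∈ L, e y2 w) / M ≤ 24 * ε * M := by linarith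
    rw [div_le_iff₀ hM] at this; nlinarith
  set U := L \ (L.filter (G y1) ∪ L.filter (G y2)) with hU
  have hUL : U ⊆ L := Finset.sdiff_subset
  have hUc : M / 2 - 27 * ε * M ≤ #U := by
    have h1 : (#U : ℝ) + #(L.filter (G y1) ∪ L.filter (G y2)) = #L := by
      exact_mod_cast Finset.card_sdiff_add_card_eq_card
        (Finset.union_subset (Finset.filter_subset _ _) (Finset.filter_subset _ _))
    have h2 : (#(L.filter (G y1) ∪ L.filter (G y2)) : ℝ) + #C
        = #(L.filter (G y1)) + #(L.filter (G y2)) := by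
      exact_mod_cast Finset.card_union_add_card_inter _ _
    have := hd2 y1 hy1
    have := hd2 y2 hy2
    linarith
  have hCL : ∀ y ∈ C, y ∈ L ∧ G y1 y ∧ G y2 y := by
    intro y hy; simp only [hC, mem_inter, mem_filter] at hy; tauto
  -- h(x)
  have hswap : ∑ x ∈ U, (#(C.filter fun y => ¬ G x y) : ℝ)
      = ∑ y ∈ C, (#(U.filter fun x => ¬ G x y) : ℝ) := by
    have := Finset.sum_card_bipartiteAbove_eq_sum_card_bipartiteBelow (s := U)
        (t := C) (fun x y => ¬ G x y)
    simp only [Finset.bipartiteAbove, Finset.bipartiteBelow] at this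
    exact_mod_cast this
  have hlow : M ^ 2 / 144 ≤ ∑ x ∈ U, (#(C.filter fun y => ¬ G x y) : ℝ) := by
    rw [hswap]
    have h1 : ∀ y ∈ C, M / 12 ≤ (#(U.filter fun x => ¬ G x y) : ℝ) := by
      intro y hy
      have hyL := (hCL y hy).1
      have h2 : (#(U.filter fun x => G x y) : ℝ) + #(U.filter fun x => ¬ G x y) = #U := by
        exact_mod_cast Finset.card_filter_add_card_filter_not (s := U) (fun x => G x y)
      have h3 : (#(U.filter fun x => G x y) : ℝ) ≤ #(L.filter (G y)) := by
        have : U.filter (fun x => G x y) ⊆ L.filter (G y) := by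
          intro x hx; rw [mem_filter] at hx ⊢; exact ⟨hUL hx.1, hs _ _ hx.2⟩
        exact_mod_cast Finset.card_le_card this
      have := hd2 y hyL
      nlinarith
    have h2 := Finset.sum_le_sum h1
    rw [Finset.sum_const, nsmul_eq_mul] at h2
    have h3 : M / 12 ≤ (#C : ℝ) := by nlinarith
    nlinarith
  have hpt : ∀ x ∈ U, (#(C.filter fun y => ¬ G x y) : ℝ) ^ 2
      ≤ (25 * ε * M ^ 2) + ∑ y ∈ L, e x y + M * e y1 x + M * e y2 x := by
    intro x hx
    have hxL := hUL hx
    have hx1 : ¬ G y1 x := by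
      intro h; simp only [hU, mem_sdiff, mem_union, mem_filter] at hx; tauto
    have hx2 : ¬ G y2 x := by
      intro h; simp only [hU, mem_sdiff, mem_union, mem_filter] at hx; tauto
    set h := (#(C.filter fun y => ¬ G x y) : ℝ) with hh
    have hhM : h ≤ M := by
      have : #(C.filter fun y => ¬ G x y) ≤ #L := 
        Finset.card_le_card fun y hy => (hCL y (Finset.mem_filter.1 hy).1).1
      have : h ≤ #L := by rw [hh]; exact_mod_cast this
      linarith
    have hh0 : 0 ≤ h := by positivity
    have key : ∀ y ∈ C.filter (fun y => ¬ G x y),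
        h ≤ (25 * ε * M + e y1 x + e y2 x) + e x y := by
      intro y hy
      obtain ⟨hyC, hxy⟩ := Finset.mem_filter.1 hy
      obtain ⟨hyL, h1y, h2y⟩ := hCL y hyC
      have a1 := he y1 hy1 x hxL hx1
      have a2 := he y2 hy2 x hxL hx2
      have a3 := he x hxL y hyL hxy
      have a4 : (#(C.filter fun y => G x y) : ℝ) + h = #C := by
        rw [hh]
        exact_mod_cast Finset.card_filter_add_card_filter_not (s := C) (fun y => G x y)
      -- N1x, N2x, Nxy
      have a5 : (#((L.filter (G y1) ∩ L.filter (G x)) ∪ (L.filter (G y2) ∩ L.filter (G x))) : ℝ)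
          + #((L.filter (G y1) ∩ L.filter (G x)) ∩ (L.filter (G y2) ∩ L.filter (G x)))
          = #(L.filter (G y1) ∩ L.filter (G x)) + #(L.filter (G y2) ∩ L.filter (G x)) := by
        exact_mod_cast Finset.card_union_add_card_inter _ _
      have a6 : (L.filter (G y1) ∩ L.filter (G x)) ∩ (L.filter (G y2) ∩ L.filter (G x))
          = C.filter (fun y => G x y) := by
        ext z; simp only [hC, mem_inter, mem_filter]; tauto
      have a7 : Disjoint ((L.filter (G y1) ∩ L.filter (G x)) ∪ (L.filter (G y2) ∩ L.filter (G x)))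
          (L.filter (G x) ∩ L.filter (G y)) := by
        rw [Finset.disjoint_left]
        intro z hz hz2
        simp only [mem_union, mem_inter, mem_filter] at hz hz2
        rcases hz with hz | hz
        · exact htf y1 hy1 y hyL z hz.1.1 h1y hz2.2.2 hz.1.2
        · exact htf y2 hy2 y hyL z hz.1.1 h2y hz2.2.2 hz.1.2
      have a8 : (#((L.filter (G y1) ∩ L.filter (G x)) ∪ (L.filter (G y2) ∩ L.filter (G x))) : ℝ)
          + #(L.filter (G x) ∩ L.filter (G y)) ≤ #(L.filter (G x)) := by
        have : #(((L.filter (G y1) ∩ L.filter (G x)) ∪ (L.filter (G y2) ∩ L.filter (G x))) ∪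
          (L.filter (G x) ∩ L.filter (G y))) ≤ #(L.filter (G x)) := by
          apply Finset.card_le_card
          intro z; simp only [mem_union, mem_inter]; tauto
        rw [Finset.card_union_of_disjoint a7] at this
        exact_mod_cast this
      rw [a6] at a5
      have a9 := hd2 x hxL
      linarith
    have h1 := Finset.sum_le_sum key
    rw [Finset.sum_const, nsmul_eq_mul, ← hh, Finset.sum_add_distrib, Finset.sum_const,
      nsmul_eq_mul, ← hh] at h1
    have h2 : ∑ y ∈ C.filter (fun y => ¬ G x y), e x y ≤ ∑ y ∈ L, e x y :=
      Finset.sum_le_sum_of_subset_of_nonneg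
        (fun y hy => (hCL y (Finset.mem_filter.1 hy).1).1) (fun _ _ _ => he0 _ _)
    have h3 : h * (25 * ε * M + e y1 x + e y2 x) ≤ M * (25 * ε * M + e y1 x + e y2 x) := by
      have := he0 y1 x
      have := he0 y2 x
      gcongr
    nlinarith
  have hsq : ∑ x ∈ U, (#(C.filter fun y => ¬ G x y) : ℝ) ^ 2 ≤ 60 * ε * M ^ 3 := by
    refine (Finset.sum_le_sum hpt).trans ?_
    have hle : ∑ x ∈ U, (25 * ε * M ^ 2 + ∑ y ∈ L, e x y + M * e y1 x + M * e y2 x)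
        ≤ ∑ x ∈ L, (25 * ε * M ^ 2 + ∑ y ∈ L, e x y + M * e y1 x + M * e y2 x) := by
      refine Finset.sum_le_sum_of_subset_of_nonneg hUL fun x _ _ => ?_
      have := he0 y1 x
      have := he0 y2 x
      have := Finset.sum_nonneg (s := L) fun y _ => he0 x y
      positivity
    refine hle.trans ?_
    rw [Finset.sum_add_distrib, Finset.sum_add_distrib, Finset.sum_add_distrib, Finset.sum_const,
      nsmul_eq_mul, ← Finset.mul_sum, ← Finset.mul_sum]
    have b1 : (#L : ℝ) * (25 * ε * M ^ 2) ≤ M * (25 * ε * M ^ 2) := by gcongr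
    have b2 := mul_le_mul_of_nonneg_left hD1 hM.le
    have b3 := mul_le_mul_of_nonneg_left hD2 hM.le
    have b4 : 0 ≤ ε * M ^ 3 := by positivity
    linarith
  have hcs := sq_sum_le_card_mul_sum_sq (s := U) (f := fun x => (#(C.filter fun y => ¬ G x y) : ℝ))
  have hUM : (#U : ℝ) ≤ M := by
    have : (#U : ℝ) ≤ #L := by exact_mod_cast Finset.card_le_card hUL
    linarith
  have c1 : (M ^ 2 / 144) ^ 2 ≤ (∑ x ∈ U, (#(C.filter fun y => ¬ G x y) : ℝ)) ^ 2 :=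
    pow_le_pow_left₀ (by positivity) hlow 2
  have c2 : (#U : ℝ) * ∑ x ∈ U, (#(C.filter fun y => ¬ G x y) : ℝ) ^ 2 ≤ M * (60 * ε * M ^ 3) :=
    mul_le_mul hUM hsq (Finset.sum_nonneg fun _ _ => sq_nonneg _) hM.le
  have c3 : ε * M ^ 4 ≤ 1 / 10000000 * M ^ 4 := by gcongr
  have c4 : 0 < M ^ 4 := by positivity
  have c5 := c1.trans (hcs.trans c2)
  linarith

open Classical in
set_option maxHeartbeats 4000000 in
theorem turan_lemma {α : Type*} (E : α → α → α → Prop) (hE : Sym3 E)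
    (L : Finset α) (hm : (100000000 : ℝ) ≤ #L)
    (hcod : ∀ x ∈ L, ∀ y ∈ L, x ≠ y →
      (1 / 3 - 1 / 20000000) * (#L : ℝ) ≤ #(L.filter (E x y))) :
    ∃ x ∈ L, ∃ y ∈ L, ∃ z ∈ L, ∃ w ∈ L, E x y z ∧ E x y w ∧ E x z w := by
  by_contra hcon
  have hno : ∀ x ∈ L, ∀ y ∈ L, ∀ z ∈ L, ∀ w ∈ L, E x y z → E x y w → E x z w → False := by
    intro x hx y hy z hz w hw h1 h2 h3
    exact hcon ⟨x, hx, y, hy, z, hz, w, hw, h1, h2, h3⟩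
  have s1 := hE.s1
  have s2 := hE.s2
  have sne := hE.ne
  set M : ℝ := (#L : ℝ) with hMdef
  -- partition of the vertex set by an edge
  have part : ∀ x ∈ L, ∀ y ∈ L, ∀ z ∈ L, E x y z →
      (#(L.filter (E x y)) : ℝ) + #(L.filter (E x z)) + #(L.filter (E y z))
        + #(L.filter fun d => ¬ E x y d ∧ ¬ E x z d ∧ ¬ E y z d) ≤ M := by
    intro x hx y hy z hz hxyz
    have d1 : Disjoint (L.filter (E x y)) (L.filter (E x z)) := by
      rw [Finset.disjoint_left]; intro d h1 h2
      rw [mem_filter] at h1 h2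
      exact hno x hx y hy z hz d h1.1 hxyz h1.2 h2.2
    have d2 : Disjoint (L.filter (E x y) ∪ L.filter (E x z)) (L.filter (E y z)) := by
      rw [Finset.disjoint_left]; intro d h1 h2
      rw [mem_union, mem_filter, mem_filter] at h1
      rw [mem_filter] at h2
      rcases h1 with h1 | h1
      · exact hno y hy x hx z hz d h1.1 (s1 _ _ _ hxyz) (s1 _ _ _ h1.2) h2.2
      · exact hno z hz x hx y hy d h1.1 (s1 _ _ _ (s2 _ _ _ hxyz)) (s1 _ _ _ h1.2)
          (s1 _ _ _ h2.2)
    have d3 : Disjoint ((L.filter (E x y) ∪ L.filter (E x z)) ∪ L.filter (E y z))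
        (L.filter fun d => ¬ E x y d ∧ ¬ E x z d ∧ ¬ E y z d) := by
      rw [Finset.disjoint_left]; intro d h1 h2
      simp only [mem_union, mem_filter] at h1 h2
      tauto
    have h := Finset.card_le_card (s := ((L.filter (E x y) ∪ L.filter (E x z)) ∪ L.filter (E y z))
      ∪ (L.filter fun d => ¬ E x y d ∧ ¬ E x z d ∧ ¬ E y z d)) (t := L) (by
        intro d; simp only [mem_union, mem_filter]; tauto)
    rw [Finset.card_union_of_disjoint d3, Finset.card_union_of_disjoint d2,
      Finset.card_union_of_disjoint d1] at h
    rw [hMdef]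
    exact_mod_cast h
  have ne2 : ∀ x y z, E x y z → x ≠ z := fun x y z h => sne x z y (s2 _ _ _ h)
  have ne3 : ∀ x y z, E x y z → y ≠ z := fun x y z h => ne2 y x z (s1 _ _ _ h)
  have upper : ∀ x ∈ L, ∀ y ∈ L, x ≠ y →
      (#(L.filter (E x y)) : ℝ) ≤ (1 / 3 + 1 / 10000000) * M := by
    intro x hx y hy hxy
    have h1 := hcod x hx y hy hxy
    have : (0 : ℝ) < #(L.filter (E x y)) := by linarith
    have : (L.filter (E x y)).Nonempty := by
      rw [← Finset.card_pos]; exact_mod_cast this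
    obtain ⟨z, hz⟩ := this
    rw [mem_filter] at hz
    have h2 := part x hx y hy z hz.1 hz.2
    have h3 := hcod x hx z hz.1 (ne2 _ _ _ hz.2)
    have h4 := hcod y hy z hz.1 (ne3 _ _ _ hz.2)
    have h5 : (0 : ℝ) ≤ #(L.filter fun d => ¬ E x y d ∧ ¬ E x z d ∧ ¬ E y z d) := by positivity
    linarith
  have badb : ∀ x ∈ L, ∀ y ∈ L, ∀ z ∈ L, E x y z →
      (#(L.filter fun d => ¬ E x y d ∧ ¬ E x z d ∧ ¬ E y z d) : ℝ) ≤ 3 / 20000000 * M := by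
    intro x hx y hy z hz h
    have h2 := part x hx y hy z hz h
    have h1 := hcod x hx y hy (sne _ _ _ h)
    have h3 := hcod x hx z hz (ne2 _ _ _ h)
    have h4 := hcod y hy z hz (ne3 _ _ _ h)
    linarith
  have hLne : L.Nonempty := by
    rw [← Finset.card_pos]
    have : (0 : ℝ) < #L := by linarith
    exact_mod_cast this
  obtain ⟨v, hv⟩ := hLne
  set L' := L.erase v with hL'
  have hL'c : (#L' : ℝ) = M - 1 := by
    rw [hL', Finset.card_erase_of_mem hv, Nat.cast_sub (Finset.card_pos.2 ⟨v, hv⟩)]; simp [hMdef]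
  have mem' : ∀ u ∈ L', u ∈ L ∧ v ≠ u := fun u hu =>
    ⟨Finset.mem_of_mem_erase hu, (Finset.ne_of_mem_erase hu).symm⟩
  have hN : ∀ u, L'.filter (E v u) = L.filter (E v u) := by
    intro u
    ext z; simp only [hL', mem_filter, mem_erase]
    constructor
    · tauto
    · intro h; exact ⟨⟨(ne2 _ _ _ h.2).symm, h.1⟩, h.2⟩
  set bad : α → α → ℕ := fun u w =>
    #((L'.filter (E v u)).filter fun z => ¬ E v u w ∧ ¬ E v w z ∧ ¬ E u w z) with hbad
  have hbadsum : ∀ u ∈ L', ∑ w ∈ L', (bad u w : ℝ) ≤ 2 / 20000000 * M ^ 2 := by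
    intro u hu
    obtain ⟨huL, hvu⟩ := mem' u hu
    have h1 : ∑ w ∈ L', bad u w = ∑ z ∈ L'.filter (E v u),
        #(L'.filter fun w => ¬ E v u w ∧ ¬ E v w z ∧ ¬ E u w z) := by
      have := Finset.sum_card_bipartiteAbove_eq_sum_card_bipartiteBelow (s := L')
        (t := L'.filter (E v u)) (fun w z => ¬ E v u w ∧ ¬ E v w z ∧ ¬ E u w z)
      simpa only [Finset.bipartiteAbove, Finset.bipartiteBelow] using this
    have h2 : ∑ w ∈ L', (bad u w : ℝ) = ∑ z ∈ L'.filter (E v u),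
        (#(L'.filter fun w => ¬ E v u w ∧ ¬ E v w z ∧ ¬ E u w z) : ℝ) := by exact_mod_cast h1
    rw [h2]
    have h3 : ∀ z ∈ L'.filter (E v u),
        (#(L'.filter fun w => ¬ E v u w ∧ ¬ E v w z ∧ ¬ E u w z) : ℝ) ≤ 3 / 20000000 * M := by
      intro z hz
      rw [mem_filter] at hz
      refine le_trans ?_ (badb v hv u huL z (mem' z hz.1).1 hz.2)
      have : (L'.filter fun w => ¬ E v u w ∧ ¬ E v w z ∧ ¬ E u w z) ⊆
          (L.filter fun d => ¬ E v u d ∧ ¬ E v z d ∧ ¬ E u z d) := by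
        intro w hw
        rw [mem_filter] at hw ⊢
        exact ⟨(mem' w hw.1).1, hw.2.1, fun h => hw.2.2.1 (s2 _ _ _ h),
          fun h => hw.2.2.2 (s2 _ _ _ h)⟩
      exact_mod_cast Finset.card_le_card this
    have h4 := Finset.sum_le_sum h3
    rw [Finset.sum_const, nsmul_eq_mul, hN u] at h4
    have h5 := upper v hv u huL hvu
    rw [hN u]
    nlinarith
  refine graph_lemma L' (E v) (fun u w h => s2 _ _ _ h) ?_ M (1 / 10000000) (by linarith)
    (by norm_num) le_rfl (by rw [hL'c]; linarith) (by rw [hL'c]; linarith) ?_ ?_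
    (fun u w => 2 / 20000000 * M + ((bad u w : ℝ) + bad w u) / 2) ?_ ?_ ?_
  · intro a ha b hb c hc h1 h2 h3
    exact hno v hv a (mem' a ha).1 b (mem' b hb).1 c (mem' c hc).1 h1 h3 h2
  · intro u hu
    obtain ⟨huL, hvu⟩ := mem' u hu
    have := hcod v hv u huL hvu
    rw [hN]; linarith
  · intro u hu
    obtain ⟨huL, hvu⟩ := mem' u hu
    rw [hN]; exact upper v hv u huL hvu
  · intro u w
    have : 0 ≤ M := by linarith
    positivity
  · intro u hu w hw huw
    obtain ⟨huL, hvu⟩ := mem' u hu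
    obtain ⟨hwL, hvw⟩ := mem' w hw
    have du := hcod v hv u huL hvu
    have dw := hcod v hv w hwL hvw
    rw [← hN] at du dw
    have hM0 : 0 ≤ M := by linarith
    by_cases huw' : u = w
    · subst huw'
      rw [Finset.inter_self]
      have : (0 : ℝ) ≤ bad u u := by positivity
      linarith
    · have up := upper u huL w hwL huw'
      have c1 : (#(L'.filter (E v u) \ L'.filter (E v w)) : ℝ)
          + #(L'.filter (E v u) ∩ L'.filter (E v w)) = #(L'.filter (E v u)) := by
        exact_mod_cast Finset.card_sdiff_add_card_inter _ _
      have c2 : (#(L'.filter (E v w) \ L'.filter (E v u)) : ℝ)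
          + #(L'.filter (E v u) ∩ L'.filter (E v w)) = #(L'.filter (E v w)) := by
        rw [Finset.inter_comm]
        exact_mod_cast Finset.card_sdiff_add_card_inter _ _
      have dj : Disjoint (L'.filter (E v u) \ L'.filter (E v w))
          (L'.filter (E v w) \ L'.filter (E v u)) := by
        rw [Finset.disjoint_left]; intro z; simp only [mem_sdiff]; tauto
      have sub : (L'.filter (E v u) \ L'.filter (E v w)) ∪ (L'.filter (E v w) \ L'.filter (E v u))
          ⊆ L.filter (E u w) ∪
            (((L'.filter (E v u)).filter fun z => ¬ E v u w ∧ ¬ E v w z ∧ ¬ E u w z) ∪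
            ((L'.filter (E v w)).filter fun z => ¬ E v w u ∧ ¬ E v u z ∧ ¬ E w u z)) := by
        intro z hz
        have i1 : E v w u → E v u w := s2 _ _ _
        have i2 : E w u z → E u w z := s1 _ _ _
        have i3 : z ∈ L' → z ∈ L := fun h => (mem' z h).1
        simp only [mem_union, mem_sdiff, mem_filter] at hz ⊢
        tauto
      have c3 := Finset.card_le_card sub
      rw [Finset.card_union_of_disjoint dj] at c3
      have c4 := c3.trans ((Finset.card_union_le _ _).trans
        (Nat.add_le_add_left (Finset.card_union_le _ _) _))
      have c5 : (#(L'.filter (E v u) \ L'.filter (E v w)) : ℝ)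
          + #(L'.filter (E v w) \ L'.filter (E v u))
          ≤ #(L.filter (E u w)) + ((bad u w : ℝ) + bad w u) := by exact_mod_cast c4
      linarith
  · have hM0 : 0 ≤ M := by linarith
    have h1 := Finset.sum_le_sum hbadsum
    rw [Finset.sum_const, nsmul_eq_mul] at h1
    have h2 : ∑ u ∈ L', ∑ w ∈ L', (bad w u : ℝ) = ∑ u ∈ L', ∑ w ∈ L', (bad u w : ℝ) :=
      Finset.sum_comm
    have h3 : ∑ u ∈ L', ∑ w ∈ L', (2 / 20000000 * M + ((bad u w : ℝ) + bad w u) / 2)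
        = #L' * (#L' * (2 / 20000000 * M)) + ∑ u ∈ L', ∑ w ∈ L', (bad u w : ℝ) := by
      simp only [Finset.sum_add_distrib, Finset.sum_const, nsmul_eq_mul, ← Finset.sum_div, h2]
      ring
    rw [h3]
    have hl : (#L' : ℝ) ≤ M := by rw [hL'c]; linarith
    have h4 : (#L' : ℝ) * (2 / 20000000 * M ^ 2) ≤ M * (2 / 20000000 * M ^ 2) := by gcongr
    have h5 : (#L' : ℝ) * (#L' * (2 / 20000000 * M)) ≤ M * (M * (2 / 20000000 * M)) := by gcongr
    nlinarith

open Classical in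
set_option maxHeartbeats 4000000 in
theorem core_lemma {α : Type*} (E : α → α → α → Prop) (hE : Sym3 E)
    (U : Finset α) (hk : (1000000000 : ℝ) ≤ #U)
    (hcod : ∀ x ∈ U, ∀ y ∈ U, x ≠ y →
      (1 / 2 - 1 / 1000000000000) * (#U : ℝ) ≤ #(U.filter (E x y)))
    (w : α → ℝ) (hw0 : ∀ x ∈ U, 0 ≤ w x) (hws : ∑ x ∈ U, w x ≤ (#U : ℝ) / 4)
    (x0 : α) (hx0 : x0 ∈ U) (hwx0 : w x0 = 0) :
    ∃ x ∈ U, ∃ y ∈ U, ∃ z ∈ U, ∃ t ∈ U, (E x y z ∧ E x y t ∧ E x z t) ∧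
      w x + w y + w z + w t ≤ 1 := by
  by_contra hcon
  have htile : ∀ x ∈ U, ∀ y ∈ U, ∀ z ∈ U, ∀ t ∈ U, E x y z → E x y t → E x z t →
      1 < w x + w y + w z + w t := by
    intro x hx y hy z hz t ht h1 h2 h3
    by_contra h
    exact hcon ⟨x, hx, y, hy, z, hz, t, ht, ⟨h1, h2, h3⟩, not_lt.1 h⟩
  have s1 := hE.s1
  have s2 := hE.s2
  have sne := hE.ne
  have ne2 : ∀ x y z, E x y z → x ≠ z := fun x y z h => sne x z y (s2 _ _ _ h)
  have ne3 : ∀ x y z, E x y z → y ≠ z := fun x y z h => ne2 y x z (s1 _ _ _ h)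
  set k : ℝ := (#U : ℝ) with hkdef
  have hk0 : 0 < k := by linarith
  -- extending an edge
  have ext : ∀ x ∈ U, ∀ y ∈ U, ∀ z ∈ U, E x y z → ∃ D ⊆ U,
      (1 / 4 - 3 / 2000000000000) * k ≤ #D ∧ ∀ d ∈ D, 1 < w x + w y + w z + w d := by
    intro x hx y hy z hz h
    set A := U.filter (E x y) with hA
    set B := U.filter (E x z) with hB
    set C := U.filter (E y z) with hC
    have cA := hcod x hx y hy (sne _ _ _ h)
    have cB := hcod x hx z hz (ne2 _ _ _ h)
    have cC := hcod y hy z hz (ne3 _ _ _ h)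
    rw [← hA] at cA
    rw [← hB] at cB
    rw [← hC] at cC
    refine ⟨(A ∩ B) ∪ ((A ∪ B) ∩ C), ?_, ?_, ?_⟩
    · intro d hd
      simp only [hA, hB, hC, mem_union, mem_inter, mem_filter] at hd
      tauto
    · have e1 : (#(A ∪ B) : ℝ) + #(A ∩ B) = #A + #B := by
        exact_mod_cast Finset.card_union_add_card_inter A B
      have e2 : (#((A ∪ B) ∪ C) : ℝ) + #((A ∪ B) ∩ C) = #(A ∪ B) + #C := by
        exact_mod_cast Finset.card_union_add_card_inter (A ∪ B) C
      have e3 : (#((A ∪ B) ∪ C) : ℝ) ≤ k := by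
        have : #((A ∪ B) ∪ C) ≤ #U := Finset.card_le_card (by
          intro d hd
          simp only [hA, hB, hC, mem_union, mem_filter] at hd
          tauto)
        rw [hkdef]; exact_mod_cast this
      have e4 : (#(A ∩ B) : ℝ) ≤ #((A ∩ B) ∪ ((A ∪ B) ∩ C)) := by
        exact_mod_cast Finset.card_le_card Finset.subset_union_left
      have e5 : (#((A ∪ B) ∩ C) : ℝ) ≤ #((A ∩ B) ∪ ((A ∪ B) ∩ C)) := by
        exact_mod_cast Finset.card_le_card Finset.subset_union_right
      linarith
    · intro d hd
      simp only [hA, hB, hC, mem_union, mem_inter, mem_filter] at hd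
      rcases hd with hd | ⟨hd | hd, hd'⟩
      · exact htile x hx y hy z hz d hd.1.1 h hd.1.2 hd.2.2
      · have := htile y hy x hx z hz d hd.1 (s1 _ _ _ h) (s1 _ _ _ hd.2) hd'.2
        linarith
      · have := htile z hz x hx y hy d hd.1 (s1 _ _ _ (s2 _ _ _ h)) (s1 _ _ _ hd.2)
          (s1 _ _ _ hd'.2)
        linarith
  have indsum : ∀ S ⊆ U, ∀ c : ℝ, ∑ v ∈ U, (if v ∈ S then c else 0) = #S * c := by
    intro S hS c
    rw [← Finset.sum_filter, Finset.filter_mem_eq_inter, Finset.inter_eq_right.2 hS,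
      Finset.sum_const, nsmul_eq_mul]
  by_cases hcase : ∃ x ∈ U, ∃ y ∈ U, ∃ z ∈ U, E x y z ∧ w x ≤ 1 / 1000000000 ∧
      w y ≤ 1 / 1000000000 ∧ w z ≤ 1 / 1000000000
  · obtain ⟨x, hx, y, hy, z, hz, hxyz, wx, wy, wz⟩ := hcase
    obtain ⟨D, hDU, hDc, hD⟩ := ext x hx y hy z hz hxyz
    set B := U.filter (fun v => ¬ w v ≤ 1 / 4) with hB
    set L := U.filter (fun v => w v ≤ 1 / 4) with hL
    have hLB : (#L : ℝ) + #B = k := by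
      rw [hkdef]
      exact_mod_cast Finset.card_filter_add_card_filter_not (s := U) (fun v => w v ≤ 1 / 4)
    have hpt : ∀ v ∈ U, (if v ∈ B then (1 / 4 : ℝ) else 0)
        + (if v ∈ D then (3 / 4 - 3 / 1000000000 : ℝ) else 0) ≤ w v := by
      intro v hv
      by_cases h1 : v ∈ D
      · have := hD v h1
        split_ifs <;> linarith
      · rw [if_neg h1]
        split_ifs with h2
        · have := (Finset.mem_filter.1 h2).2
          linarith
        · linarith [hw0 v hv]
    have h1 := Finset.sum_le_sum hpt
    rw [Finset.sum_add_distrib, indsum B (Finset.filter_subset _ _), indsum D hDU] at h1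
    have hBc : (#B : ℝ) ≤ (1 / 4 + 4 / 1000000000) * k := by linarith
    obtain ⟨p, hp, q, hq, r, hr, t, ht, e1, e2, e3⟩ := turan_lemma E hE L (by linarith) (by
      intro p hp q hq hpq
      have hp' := Finset.mem_filter.1 hp
      have hq' := Finset.mem_filter.1 hq
      have := hcod p hp'.1 q hq'.1 hpq
      have h2 : U.filter (E p q) ⊆ L.filter (E p q) ∪ B := by
        intro v hv
        simp only [hL, hB, mem_union, mem_filter] at hv ⊢
        tauto
      have h3 : (#(U.filter (E p q)) : ℝ) ≤ #(L.filter (E p q)) + #B := by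
        exact_mod_cast (Finset.card_le_card h2).trans (Finset.card_union_le _ _)
      linarith)
    have hp' := Finset.mem_filter.1 hp
    have hq' := Finset.mem_filter.1 hq
    have hr' := Finset.mem_filter.1 hr
    have ht' := Finset.mem_filter.1 ht
    have := htile p hp'.1 q hq'.1 r hr'.1 t ht'.1 e1 e2 e3
    linarith [hp'.2, hq'.2, hr'.2, ht'.2]
  · have hZ : ∀ x ∈ U, ∀ y ∈ U, ∀ z ∈ U, E x y z → w x ≤ 1 / 1000000000 →
        w y ≤ 1 / 1000000000 → 1 / 1000000000 < w z := by
      intro x hx y hy z hz h h1 h2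
      by_contra h3
      exact hcase ⟨x, hx, y, hy, z, hz, h, h1, h2, not_lt.1 h3⟩
    have hne : (U.erase x0).Nonempty := by
      rw [← Finset.card_pos, Finset.card_erase_of_mem hx0]
      have : (1 : ℝ) < #U := by linarith
      have : 1 < #U := by exact_mod_cast this
      omega
    obtain ⟨y0, hy0, hy0min⟩ := Finset.exists_min_image (U.erase x0) w hne
    have hy0U := Finset.mem_of_mem_erase hy0
    have hxy0 : x0 ≠ y0 := (Finset.ne_of_mem_erase hy0).symm
    set N := U.filter (E x0 y0) with hN
    have hNU : N ⊆ U := Finset.filter_subset _ _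
    have hNc := hcod x0 hx0 y0 hy0U hxy0
    rw [← hN] at hNc
    have hNne : N.Nonempty := by
      rw [← Finset.card_pos]
      have : (0 : ℝ) < #N := by linarith
      exact_mod_cast this
    obtain ⟨c, hc, hcmin⟩ := Finset.exists_min_image N w hNne
    have hc' := Finset.mem_filter.1 hc
    have hcne : c ∈ U.erase x0 := Finset.mem_erase.2 ⟨(ne2 _ _ _ hc'.2).symm, hc'.1⟩
    set q := w y0 with hq
    set a := w c with ha
    have hqa : q ≤ a := hy0min c hcne
    have hq0 : 0 ≤ q := hw0 _ hy0U
    obtain ⟨b, hab, D, hDU, hDc, hDb, hsum⟩ : ∃ b ≥ a, ∃ D ⊆ U,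
        (1 / 4 - 3 / 2000000000000) * k ≤ #D ∧ (∀ d ∈ D, b ≤ w d) ∧ 1 < q + a + b := by
      obtain ⟨D, hDU, hDc, hD⟩ := ext x0 hx0 y0 hy0U c hc'.1 hc'.2
      have hDne : D.Nonempty := by
        rw [← Finset.card_pos]
        have : (0 : ℝ) < #D := by linarith
        exact_mod_cast this
      obtain ⟨d, hd, hdmin⟩ := Finset.exists_min_image D w hDne
      have h1 := hD d hd
      rw [hwx0] at h1
      by_cases h : a ≤ w d
      · exact ⟨w d, h, D, hDU, hDc, hdmin, by linarith⟩
      · exact ⟨a, le_rfl, N, hNU, by linarith, hcmin, by linarith⟩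
    have p1 : (a - q) * ((1 / 2 - 1 / 1000000000000) * k) ≤ #N * (a - q) := by
      rw [mul_comm]; exact mul_le_mul_of_nonneg_right hNc (by linarith)
    have p2 : (b - a) * ((1 / 4 - 3 / 2000000000000) * k) ≤ #D * (b - a) := by
      rw [mul_comm]; exact mul_le_mul_of_nonneg_right hDc (by linarith)
    have p3 : k < (q + a + b) * k := by nlinarith
    have p4 : q * 1000000000 ≤ q * k := by gcongr
    have p5 : 0 ≤ q * k := by positivity
    have p6 : q * k ≤ a * k := by gcongr
    have hq12 : q ≤ 12 / 1000000000000 := by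
      have hpt : ∀ v ∈ U, (if v ∈ U.erase x0 then q else 0)
          + (if v ∈ N then a - q else 0) + (if v ∈ D then b - a else 0) ≤ w v := by
        intro v hv
        have hh : v ∉ U.erase x0 → v ∉ N := by
          intro h1 h2
          apply h1
          exact Finset.mem_erase.2 ⟨(ne2 _ _ _ (Finset.mem_filter.1 h2).2).symm, hv⟩
        by_cases h1 : v ∈ D
        · have := hDb v h1
          split_ifs <;> linarith
        · rw [if_neg h1]
          by_cases h2 : v ∈ N
          · have := hcmin v h2
            split_ifs <;> linarith
          · rw [if_neg h2]
            split_ifs with h3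
            · linarith [hy0min v h3]
            · linarith [hw0 v hv]
      have h1 := Finset.sum_le_sum hpt
      rw [Finset.sum_add_distrib, Finset.sum_add_distrib, indsum _ (Finset.erase_subset _ _),
        indsum N hNU, indsum D hDU, Finset.card_erase_of_mem hx0,
        Nat.cast_sub (Finset.card_pos.2 ⟨x0, hx0⟩)] at h1
      rw [← hkdef] at h1
      push_cast at h1
      have h2 : q * k ≤ 12 / 1000000000000 * k := by linarith
      exact le_of_mul_le_mul_right h2 hk0
    have hsa : 1 / 1000000000 < a :=
      hZ x0 hx0 y0 hy0U c hc'.1 hc'.2 (by rw [hwx0]; norm_num) (by linarith)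
    set B := U.filter (fun v => ¬ w v ≤ 1 / 1000000000) with hB
    set Z := U.filter (fun v => w v ≤ 1 / 1000000000) with hZdef
    have hZB : (#Z : ℝ) + #B = k := by
      rw [hkdef]
      exact_mod_cast Finset.card_filter_add_card_filter_not (s := U)
        (fun v => w v ≤ 1 / 1000000000)
    have p7 : (a - 1 / 1000000000) * ((1 / 2 - 1 / 1000000000000) * k)
        ≤ #N * (a - 1 / 1000000000) := by
      rw [mul_comm]; exact mul_le_mul_of_nonneg_right hNc (by linarith)
    have p8 : q * k ≤ 12 / 1000000000000 * k := by gcongr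
    have hBc : (#B : ℝ) ≤ (505 / 1000) * k := by
      have hpt : ∀ v ∈ U, (if v ∈ B then (1 / 1000000000 : ℝ) else 0)
          + (if v ∈ N then a - 1 / 1000000000 else 0) + (if v ∈ D then b - a else 0) ≤ w v := by
        intro v hv
        by_cases h1 : v ∈ D
        · have := hDb v h1
          split_ifs <;> linarith
        · rw [if_neg h1]
          by_cases h2 : v ∈ N
          · have := hcmin v h2
            split_ifs <;> linarith
          · rw [if_neg h2]
            split_ifs with h3
            · have := (Finset.mem_filter.1 h3).2
              linarith
            · linarith [hw0 v hv]
      have h1 := Finset.sum_le_sum hpt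
      rw [Finset.sum_add_distrib, Finset.sum_add_distrib, indsum _ (Finset.filter_subset _ _),
        indsum N hNU, indsum D hDU] at h1
      linarith
    have hZ3 : 2 < #Z := by
      have : (2 : ℝ) < #Z := by linarith
      exact_mod_cast this
    obtain ⟨x, y, z, hx, hy, hz, hxy, hxz, hyz⟩ := Finset.two_lt_card_iff.1 hZ3
    have hx' := Finset.mem_filter.1 hx
    have hy' := Finset.mem_filter.1 hy
    have hz' := Finset.mem_filter.1 hz
    have sub : ∀ x ∈ Z, ∀ y ∈ Z, U.filter (E x y) ⊆ B := by
      intro x hx y hy v hv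
      have hx' := Finset.mem_filter.1 hx
      have hy' := Finset.mem_filter.1 hy
      have hv' := Finset.mem_filter.1 hv
      rw [hB, mem_filter]
      exact ⟨hv'.1, not_le.2 (hZ x hx'.1 y hy'.1 v hv'.1 hv'.2 hx'.2 hy'.2)⟩
    set A1 := U.filter (E x y) with hA1
    set A2 := U.filter (E x z) with hA2
    set A3 := U.filter (E y z) with hA3
    have c1 := hcod x hx'.1 y hy'.1 hxy
    have c2 := hcod x hx'.1 z hz'.1 hxz
    have c3 := hcod y hy'.1 z hz'.1 hyz
    rw [← hA1] at c1
    rw [← hA2] at c2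
    rw [← hA3] at c3
    have b1 := sub x hx y hy
    have b2 := sub x hx z hz
    have b3 := sub y hy z hz
    have e1 : (#(A1 ∪ A2) : ℝ) + #(A1 ∩ A2) = #A1 + #A2 := by
      exact_mod_cast Finset.card_union_add_card_inter A1 A2
    have e2 : (#((A1 ∩ A2) ∪ A3) : ℝ) + #((A1 ∩ A2) ∩ A3) = #(A1 ∩ A2) + #A3 := by
      exact_mod_cast Finset.card_union_add_card_inter (A1 ∩ A2) A3
    have e3 : (#(A1 ∪ A2) : ℝ) ≤ #B := by
      exact_mod_cast Finset.card_le_card (Finset.union_subset b1 b2)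
    have e4 : (#((A1 ∩ A2) ∪ A3) : ℝ) ≤ #B := by
      exact_mod_cast Finset.card_le_card
        (Finset.union_subset (Finset.inter_subset_left.trans b1) b3)
    have hT : ∀ v ∈ U, (if v ∈ (A1 ∩ A2) ∩ A3 then (9 / 10 : ℝ) else 0) ≤ w v := by
      intro v hv
      split_ifs with h
      · simp only [hA1, hA2, hA3, mem_inter, mem_filter] at h
        have := htile v hv x hx'.1 y hy'.1 z hz'.1 (s1 _ _ _ (s2 _ _ _ h.1.1.2))
          (s1 _ _ _ (s2 _ _ _ h.1.2.2)) (s1 _ _ _ (s2 _ _ _ h.2.2))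
        linarith [hx'.2, hy'.2, hz'.2]
      · exact hw0 v hv
    have h1 := Finset.sum_le_sum hT
    rw [indsum _ (Finset.inter_subset_right.trans (Finset.filter_subset _ _))] at h1
    linarith

open Classical in
theorem dual_lemma {α : Type*} (E : α → α → α → Prop) (hE : Sym3 E)
    (U : Finset α) (hk : (1000000000 : ℝ) ≤ #U)
    (hcod : ∀ x ∈ U, ∀ y ∈ U, x ≠ y →
      (1 / 2 - 1 / 1000000000000) * (#U : ℝ) ≤ #(U.filter (E x y)))
    (g : α → ℝ) :
    ∃ x ∈ U, ∃ y ∈ U, ∃ z ∈ U, ∃ t ∈ U, (E x y z ∧ E x y t ∧ E x z t) ∧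
      #U * (g x + g y + g z + g t) ≤ 4 * ∑ v ∈ U, g v := by
  have hk0 : (0 : ℝ) < #U := by linarith
  have hne : U.Nonempty := by
    rw [← Finset.card_pos]; exact_mod_cast hk0
  obtain ⟨x0, hx0, hmin⟩ := Finset.exists_min_image U g hne
  set A := ∑ v ∈ U, (g v - g x0) with hA
  have hA' : A = ∑ v ∈ U, g v - #U * g x0 := by
    rw [hA, Finset.sum_sub_distrib, Finset.sum_const, nsmul_eq_mul]
  have hA0 : 0 ≤ A := Finset.sum_nonneg fun v hv => by linarith [hmin v hv]
  rcases hA0.eq_or_lt with h0 | hpos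
  · have hall : ∀ v ∈ U, g v = g x0 := by
      have := (Finset.sum_eq_zero_iff_of_nonneg
        (fun v hv => by linarith [hmin v hv] : ∀ v ∈ U, 0 ≤ g v - g x0)).1 h0.symm
      intro v hv; linarith [this v hv]
    obtain ⟨x, hx, y, hy, z, hz, t, ht, h, -⟩ := core_lemma E hE U hk hcod (fun _ => 0)
      (fun _ _ => le_rfl) (by simp only [Finset.sum_const_zero]; positivity) x0 hx0 rfl
    refine ⟨x, hx, y, hy, z, hz, t, ht, h, ?_⟩
    rw [hall x hx, hall y hy, hall z hz, hall t ht]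
    linarith
  · obtain ⟨x, hx, y, hy, z, hz, t, ht, h, hle⟩ := core_lemma E hE U hk hcod
      (fun v => (g v - g x0) * (#U / (4 * A)))
      (fun v hv => mul_nonneg (by linarith [hmin v hv]) (by positivity))
      (by
        rw [← Finset.sum_mul, ← hA]
        apply le_of_eq; field_simp) x0 hx0 (by simp)
    refine ⟨x, hx, y, hy, z, hz, t, ht, h, ?_⟩
    have h2 : (g x + g y + g z + g t - 4 * g x0) * (#U / (4 * A)) ≤ 1 := by linarith
    rw [← mul_div_assoc, div_le_one (by positivity)] at h2
    linarith

open Classical in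
theorem step_lemma {α ι : Type*} (E : α → α → α → Prop) (hE : Sym3 E)
    (U : Finset α) (hk : (1000000000 : ℝ) ≤ #U)
    (hcod : ∀ x ∈ U, ∀ y ∈ U, x ≠ y →
      (1 / 2 - 1 / 1000000000000) * (#U : ℝ) ≤ #(U.filter (E x y)))
    (Q : Finset ι) (S : ι → Finset α) (lam : ℝ) (hl : 0 < lam) (hl2 : 4 * lam ≤ #U - 4) :
    ∃ x ∈ U, ∃ y ∈ U, ∃ z ∈ U, ∃ t ∈ U, (E x y z ∧ E x y t ∧ E x z t) ∧
      ∑ i ∈ Q, Real.exp (-(lam * ((#(S i ∩ (U \ {x, y, z, t})) : ℝ) / #(U \ {x, y, z, t}))))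
        ≤ (∑ i ∈ Q, Real.exp (-(lam * ((#(S i ∩ U) : ℝ) / #U))))
          * (1 + 16 * lam ^ 2 / ((#U : ℝ) - 4) ^ 2) := by
  set W : ι → ℝ := fun i => Real.exp (-(lam * ((#(S i ∩ U) : ℝ) / #U))) with hW
  have hWpos : ∀ i, 0 < W i := fun i => Real.exp_pos _
  set g : α → ℝ := fun v => ∑ i ∈ Q, if v ∈ S i then W i else 0 with hg
  obtain ⟨x, hx, y, hy, z, hz, t, ht, hT, hle⟩ := dual_lemma E hE U hk hcod g
  refine ⟨x, hx, y, hy, z, hz, t, ht, hT, ?_⟩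
  obtain ⟨h1, h2, h3⟩ := hT
  have s1 := hE.s1
  have s2 := hE.s2
  have sne := hE.ne
  have ne2 : ∀ x y z, E x y z → x ≠ z := fun x y z h => sne x z y (s2 _ _ _ h)
  have ne3 : ∀ x y z, E x y z → y ≠ z := fun x y z h => ne2 y x z (s1 _ _ _ h)
  have n1 : x ≠ y := sne _ _ _ h1
  have n2 : x ≠ z := ne2 _ _ _ h1
  have n3 : x ≠ t := ne2 _ _ _ h2
  have n4 : y ≠ z := ne3 _ _ _ h1
  have n5 : y ≠ t := ne3 _ _ _ h2
  have n6 : z ≠ t := ne3 _ _ _ h3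
  have gsum : ∀ A : Finset α, ∑ v ∈ A, g v = ∑ i ∈ Q, W i * #(S i ∩ A) := by
    intro A
    rw [hg, Finset.sum_comm]
    refine Finset.sum_congr rfl fun i _ => ?_
    rw [← Finset.sum_filter, Finset.sum_const, nsmul_eq_mul, Finset.filter_mem_eq_inter,
      Finset.inter_comm, mul_comm]
  have hTg : g x + g y + g z + g t = ∑ v ∈ ({x, y, z, t} : Finset α), g v := by
    rw [Finset.sum_insert (by simp [n1, n2, n3]), Finset.sum_insert (by simp [n4, n5]),
      Finset.sum_insert (by simp [n6]), Finset.sum_singleton]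
    ring
  have hTc : #({x, y, z, t} : Finset α) = 4 := by
    rw [Finset.card_insert_of_notMem (by simp [n1, n2, n3]),
      Finset.card_insert_of_notMem (by simp [n4, n5]),
      Finset.card_insert_of_notMem (by simp [n6]), Finset.card_singleton]
  have hTU : ({x, y, z, t} : Finset α) ⊆ U := by
    intro v hv; simp only [mem_insert, mem_singleton] at hv
    rcases hv with rfl | rfl | rfl | rfl <;> assumption
  rw [hTg] at hle
  generalize ({x, y, z, t} : Finset α) = T at *
  set k : ℝ := (#U : ℝ) with hkdef
  have hk4 : 0 < k - 4 := by linarith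
  have hk0 : 0 < k := by linarith
  have hUT : (#(U \ T) : ℝ) = k - 4 := by
    have : (#(U \ T) : ℝ) + #T = #U := by
      exact_mod_cast Finset.card_sdiff_add_card_eq_card hTU
    rw [hTc] at this; push_cast at this; linarith
  rw [hUT]
  have hSi : ∀ i, (#(S i ∩ (U \ T)) : ℝ) = #(S i ∩ U) - #(S i ∩ T) := by
    intro i
    have e1 : S i ∩ (U \ T) = (S i ∩ U) \ (S i ∩ T) := by
      ext v; simp only [mem_inter, mem_sdiff]; tauto
    have e2 : (#((S i ∩ U) \ (S i ∩ T)) : ℝ) + #(S i ∩ T) = #(S i ∩ U) := by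
      exact_mod_cast Finset.card_sdiff_add_card_eq_card (Finset.inter_subset_inter_left hTU)
    rw [e1]; linarith
  have hpt : ∀ i ∈ Q, Real.exp (-(lam * ((#(S i ∩ (U \ T)) : ℝ) / (k - 4))))
      ≤ W i * (1 + 16 * lam ^ 2 / (k - 4) ^ 2)
        + lam / (k * (k - 4)) * (k * (W i * #(S i ∩ T)) - 4 * (W i * #(S i ∩ U))) := by
    intro i _
    rw [hSi]
    set s : ℝ := (#(S i ∩ U) : ℝ) with hs
    set r : ℝ := (#(S i ∩ T) : ℝ) with hr
    have hs0 : 0 ≤ s := by positivity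
    have hr0 : 0 ≤ r := by positivity
    have hsk : s ≤ k := by
      rw [hs, hkdef]; exact_mod_cast Finset.card_le_card Finset.inter_subset_right
    have hr4 : r ≤ 4 := by
      have : #(S i ∩ T) ≤ 4 := hTc ▸ Finset.card_le_card Finset.inter_subset_right
      rw [hr]; exact_mod_cast this
    set u : ℝ := lam * (k * r - 4 * s) / (k * (k - 4)) with hu
    have hexp : -(lam * ((s - r) / (k - 4))) = -(lam * (s / k)) + u := by
      rw [hu]; field_simp; ring
    have habs : |u| ≤ 4 * lam / (k - 4) := by
      rw [hu, abs_div, abs_mul, abs_of_pos hl, abs_of_pos (by positivity : 0 < k * (k - 4)),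
        div_le_div_iff₀ (by positivity) hk4]
      have : |k * r - 4 * s| ≤ 4 * k := by
        rw [abs_le]; constructor <;> nlinarith
      calc lam * |k * r - 4 * s| * (k - 4) ≤ lam * (4 * k) * (k - 4) := by gcongr
        _ = 4 * lam * (k * (k - 4)) := by ring
    have hu1 : |u| ≤ 1 := habs.trans (by rw [div_le_one hk4]; exact hl2)
    have hu2 : u ^ 2 ≤ 16 * lam ^ 2 / (k - 4) ^ 2 := by
      have : |u| ^ 2 ≤ (4 * lam / (k - 4)) ^ 2 := pow_le_pow_left₀ (abs_nonneg _) habs 2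
      rw [sq_abs, div_pow (4 * lam), mul_pow] at this
      calc u ^ 2 ≤ _ := this
        _ = _ := by norm_num
    have hexpu : Real.exp u ≤ 1 + u + u ^ 2 := by
      have := (abs_le.1 (Real.abs_exp_sub_one_sub_id_le hu1)).2
      linarith
    rw [hexp, Real.exp_add]
    have hWi : Real.exp (-(lam * (s / k))) = W i := rfl
    rw [hWi]
    have : W i * Real.exp u ≤ W i * (1 + 16 * lam ^ 2 / (k - 4) ^ 2 + u) := by
      apply mul_le_mul_of_nonneg_left _ (hWpos i).le
      linarith
    refine this.trans (le_of_eq ?_)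
    rw [hu]; ring
  refine (Finset.sum_le_sum hpt).trans ?_
  rw [Finset.sum_add_distrib, ← Finset.sum_mul, ← Finset.mul_sum, Finset.sum_sub_distrib,
    ← Finset.mul_sum, ← Finset.mul_sum, ← gsum, ← gsum]
  have : lam / (k * (k - 4)) * (k * ∑ v ∈ T, g v - 4 * ∑ v ∈ U, g v) ≤ 0 :=
    mul_nonpos_of_nonneg_of_nonpos (by positivity) (by linarith)
  linarith

theorem spans_of_edges {n : ℕ} (H : Finset (Finset (Fin n))) (x y z t : Fin n)
    (n1 : x ≠ y) (n2 : x ≠ z) (n3 : x ≠ t) (n4 : y ≠ z) (n5 : y ≠ t) (n6 : z ≠ t)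
    (h1 : ({x, y, z} : Finset (Fin n)) ∈ H) (h2 : ({x, y, t} : Finset (Fin n)) ∈ H)
    (h3 : ({x, z, t} : Finset (Fin n)) ∈ H) : SpansK4m H {x, y, z, t} := by
  have c3 : ∀ a b c : Fin n, a ≠ b → a ≠ c → b ≠ c → #({a, b, c} : Finset (Fin n)) = 3 := by
    intro a b c h1 h2 h3
    exact Finset.card_eq_three.2 ⟨a, b, c, h1, h2, h3, rfl⟩
  refine ⟨?_, ?_⟩
  · rw [Finset.card_insert_of_notMem (by simp [n1, n2, n3]), c3 _ _ _ n4 n5 n6]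
  · have d1 : ({x, y, z} : Finset (Fin n)) ≠ {x, y, t} := by
      intro h
      have : z ∈ ({x, y, t} : Finset (Fin n)) := h ▸ (by simp)
      simp only [mem_insert, mem_singleton] at this
      rcases this with h | h | h
      · exact n2 h.symm
      · exact n4 h.symm
      · exact n6 h
    have d2 : ({x, y, z} : Finset (Fin n)) ≠ {x, z, t} := by
      intro h
      have : y ∈ ({x, z, t} : Finset (Fin n)) := h ▸ (by simp)
      simp only [mem_insert, mem_singleton] at this
      rcases this with h | h | h
      · exact n1 h.symm
      · exact n4 h
      · exact n5 h
    have d3 : ({x, y, t} : Finset (Fin n)) ≠ {x, z, t} := by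
      intro h
      have : y ∈ ({x, z, t} : Finset (Fin n)) := h ▸ (by simp)
      simp only [mem_insert, mem_singleton] at this
      rcases this with h | h | h
      · exact n1 h.symm
      · exact n4 h
      · exact n5 h
    have : #({{x, y, z}, {x, y, t}, {x, z, t}} : Finset (Finset (Fin n))) = 3 :=
      Finset.card_eq_three.2 ⟨_, _, _, d1, d2, d3, rfl⟩
    refine this.symm.le.trans ?_
    apply Finset.card_le_card
    intro e he
    simp only [mem_insert, mem_singleton] at he
    rw [mem_filter, mem_powersetCard]
    rcases he with rfl | rfl | rfl
    · refine ⟨⟨?_, c3 _ _ _ n1 n2 n4⟩, h1⟩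
      intro v; simp only [mem_insert, mem_singleton]; tauto
    · refine ⟨⟨?_, c3 _ _ _ n1 n3 n5⟩, h2⟩
      intro v; simp only [mem_insert, mem_singleton]; tauto
    · refine ⟨⟨?_, c3 _ _ _ n2 n3 n6⟩, h3⟩
      intro v; simp only [mem_insert, mem_singleton]; tauto

theorem sym3_of_graph {n : ℕ} (H : Finset (Finset (Fin n))) (hH : Is3Graph n H) :
    Sym3 (fun x y z : Fin n => ({x, y, z} : Finset (Fin n)) ∈ H) where
  s1 := by
    intro x y z h
    have : ({y, x, z} : Finset (Fin n)) = {x, y, z} := by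
      ext v; simp only [mem_insert, mem_singleton]; tauto
    rw [this]; exact h
  s2 := by
    intro x y z h
    have : ({x, z, y} : Finset (Fin n)) = {x, y, z} := by
      ext v; simp only [mem_insert, mem_singleton]; tauto
    rw [this]; exact h
  ne := by
    intro x y z h hxy
    subst hxy
    have h1 := hH _ h
    have h2 : #({x, x, z} : Finset (Fin n)) ≤ 2 := by
      rw [Finset.insert_eq_of_mem (by simp)]
      exact Finset.card_le_two
    omega

theorem large_n (φ : ℝ) (hφ : 0 < φ) : ∃ n₀ : ℕ, ∀ n : ℕ, n₀ ≤ n →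
    (1000000000 : ℝ) ≤ φ * n ∧ 4 * √(n : ℝ) ≤ φ * n - 4 ∧
    (n : ℝ) ^ 2 * Real.exp (64 / φ ^ 2) ≤ Real.exp (1 / 10000000000000 * √(n : ℝ)) := by
  have ht : Filter.Tendsto (fun n : ℕ => √(n : ℝ)) Filter.atTop Filter.atTop :=
    Real.tendsto_sqrt_atTop.comp tendsto_natCast_atTop_atTop
  have e0 : ∀ᶠ y : ℝ in Filter.atTop, y ^ 4 * Real.exp (-y)
      < (1 / 10000000000000) ^ 4 * Real.exp (-(64 / φ ^ 2)) :=
    (Real.tendsto_pow_mul_exp_neg_atTop_nhds_zero 4).eventually_lt_const (by positivity)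
  have ht2 : Filter.Tendsto (fun n : ℕ => 1 / 10000000000000 * √(n : ℝ)) Filter.atTop
      Filter.atTop := ht.const_mul_atTop (by norm_num)
  have e1 := ht2.eventually e0
  have e2 := ht.eventually_ge_atTop (max 1 (8 / φ))
  have e3 := (tendsto_natCast_atTop_atTop (R := ℝ)).eventually_ge_atTop (1000000000 / φ)
  obtain ⟨n₀, h⟩ := Filter.eventually_atTop.1 (e1.and (e2.and e3))
  refine ⟨n₀, fun n hn => ?_⟩
  obtain ⟨h1, h2, h3⟩ := h n hn
  have hsq : √(n : ℝ) ^ 2 = n := Real.sq_sqrt (by positivity)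
  have h3' : (1000000000 : ℝ) ≤ φ * n := by
    rw [div_le_iff₀ hφ] at h3; linarith
  refine ⟨h3', ?_, ?_⟩
  · have h4 : 8 / φ ≤ √(n : ℝ) := (le_max_right _ _).trans h2
    rw [div_le_iff₀ hφ] at h4
    have h5 : 8 * √(n : ℝ) ≤ φ * n := by
      have h6 : 0 ≤ √(n : ℝ) := Real.sqrt_nonneg _
      nlinarith
    linarith
  · set y := 1 / 10000000000000 * √(n : ℝ) with hy
    have h4 : y ^ 4 = (1 / 10000000000000) ^ 4 * (n : ℝ) ^ 2 := by
      have h4s : √(n : ℝ) ^ 4 = (n : ℝ) ^ 2 := by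
        calc √(n : ℝ) ^ 4 = (√(n : ℝ) ^ 2) ^ 2 := by ring
          _ = _ := by rw [hsq]
      rw [hy, mul_pow, h4s]
    rw [h4, Real.exp_neg, Real.exp_neg, mul_assoc] at h1
    have h5 := lt_of_mul_lt_mul_left h1 (by positivity)
    rw [← div_eq_mul_inv, div_lt_iff₀ (Real.exp_pos _), inv_mul_eq_div,
      lt_div_iff₀ (Real.exp_pos _)] at h5
    exact h5.le

set_option maxHeartbeats 1000000 in
theorem main_induction (γ φ : ℝ) (hγ0 : γ ≤ 1 / 10000000000000) (hφ : 0 < φ)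
    (n : ℕ) (hn1 : (1000000000 : ℝ) ≤ φ * n) (hn2 : 4 * √(n : ℝ) ≤ φ * n - 4)
    (hn3 : (n : ℝ) ^ 2 * Real.exp (64 / φ ^ 2) ≤ Real.exp (1 / 10000000000000 * √(n : ℝ)))
    (H : Finset (Finset (Fin n))) (hH : Is3Graph n H)
    (hcod : CodegLB H ((1 / 2 - γ) * n)) (j : ℕ) :
    (∃ P : Finset (Finset (Fin n)),
      (∀ S ∈ P, SpansK4m H S) ∧ (∀ S ∈ P, ∀ T ∈ P, S ≠ T → Disjoint S T) ∧
      (((Finset.univ \ P.biUnion id).card : ℝ) ≤ φ * n)) ∨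
    (∃ P : Finset (Finset (Fin n)),
      (∀ S ∈ P, SpansK4m H S) ∧ (∀ S ∈ P, ∀ T ∈ P, S ≠ T → Disjoint S T) ∧ #P = j ∧
      ∑ p ∈ (Finset.univ : Finset (Fin n × Fin n)).filter (fun p => p.1 ≠ p.2),
        Real.exp (-(√(n : ℝ) * ((#((Finset.univ.filter fun z =>
          ({p.1, p.2, z} : Finset (Fin n)) ∈ H) ∩ (Finset.univ \ P.biUnion id)) : ℝ)
            / #(Finset.univ \ P.biUnion id))))
        ≤ (n : ℝ) ^ 2 * Real.exp (-(√(n : ℝ) * (1 / 2 - γ)))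
          * Real.exp (j * (64 / (φ ^ 2 * n)))) := by
  have hnpos : (0 : ℝ) < n := by
    by_contra h
    nlinarith
  have hsq : √(n : ℝ) ^ 2 = n := Real.sq_sqrt hnpos.le
  have hlam : 0 < √(n : ℝ) := Real.sqrt_pos.2 hnpos
  induction j with
  | zero =>
    right
    refine ⟨∅, by simp, by simp, by simp, ?_⟩
    simp only [Finset.biUnion_empty, Finset.sdiff_empty, Finset.inter_univ, Finset.card_univ,
      Fintype.card_fin, CharP.cast_eq_zero, zero_mul, Real.exp_zero, mul_one]
    have hpt : ∀ p ∈ (Finset.univ : Finset (Fin n × Fin n)).filter (fun p => p.1 ≠ p.2),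
        Real.exp (-(√(n : ℝ) * ((#(Finset.univ.filter fun z =>
          ({p.1, p.2, z} : Finset (Fin n)) ∈ H) : ℝ) / n)))
        ≤ Real.exp (-(√(n : ℝ) * (1 / 2 - γ))) := by
      intro p hp
      have h1 := hcod p.1 p.2 (Finset.mem_filter.1 hp).2
      unfold degOn at h1
      apply Real.exp_le_exp.2
      apply neg_le_neg
      apply mul_le_mul_of_nonneg_left _ hlam.le
      rw [le_div_iff₀ hnpos]; exact h1
    refine (Finset.sum_le_sum hpt).trans ?_
    rw [Finset.sum_const, nsmul_eq_mul]
    apply mul_le_mul_of_nonneg_right _ (Real.exp_pos _).le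
    have : #((Finset.univ : Finset (Fin n × Fin n)).filter (fun p => p.1 ≠ p.2)) ≤ n ^ 2 := by
      refine (Finset.card_filter_le _ _).trans ?_
      simp [sq]
    exact_mod_cast this
  | succ j ih =>
    rcases ih with ih | ⟨P, hP1, hP2, hPj, hΦ⟩
    · exact Or.inl ih
    by_cases hsmall : (((Finset.univ \ P.biUnion id).card : ℝ) ≤ φ * n)
    · exact Or.inl ⟨P, hP1, hP2, hsmall⟩
    right
    rw [not_le] at hsmall
    set U := Finset.univ \ P.biUnion id with hU
    set k : ℝ := (#U : ℝ) with hk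
    have hkpos : 0 < k := by linarith
    have hjn : (j : ℝ) ≤ n := by
      have h1 : #(P.biUnion id) = ∑ S ∈ P, #S :=
        Finset.card_biUnion fun S hS T hT hST => hP2 S hS T hT hST
      rw [Finset.sum_congr rfl fun S hS => (hP1 S hS).1, Finset.sum_const, hPj] at h1
      have h2 : #(P.biUnion id) ≤ n := by simpa using Finset.card_le_univ (P.biUnion id)
      rw [h1, smul_eq_mul] at h2
      have : j ≤ n := by omega
      exact_mod_cast this
    have hinter : ∀ x y : Fin n, (Finset.univ.filter fun z =>
          ({x, y, z} : Finset (Fin n)) ∈ H) ∩ U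
        = U.filter fun z => ({x, y, z} : Finset (Fin n)) ∈ H := by
      intro x y; ext v; simp only [mem_inter, mem_filter, mem_univ, true_and]; tauto
    have hcodU : ∀ x ∈ U, ∀ y ∈ U, x ≠ y → (1 / 2 - 1 / 1000000000000) * k
        ≤ #(U.filter fun z => ({x, y, z} : Finset (Fin n)) ∈ H) := by
      intro x _ y _ hxy
      have h1 := (Finset.single_le_sum (f := fun p : Fin n × Fin n =>
        Real.exp (-(√(n : ℝ) * ((#((Finset.univ.filter fun z =>
          ({p.1, p.2, z} : Finset (Fin n)) ∈ H) ∩ U) : ℝ) / k))))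
        (fun _ _ => (Real.exp_pos _).le)
        (Finset.mem_filter.2 ⟨Finset.mem_univ (x, y), hxy⟩)).trans hΦ
      simp only at h1
      rw [hinter] at h1
      have h2 : Real.exp (j * (64 / (φ ^ 2 * n))) ≤ Real.exp (64 / φ ^ 2) := by
        apply Real.exp_le_exp.2
        calc (j : ℝ) * (64 / (φ ^ 2 * n)) ≤ n * (64 / (φ ^ 2 * n)) := by gcongr
          _ = 64 / φ ^ 2 := by field_simp
      have h3 : (n : ℝ) ^ 2 * Real.exp (-(√(n : ℝ) * (1 / 2 - γ)))
          * Real.exp (j * (64 / (φ ^ 2 * n)))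
          ≤ Real.exp (-(√(n : ℝ) * (1 / 2 - γ))) * Real.exp (1 / 10000000000000 * √(n : ℝ)) := by
        calc (n : ℝ) ^ 2 * Real.exp (-(√(n : ℝ) * (1 / 2 - γ)))
              * Real.exp (j * (64 / (φ ^ 2 * n)))
            ≤ (n : ℝ) ^ 2 * Real.exp (-(√(n : ℝ) * (1 / 2 - γ))) * Real.exp (64 / φ ^ 2) := by
              gcongr
          _ = Real.exp (-(√(n : ℝ) * (1 / 2 - γ))) * ((n : ℝ) ^ 2 * Real.exp (64 / φ ^ 2)) := by
              ring
          _ ≤ _ := by gcongr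
      have h4 := h1.trans h3
      rw [← Real.exp_add] at h4
      have h5 := Real.exp_le_exp.1 h4
      have h6 : √(n : ℝ) * (1 / 2 - γ - 1 / 10000000000000) ≤ √(n : ℝ) *
          ((#(U.filter fun z => ({x, y, z} : Finset (Fin n)) ∈ H) : ℝ) / k) := by linarith
      have h7 := le_of_mul_le_mul_left h6 hlam
      rw [le_div_iff₀ hkpos] at h7
      refine le_trans ?_ h7
      apply mul_le_mul_of_nonneg_right _ hkpos.le
      linarith
    have hE := sym3_of_graph H hH
    obtain ⟨x, hx, y, hy, z, hz, t, ht, ⟨h1, h2, h3⟩, hle⟩ := step_lemma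
      (fun x y z : Fin n => ({x, y, z} : Finset (Fin n)) ∈ H) hE U (by linarith)
      (by convert hcodU)
      ((Finset.univ : Finset (Fin n × Fin n)).filter (fun p => p.1 ≠ p.2))
      (fun p => Finset.univ.filter fun z => ({p.1, p.2, z} : Finset (Fin n)) ∈ H)
      (√(n : ℝ)) hlam (by linarith)
    have sne := hE.ne
    have ne2 := fun x y z h => sne x z y (hE.s2 _ _ _ h)
    have ne3 := fun x y z h => ne2 y x z (hE.s1 _ _ _ h)
    have hspan : SpansK4m H {x, y, z, t} := spans_of_edges H x y z t (sne _ _ _ h1) (ne2 _ _ _ h1)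
      (ne2 _ _ _ h2) (ne3 _ _ _ h1) (ne3 _ _ _ h2) (ne3 _ _ _ h3) h1 h2 h3
    set T : Finset (Fin n) := {x, y, z, t} with hT
    have hTU : T ⊆ U := by
      intro v hv; simp only [hT, mem_insert, mem_singleton] at hv
      rcases hv with rfl | rfl | rfl | rfl <;> assumption
    have hTd : ∀ S ∈ P, Disjoint T S := by
      intro S hS
      rw [Finset.disjoint_left]
      intro v hv hvS
      have := hTU hv
      rw [hU, mem_sdiff] at this
      exact this.2 (Finset.mem_biUnion.2 ⟨S, hS, hvS⟩)
    have hTP : T ∉ P := by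
      intro h
      have h1 := hTd T h
      rw [disjoint_self, Finset.bot_eq_empty] at h1
      have := hspan.1
      rw [h1] at this
      simp at this
    have hU' : Finset.univ \ (insert T P).biUnion id = U \ T := by
      rw [Finset.biUnion_insert, hU]
      ext v; simp only [mem_sdiff, mem_union, mem_univ, true_and, id]; tauto
    refine ⟨insert T P, ?_, ?_, ?_, ?_⟩
    · intro S hS
      rcases Finset.mem_insert.1 hS with rfl | hS
      · exact hspan
      · exact hP1 S hS
    · intro S hS S' hS' hne
      rcases Finset.mem_insert.1 hS with rfl | hS <;> rcases Finset.mem_insert.1 hS' with rfl | hS'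
      · exact absurd rfl hne
      · exact hTd _ hS'
      · exact (hTd _ hS).symm
      · exact hP2 S hS S' hS' hne
    · rw [Finset.card_insert_of_notMem hTP, hPj]
    · rw [hU']
      have hfac : 1 + 16 * √(n : ℝ) ^ 2 / (k - 4) ^ 2 ≤ Real.exp (64 / (φ ^ 2 * n)) := by
        have h4 : 16 * √(n : ℝ) ^ 2 / (k - 4) ^ 2 ≤ 64 / (φ ^ 2 * n) := by
          rw [hsq]
          have h5 : φ * n / 2 ≤ k - 4 := by linarith
          calc 16 * (n : ℝ) / (k - 4) ^ 2 ≤ 16 * n / (φ * n / 2) ^ 2 := by gcongr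
            _ = 64 / (φ ^ 2 * n) := by field_simp; norm_num
        have := Real.add_one_le_exp (64 / (φ ^ 2 * n))
        linarith
      have h4 : ((j + 1 : ℕ) : ℝ) * (64 / (φ ^ 2 * n))
          = j * (64 / (φ ^ 2 * n)) + 64 / (φ ^ 2 * n) := by push_cast; ring
      rw [h4, Real.exp_add, ← mul_assoc]
      have h5 : (0 : ℝ) ≤ 1 + 16 * √(n : ℝ) ^ 2 / (k - 4) ^ 2 := by positivity
      have h6 := mul_le_mul hΦ hfac h5 (by positivity)
      refine le_trans (le_of_eq ?_) (hle.trans (le_trans (le_of_eq ?_) h6))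
      · congr!
      · congr!

/-- almost perfect `K₄⁻`-tiling. -/
theorem stmt_1 :
    ∃ γ₀ : ℝ, 0 < γ₀ ∧ ∀ γ : ℝ, 0 < γ → γ ≤ γ₀ →
      ∃ φ₀ : ℝ, 0 < φ₀ ∧ ∀ φ : ℝ, 0 < φ → φ ≤ φ₀ →
        ∃ n₀ : ℕ, ∀ n : ℕ, n₀ ≤ n →
          ∀ H : Finset (Finset (Fin n)), Is3Graph n H →
            CodegLB H ((1 / 2 - γ) * n) →
            ∃ P : Finset (Finset (Fin n)),
              (∀ S ∈ P, SpansK4m H S) ∧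
              (∀ S ∈ P, ∀ T ∈ P, S ≠ T → Disjoint S T) ∧
              (((Finset.univ \ P.biUnion id).card : ℝ) ≤ φ * n) := by
  refine ⟨1 / 10000000000000, by norm_num, fun γ _ hγ0 => ⟨1, one_pos, fun φ hφ _ => ?_⟩⟩
  obtain ⟨n₀, hn₀⟩ := large_n φ hφ
  refine ⟨n₀, fun n hn H hH hcod => ?_⟩
  obtain ⟨hn1, hn2, hn3⟩ := hn₀ n hn
  rcases main_induction γ φ hγ0 hφ n hn1 hn2 hn3 H hH hcod (n + 1) with h | ⟨P, hP1, hP2, hPj, -⟩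
  · exact h
  · exfalso
    have h1 : #(P.biUnion id) = ∑ S ∈ P, #S :=
      Finset.card_biUnion fun S hS T hT hST => hP2 S hS T hT hST
    rw [Finset.sum_congr rfl fun S hS => (hP1 S hS).1, Finset.sum_const, hPj] at h1
    have h2 : #(P.biUnion id) ≤ n := by simpa using Finset.card_le_univ (P.biUnion id)
    rw [h1, smul_eq_mul] at h2
    omega
end

section
/- There exist γ > 0 and n₀ ∈ ℕ such that the following holds. Suppose H is a 3-graph on n ≥ n₀ vertices where n is divisible by 4. If δ₂(H) ≥ n/2 − 1 and H is γ-extremal, then H contains a K₄⁻-factor. -/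
open Finset

theorem swap_lemma (m D : ℕ) (E : Fin m → Fin m → Fin m → Fin m → Prop)
    [∀ i j k l, Decidable (E i j k l)]
    (h0 : ∀ i, (univ.filter fun t : Fin m × Fin m × Fin m => ¬ E i t.1 t.2.1 t.2.2).card ≤ D)
    (h1 : ∀ i, (univ.filter fun t : Fin m × Fin m × Fin m => ¬ E t.1 i t.2.1 t.2.2).card ≤ D)
    (h2 : ∀ i, (univ.filter fun t : Fin m × Fin m × Fin m => ¬ E t.1 t.2.1 i t.2.2).card ≤ D)
    (h3 : ∀ i, (univ.filter fun t : Fin m × Fin m × Fin m => ¬ E t.1 t.2.1 t.2.2 i).card ≤ D)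
    (hD : 4 * D + 6 * m ^ 2 < m ^ 3) :
    ∃ p q r : Equiv.Perm (Fin m), ∀ i, E i (p i) (q i) (r i) := by
  obtain ⟨⟨p, q, r⟩, -, hmax⟩ := Finset.exists_max_image
    (univ : Finset (Equiv.Perm (Fin m) × Equiv.Perm (Fin m) × Equiv.Perm (Fin m)))
    (fun t => (univ.filter fun i => E i (t.1 i) (t.2.1 i) (t.2.2 i)).card) ⟨1, mem_univ _⟩
  refine ⟨p, q, r, ?_⟩
  by_contra hcon
  push Not at hcon
  obtain ⟨i, hi⟩ := hcon
  have key : ∃ j k l, j ≠ i ∧ k ≠ i ∧ l ≠ i ∧ j ≠ k ∧ j ≠ l ∧ k ≠ l ∧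
      E i (p j) (q k) (r l) ∧ E j (p i) (q l) (r k) ∧ E k (p l) (q i) (r j) ∧
      E l (p k) (q j) (r i) := by
    by_contra hno
    push Not at hno
    let F0 := univ.filter fun t : Fin m × Fin m × Fin m => ¬ E i (p t.1) (q t.2.1) (r t.2.2)
    let F1 := univ.filter fun t : Fin m × Fin m × Fin m => ¬ E t.1 (p i) (q t.2.2) (r t.2.1)
    let F2 := univ.filter fun t : Fin m × Fin m × Fin m => ¬ E t.2.1 (p t.2.2) (q i) (r t.1)
    let F3 := univ.filter fun t : Fin m × Fin m × Fin m => ¬ E t.2.2 (p t.2.1) (q t.1) (r i)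
    let G1 := univ.image fun t : Fin m × Fin m => (i, t.1, t.2)
    let G2 := univ.image fun t : Fin m × Fin m => (t.1, i, t.2)
    let G3 := univ.image fun t : Fin m × Fin m => (t.1, t.2, i)
    let G4 := univ.image fun t : Fin m × Fin m => (t.1, t.1, t.2)
    let G5 := univ.image fun t : Fin m × Fin m => (t.1, t.2, t.1)
    let G6 := univ.image fun t : Fin m × Fin m => (t.1, t.2, t.2)
    have hF0 : F0.card ≤ D := by
      refine le_trans (card_le_card_of_injOn (fun t => (p t.1, q t.2.1, r t.2.2)) ?_ ?_) (h0 i)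
      · intro t ht; simpa [F0] using ht
      · rintro ⟨a, b, c⟩ - ⟨a', b', c'⟩ - h; simpa using h
    have hF1 : F1.card ≤ D := by
      refine le_trans (card_le_card_of_injOn (fun t => (t.1, q t.2.2, r t.2.1)) ?_ ?_) (h1 (p i))
      · intro t ht; simpa [F1] using ht
      · rintro ⟨a, b, c⟩ - ⟨a', b', c'⟩ - h; simp at h ⊢; tauto
    have hF2 : F2.card ≤ D := by
      refine le_trans (card_le_card_of_injOn (fun t => (t.2.1, p t.2.2, r t.1)) ?_ ?_) (h2 (q i))
      · intro t ht; simpa [F2] using ht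
      · rintro ⟨a, b, c⟩ - ⟨a', b', c'⟩ - h; simp at h ⊢; tauto
    have hF3 : F3.card ≤ D := by
      refine le_trans (card_le_card_of_injOn (fun t => (t.2.2, p t.2.1, q t.1)) ?_ ?_) (h3 (r i))
      · intro t ht; simpa [F3] using ht
      · rintro ⟨a, b, c⟩ - ⟨a', b', c'⟩ - h; simp at h ⊢; tauto
    have hG : ∀ f : Fin m × Fin m → Fin m × Fin m × Fin m, (univ.image f).card ≤ m ^ 2 := by
      intro f
      refine le_trans card_image_le ?_
      simp [sq]
    have hsub : (univ : Finset (Fin m × Fin m × Fin m)) ⊆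
        F0 ∪ F1 ∪ F2 ∪ F3 ∪ G1 ∪ G2 ∪ G3 ∪ G4 ∪ G5 ∪ G6 := by
      rintro ⟨j, k, l⟩ -
      have := hno j k l
      simp only [mem_union, F0, F1, F2, F3, G1, G2, G3, G4, G5, G6, mem_filter, mem_univ,
        true_and, mem_image, Prod.mk.injEq, Prod.exists]
      by_cases e1 : j = i
      · subst e1; simp
      by_cases e2 : k = i
      · subst e2; simp
      by_cases e3 : l = i
      · subst e3; simp
      by_cases e4 : j = k
      · subst e4; simp
      by_cases e5 : j = l
      · subst e5; simp
      by_cases e6 : k = l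
      · subst e6; simp
      have := this e1 e2 e3 e4 e5 e6
      tauto
    have hc := card_le_card hsub
    have hu : (univ : Finset (Fin m × Fin m × Fin m)).card = m ^ 3 := by
      simp; ring
    have c1 := card_union_le (F0 ∪ F1 ∪ F2 ∪ F3 ∪ G1 ∪ G2 ∪ G3 ∪ G4 ∪ G5) G6
    have c2 := card_union_le (F0 ∪ F1 ∪ F2 ∪ F3 ∪ G1 ∪ G2 ∪ G3 ∪ G4) G5
    have c3 := card_union_le (F0 ∪ F1 ∪ F2 ∪ F3 ∪ G1 ∪ G2 ∪ G3) G4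
    have c4 := card_union_le (F0 ∪ F1 ∪ F2 ∪ F3 ∪ G1 ∪ G2) G3
    have c5 := card_union_le (F0 ∪ F1 ∪ F2 ∪ F3 ∪ G1) G2
    have c6 := card_union_le (F0 ∪ F1 ∪ F2 ∪ F3) G1
    have c7 := card_union_le (F0 ∪ F1 ∪ F2) F3
    have c8 := card_union_le (F0 ∪ F1) F2
    have c9 := card_union_le F0 F1
    have g1 : G1.card ≤ m ^ 2 := hG _
    have g2 : G2.card ≤ m ^ 2 := hG _
    have g3 : G3.card ≤ m ^ 2 := hG _
    have g4 : G4.card ≤ m ^ 2 := hG _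
    have g5 : G5.card ≤ m ^ 2 := hG _
    have g6 : G6.card ≤ m ^ 2 := hG _
    omega
  obtain ⟨j, k, l, ji, ki, li, jk, jl, kl, e0, e1, e2, e3⟩ := key
  let p' : Equiv.Perm (Fin m) := (Equiv.swap i j * Equiv.swap k l).trans p
  let q' : Equiv.Perm (Fin m) := (Equiv.swap i k * Equiv.swap j l).trans q
  let r' : Equiv.Perm (Fin m) := (Equiv.swap i l * Equiv.swap j k).trans r
  have hval : ∀ x, x ≠ i → x ≠ j → x ≠ k → x ≠ l → p' x = p x ∧ q' x = q x ∧ r' x = r x := by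
    intro x h1 h2 h3 h4
    simp [p', q', r', Equiv.swap_apply_of_ne_of_ne, *]
  have sw : ∀ a b c d : Fin m, a ≠ b → a ≠ c → a ≠ d → b ≠ c → b ≠ d → c ≠ d →
      (Equiv.swap a b * Equiv.swap c d) a = b ∧ (Equiv.swap a b * Equiv.swap c d) b = a ∧
      (Equiv.swap a b * Equiv.swap c d) c = d ∧ (Equiv.swap a b * Equiv.swap c d) d = c := by
    intro a b c d h1 h2 h3 h4 h5 h6
    simp [Equiv.swap_apply_of_ne_of_ne, h1, h2, h3, h4, h5, h6, h1.symm, h2.symm, h3.symm,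
      h4.symm, h5.symm, h6.symm]
  obtain ⟨pi, pj, pk, pl⟩ := sw i j k l ji.symm ki.symm li.symm jk jl kl
  obtain ⟨qi, qk, qj, ql⟩ := sw i k j l ki.symm ji.symm li.symm jk.symm kl jl
  obtain ⟨ri, rl, rj, rk⟩ := sw i l j k li.symm ji.symm ki.symm jl.symm kl.symm jk
  have n0 : E i (p' i) (q' i) (r' i) := by
    simp only [p', q', r', Equiv.trans_apply, pi, qi, ri]; exact e0
  have n1 : E j (p' j) (q' j) (r' j) := by
    simp only [p', q', r', Equiv.trans_apply, pj, qj, rj]; exact e1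
  have n2 : E k (p' k) (q' k) (r' k) := by
    simp only [p', q', r', Equiv.trans_apply, pk, qk, rk]; exact e2
  have n3 : E l (p' l) (q' l) (r' l) := by
    simp only [p', q', r', Equiv.trans_apply, pl, ql, rl]; exact e3
  have hm := hmax (p', q', r') (mem_univ _)
  have hlt : (univ.filter fun x => E x (p x) (q x) (r x)).card <
      (univ.filter fun x => E x (p' x) (q' x) (r' x)).card := by
    apply card_lt_card
    rw [Finset.ssubset_iff_of_subset]
    · exact ⟨i, by simpa using n0, by simpa using hi⟩
    · intro x hx
      simp only [mem_filter, mem_univ, true_and] at hx ⊢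
      by_cases h1 : x = i
      · subst h1; exact n0
      by_cases h2 : x = j
      · subst h2; exact n1
      by_cases h3 : x = k
      · subst h3; exact n2
      by_cases h4 : x = l
      · subst h4; exact n3
      obtain ⟨a, b, c⟩ := hval x h1 h2 h3 h4
      rw [a, b, c]; exact hx
  exact absurd hm (not_le.mpr hlt)

/-- Number of pairs in `X × Y` missing from the link of `v`. -/
def missC {n : ℕ} (H : Finset (Finset (Fin n))) (v : Fin n) (X Y : Finset (Fin n)) : ℕ :=
  ((X ×ˢ Y).filter fun p => ({v, p.1, p.2} : Finset (Fin n)) ∉ H).card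

theorem missC_mono {n : ℕ} (H : Finset (Finset (Fin n))) (v : Fin n) {X Y X' Y' : Finset (Fin n)}
    (hX : X ⊆ X') (hY : Y ⊆ Y') : missC H v X Y ≤ missC H v X' Y' :=
  card_le_card (filter_subset_filter _ (product_subset_product hX hY))

theorem edge_ne {n : ℕ} {H : Finset (Finset (Fin n))} (h3 : Is3Graph n H) {x y z : Fin n}
    (h : ({x, y, z} : Finset (Fin n)) ∈ H) : x ≠ y ∧ x ≠ z ∧ y ≠ z := by
  have hc := h3 _ h
  refine ⟨?_, ?_, ?_⟩
  · rintro rfl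
    have := Finset.card_le_two (a := x) (b := z)
    simp at hc; omega
  · rintro rfl
    have := Finset.card_le_two (a := x) (b := y)
    rw [show ({x, y, x} : Finset (Fin n)) = {x, y} by ext; simp; tauto] at hc; omega
  · rintro rfl
    have := Finset.card_le_two (a := x) (b := y)
    simp at hc; omega

theorem k4m_mk {n : ℕ} {H : Finset (Finset (Fin n))} (h3 : Is3Graph n H) {w x y z : Fin n}
    (h1 : ({w, x, y} : Finset (Fin n)) ∈ H) (h2 : ({w, x, z} : Finset (Fin n)) ∈ H)
    (h4 : ({w, y, z} : Finset (Fin n)) ∈ H) : SpansK4m H {w, x, y, z} := by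
  obtain ⟨a1, a2, a3⟩ := edge_ne h3 h1
  obtain ⟨b1, b2, b3⟩ := edge_ne h3 h2
  obtain ⟨c1, c2, c3⟩ := edge_ne h3 h4
  refine ⟨?_, ?_⟩
  · rw [card_insert_of_notMem, card_insert_of_notMem, card_insert_of_notMem, card_singleton] <;>
      simp [*]
  · have hs : ({{w, x, y}, {w, x, z}, {w, y, z}} : Finset (Finset (Fin n))) ⊆
        (({w, x, y, z} : Finset (Fin n)).powersetCard 3).filter (· ∈ H) := by
      intro e he
      simp only [mem_insert, mem_singleton] at he
      simp only [mem_filter, mem_powersetCard]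
      rcases he with rfl | rfl | rfl
      · exact ⟨⟨by intro t; simp; tauto, h3 _ h1⟩, h1⟩
      · exact ⟨⟨by intro t; simp; tauto, h3 _ h2⟩, h2⟩
      · exact ⟨⟨by intro t; simp; tauto, h3 _ h4⟩, h4⟩
    refine le_trans (le_of_eq ?_) (card_le_card hs)
    rw [card_insert_of_notMem, card_insert_of_notMem, card_singleton]
    · intro h
      rw [mem_singleton] at h
      have : x ∈ ({w, y, z} : Finset (Fin n)) := h ▸ by simp
      simp at this; tauto
    · intro h
      rw [mem_insert, mem_singleton] at h
      rcases h with h | h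
      · have : y ∈ ({w, x, z} : Finset (Fin n)) := h ▸ by simp
        simp at this; tauto
      · have : x ∈ ({w, y, z} : Finset (Fin n)) := h ▸ by simp
        simp at this; tauto

theorem factor_union {n : ℕ} {H : Finset (Finset (Fin n))} {X Y : Finset (Fin n)}
    (hX : HasK4mFactorOn H X) (hY : HasK4mFactorOn H Y) (hd : Disjoint X Y) :
    HasK4mFactorOn H (X ∪ Y) := by
  classical
  obtain ⟨P, hP1, hP2, rfl⟩ := hX
  obtain ⟨Q, hQ1, hQ2, rfl⟩ := hY
  have hPQ : ∀ S ∈ P, ∀ T ∈ Q, Disjoint S T := fun S hS T hT =>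
    disjoint_of_subset_left (subset_biUnion_of_mem id hS)
      (disjoint_of_subset_right (subset_biUnion_of_mem id hT) hd)
  refine ⟨P ∪ Q, ?_, ?_, ?_⟩
  · intro S hS
    rcases mem_union.1 hS with h | h
    · exact hP1 S h
    · exact hQ1 S h
  · intro S hS T hT hne
    rcases mem_union.1 hS with h | h <;> rcases mem_union.1 hT with h' | h'
    · exact hP2 S h T h' hne
    · exact hPQ S h T h'
    · exact (hPQ T h' S h).symm
    · exact hQ2 S h T h' hne
  · exact union_biUnion

theorem factor_single {n : ℕ} {H : Finset (Finset (Fin n))} {S : Finset (Fin n)}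
    (h : SpansK4m H S) : HasK4mFactorOn H S :=
  ⟨{S}, by simpa using h, by simp, by simp⟩

theorem factor_empty {n : ℕ} {H : Finset (Finset (Fin n))} : HasK4mFactorOn H ∅ :=
  ⟨∅, by simp, by simp, by simp⟩

theorem bnd_fix1 {m M : ℕ} (P : Fin m → Fin m → Fin m → Prop) [∀ i j k, Decidable (P i j k)]
    (h : ∀ i, (univ.filter fun p : Fin m × Fin m => P i p.1 p.2).card ≤ M) :
    (univ.filter fun t : Fin m × Fin m × Fin m => P t.1 t.2.1 t.2.2).card ≤ m * M := by
  have : (univ.filter fun t : Fin m × Fin m × Fin m => P t.1 t.2.1 t.2.2) ⊆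
      (univ : Finset (Fin m)).biUnion fun i =>
        (univ.filter fun p : Fin m × Fin m => P i p.1 p.2).image fun p => (i, p.1, p.2) := by
    rintro ⟨a, b, c⟩ ht
    simpa using ht
  refine (card_le_card this).trans ((card_biUnion_le_card_mul _ _ M ?_).trans (by simp))
  intro i _
  exact card_image_le.trans (h i)

theorem bnd_fix2 {m M : ℕ} (P : Fin m → Fin m → Fin m → Prop) [∀ i j k, Decidable (P i j k)]
    (h : ∀ i, (univ.filter fun p : Fin m × Fin m => P p.1 i p.2).card ≤ M) :
    (univ.filter fun t : Fin m × Fin m × Fin m => P t.1 t.2.1 t.2.2).card ≤ m * M := by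
  have : (univ.filter fun t : Fin m × Fin m × Fin m => P t.1 t.2.1 t.2.2) ⊆
      (univ : Finset (Fin m)).biUnion fun i =>
        (univ.filter fun p : Fin m × Fin m => P p.1 i p.2).image fun p => (p.1, i, p.2) := by
    rintro ⟨a, b, c⟩ ht
    simpa using ht
  refine (card_le_card this).trans ((card_biUnion_le_card_mul _ _ M ?_).trans (by simp))
  intro i _
  exact card_image_le.trans (h i)

theorem bnd_fix3 {m M : ℕ} (P : Fin m → Fin m → Fin m → Prop) [∀ i j k, Decidable (P i j k)]
    (h : ∀ i, (univ.filter fun p : Fin m × Fin m => P p.1 p.2 i).card ≤ M) :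
    (univ.filter fun t : Fin m × Fin m × Fin m => P t.1 t.2.1 t.2.2).card ≤ m * M := by
  have : (univ.filter fun t : Fin m × Fin m × Fin m => P t.1 t.2.1 t.2.2) ⊆
      (univ : Finset (Fin m)).biUnion fun i =>
        (univ.filter fun p : Fin m × Fin m => P p.1 p.2 i).image fun p => (p.1, p.2, i) := by
    rintro ⟨a, b, c⟩ ht
    simpa using ht
  refine (card_le_card this).trans ((card_biUnion_le_card_mul _ _ M ?_).trans (by simp))
  intro i _
  exact card_image_le.trans (h i)

theorem bnd_three {τ : Type*} [Fintype τ] [DecidableEq τ] {K : ℕ} (P Q R : τ → Prop) [DecidablePred P]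
    [DecidablePred Q] [DecidablePred R]
    (hP : (univ.filter fun t => ¬ P t).card ≤ K) (hQ : (univ.filter fun t => ¬ Q t).card ≤ K)
    (hR : (univ.filter fun t => ¬ R t).card ≤ K) :
    (univ.filter fun t => ¬ (P t ∧ Q t ∧ R t)).card ≤ 3 * K := by
  have : (univ.filter fun t => ¬ (P t ∧ Q t ∧ R t)) ⊆
      (univ.filter fun t => ¬ P t) ∪ (univ.filter fun t => ¬ Q t) ∪ (univ.filter fun t => ¬ R t) := by
    intro t ht
    simp only [mem_filter, mem_univ, true_and, mem_union] at ht ⊢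
    tauto
  have h1 := card_le_card this
  have h2 := card_union_le ((univ.filter fun t => ¬ P t) ∪ (univ.filter fun t => ¬ Q t))
    (univ.filter fun t => ¬ R t)
  have h3 := card_union_le (univ.filter fun t => ¬ P t) (univ.filter fun t => ¬ Q t)
  omega

theorem factor_partite {n : ℕ} {H : Finset (Finset (Fin n))} (h3 : Is3Graph n H)
    (W Y : Finset (Fin n)) (m M : ℕ) (hd : Disjoint W Y) (hW : W.card = m) (hY : Y.card = 3 * m)
    (hw : ∀ w ∈ W, missC H w Y Y ≤ M) (hy : ∀ y ∈ Y, missC H y W Y ≤ M)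
    (hm : 4 * (3 * (m * M)) + 6 * m ^ 2 < m ^ 3) : HasK4mFactorOn H (W ∪ Y) := by
  classical
  let eW : Fin m ≃ W := (W.equivFinOfCardEq hW).symm
  have : Fintype.card (Fin 3 × Fin m) = Fintype.card Y := by simp [hY]
  let eY : Fin 3 × Fin m ≃ Y := Fintype.equivOfCardEq this
  let w : Fin m → Fin n := fun i => eW i
  let y : Fin 3 → Fin m → Fin n := fun c i => eY (c, i)
  have hwW : ∀ i, w i ∈ W := fun i => (eW i).2
  have hyY : ∀ c i, y c i ∈ Y := fun c i => (eY (c, i)).2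
  have winj : ∀ i j, w i = w j → i = j := by
    intro i j h
    exact eW.injective (Subtype.ext h)
  have yinj : ∀ c i d j, y c i = y d j → c = d ∧ i = j := by
    intro c i d j h
    have := eY.injective (Subtype.ext h)
    simpa using this
  have wsurj : ∀ v ∈ W, ∃ i, w i = v := by
    intro v hv
    exact ⟨eW.symm ⟨v, hv⟩, by simp [w]⟩
  have ysurj : ∀ v ∈ Y, ∃ c i, y c i = v := by
    intro v hv
    exact ⟨(eY.symm ⟨v, hv⟩).1, (eY.symm ⟨v, hv⟩).2, by simp [y]⟩
  have bw : ∀ i c d, (univ.filter fun p : Fin m × Fin m =>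
      ¬ ({w i, y c p.1, y d p.2} : Finset (Fin n)) ∈ H).card ≤ M := by
    intro i c d
    refine le_trans (card_le_card_of_injOn (fun p => (y c p.1, y d p.2)) ?_ ?_) (hw _ (hwW i))
    · intro p hp
      simp only [coe_filter, mem_univ, true_and, Set.mem_ofPred_eq] at hp
      simp [hyY, hp]
    · rintro ⟨a, b⟩ - ⟨a', b'⟩ - h
      simp only [Prod.mk.injEq] at h
      exact Prod.ext (yinj _ _ _ _ h.1).2 (yinj _ _ _ _ h.2).2
  have by1 : ∀ j c d, (univ.filter fun p : Fin m × Fin m =>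
      ¬ ({w p.1, y c j, y d p.2} : Finset (Fin n)) ∈ H).card ≤ M := by
    intro j c d
    refine le_trans (card_le_card_of_injOn (fun p => (w p.1, y d p.2)) ?_ ?_) (hy _ (hyY c j))
    · intro p hp
      simp only [coe_filter, mem_univ, true_and, Set.mem_ofPred_eq] at hp
      rw [Finset.insert_comm] at hp
      simp [hyY, hwW, hp]
    · rintro ⟨a, b⟩ - ⟨a', b'⟩ - h
      simp only [Prod.mk.injEq] at h
      exact Prod.ext (winj _ _ h.1) (yinj _ _ _ _ h.2).2
  have by2 : ∀ j c d, (univ.filter fun p : Fin m × Fin m =>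
      ¬ ({w p.1, y d p.2, y c j} : Finset (Fin n)) ∈ H).card ≤ M := by
    intro j c d
    simpa only [Finset.pair_comm] using by1 j c d
  let E : Fin m → Fin m → Fin m → Fin m → Prop := fun i j k l =>
    ({w i, y 0 j, y 1 k} : Finset (Fin n)) ∈ H ∧ ({w i, y 0 j, y 2 l} : Finset (Fin n)) ∈ H ∧
    ({w i, y 1 k, y 2 l} : Finset (Fin n)) ∈ H
  obtain ⟨p, q, r, hE⟩ := swap_lemma m (3 * (m * M)) E
    (fun i => bnd_three _ _ _
      (bnd_fix3 (fun a b c => ¬ ({w i, y 0 a, y 1 b} : Finset (Fin n)) ∈ H) fun c => bw i 0 1)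
      (bnd_fix2 (fun a b c => ¬ ({w i, y 0 a, y 2 c} : Finset (Fin n)) ∈ H) fun c => bw i 0 2)
      (bnd_fix1 (fun a b c => ¬ ({w i, y 1 b, y 2 c} : Finset (Fin n)) ∈ H) fun c => bw i 1 2))
    (fun i => bnd_three _ _ _
      (bnd_fix3 (fun a b c => ¬ ({w a, y 0 i, y 1 b} : Finset (Fin n)) ∈ H) fun c => by1 i 0 1)
      (bnd_fix2 (fun a b c => ¬ ({w a, y 0 i, y 2 c} : Finset (Fin n)) ∈ H) fun c => by1 i 0 2)
      (bnd_fix1 (fun a b c => ¬ ({w a, y 1 b, y 2 c} : Finset (Fin n)) ∈ H) fun c => bw c 1 2))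
    (fun i => bnd_three _ _ _
      (bnd_fix3 (fun a b c => ¬ ({w a, y 0 b, y 1 i} : Finset (Fin n)) ∈ H) fun c => by2 i 1 0)
      (bnd_fix1 (fun a b c => ¬ ({w a, y 0 b, y 2 c} : Finset (Fin n)) ∈ H) fun c => bw c 0 2)
      (bnd_fix2 (fun a b c => ¬ ({w a, y 1 i, y 2 c} : Finset (Fin n)) ∈ H) fun c => by1 i 1 2))
    (fun i => bnd_three _ _ _
      (bnd_fix1 (fun a b c => ¬ ({w a, y 0 b, y 1 c} : Finset (Fin n)) ∈ H) fun c => bw c 0 1)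
      (bnd_fix3 (fun a b c => ¬ ({w a, y 0 b, y 2 i} : Finset (Fin n)) ∈ H) fun c => by2 i 2 0)
      (bnd_fix2 (fun a b c => ¬ ({w a, y 1 c, y 2 i} : Finset (Fin n)) ∈ H) fun c => by2 i 2 1))
    hm
  have hwy : ∀ i c j, w i ≠ y c j := fun i c j h =>
    (disjoint_left.1 hd (hwW i)) (h ▸ hyY c j)
  let f : Fin m → Finset (Fin n) := fun i => {w i, y 0 (p i), y 1 (q i), y 2 (r i)}
  refine ⟨univ.image f, ?_, ?_, ?_⟩
  · intro S hS
    obtain ⟨i, -, rfl⟩ := mem_image.1 hS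
    exact k4m_mk h3 (hE i).1 (hE i).2.1 (hE i).2.2
  · intro S hS T hT hne
    obtain ⟨i, -, rfl⟩ := mem_image.1 hS
    obtain ⟨j, -, rfl⟩ := mem_image.1 hT
    have hij : i ≠ j := fun h => hne (by rw [h])
    rw [disjoint_left]
    intro v hv hv'
    simp only [f, mem_insert, mem_singleton] at hv hv'
    apply hij
    rcases hv with rfl | rfl | rfl | rfl <;> rcases hv' with h | h | h | h
    · exact winj _ _ h
    · exact absurd h (hwy _ _ _)
    · exact absurd h (hwy _ _ _)
    · exact absurd h (hwy _ _ _)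
    · exact absurd h.symm (hwy _ _ _)
    · exact p.injective (yinj _ _ _ _ h).2
    · exact absurd (yinj _ _ _ _ h).1 (by decide)
    · exact absurd (yinj _ _ _ _ h).1 (by decide)
    · exact absurd h.symm (hwy _ _ _)
    · exact absurd (yinj _ _ _ _ h).1 (by decide)
    · exact q.injective (yinj _ _ _ _ h).2
    · exact absurd (yinj _ _ _ _ h).1 (by decide)
    · exact absurd h.symm (hwy _ _ _)
    · exact absurd (yinj _ _ _ _ h).1 (by decide)
    · exact absurd (yinj _ _ _ _ h).1 (by decide)
    · exact r.injective (yinj _ _ _ _ h).2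
  · ext v
    simp only [mem_biUnion, mem_image, mem_univ, true_and, exists_exists_eq_and, id, mem_union]
    constructor
    · rintro ⟨i, hi⟩
      simp only [f, mem_insert, mem_singleton] at hi
      rcases hi with rfl | rfl | rfl | rfl
      · exact Or.inl (hwW _)
      all_goals exact Or.inr (hyY _ _)
    · rintro (hv | hv)
      · obtain ⟨i, rfl⟩ := wsurj v hv
        exact ⟨i, by simp [f]⟩
      · obtain ⟨c, i, rfl⟩ := ysurj v hv
        fin_cases c
        · exact ⟨p.symm i, by simp [f]⟩
        · exact ⟨q.symm i, by simp [f]⟩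
        · exact ⟨r.symm i, by simp [f]⟩

/-- All vertices of `A` and `B` are typical with respect to the partition. -/
structure GoodPair {n : ℕ} (H : Finset (Finset (Fin n))) (A B : Finset (Fin n)) : Prop where
  aa : ∀ a ∈ A, 100000 * missC H a A A ≤ n ^ 2
  ab : ∀ a ∈ A, 100000 * missC H a B B ≤ n ^ 2
  bb : ∀ b ∈ B, 100000 * missC H b A B ≤ n ^ 2

theorem GoodPair.mono {n : ℕ} {H : Finset (Finset (Fin n))} {A B A' B' : Finset (Fin n)}
    (h : GoodPair H A B) (hA : A' ⊆ A) (hB : B' ⊆ B) : GoodPair H A' B' where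
  aa a ha := le_trans (Nat.mul_le_mul_left _ (missC_mono H a hA hA)) (h.aa a (hA ha))
  ab a ha := le_trans (Nat.mul_le_mul_left _ (missC_mono H a hB hB)) (h.ab a (hA ha))
  bb b hb := le_trans (Nat.mul_le_mul_left _ (missC_mono H b hA hB)) (h.bb b (hB hb))

theorem arith_final (n m M : ℕ) (hn : 1000000 ≤ n) (hm : n ≤ 13 * m)
    (hM : M * 100000 ≤ n ^ 2) : 4 * (3 * (m * M)) + 6 * m ^ 2 < m ^ 3 := by
  have h1 : n ^ 2 ≤ 169 * m ^ 2 := by nlinarith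
  have h2 : M * 100000 ≤ 169 * m ^ 2 := hM.trans h1
  have h3 : m * (M * 100000) ≤ m * (169 * m ^ 2) := Nat.mul_le_mul_left _ h2
  have hm' : 100 ≤ m := by omega
  have h4 : 100 * m ^ 2 ≤ m * m ^ 2 := Nat.mul_le_mul_right _ hm'
  have h5 : 0 < m ^ 2 := by positivity
  have h6 : m ^ 3 = m * m ^ 2 := by ring
  rw [h6]
  nlinarith

theorem final_factor {n : ℕ} {H : Finset (Finset (Fin n))} (h3 : Is3Graph n H)
    {A B : Finset (Fin n)} (hn : 1000000 ≤ n) (g : GoodPair H A B) (hd : Disjoint A B)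
    (hA : 49 * n ≤ 100 * A.card) (hB : 49 * n ≤ 100 * B.card) (hAB : A.card + B.card ≤ n)
    (hB3 : 3 ∣ B.card) (h4 : 4 ∣ A.card + B.card) : HasK4mFactorOn H (A ∪ B) := by
  obtain ⟨b, hb⟩ := hB3
  obtain ⟨c, hc⟩ := h4
  -- |A| = 4 a + b
  have hex : ∃ a, A.card = 4 * a + b := ⟨c - b, by omega⟩
  obtain ⟨a, ha⟩ := hex
  obtain ⟨A3, hA3, hA3c⟩ := exists_subset_card_eq (s := A) (n := b) (by omega)
  have hr : (A \ A3).card = 4 * a := by rw [card_sdiff_of_subset hA3]; omega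
  obtain ⟨W, hW, hWc⟩ := exists_subset_card_eq (s := A \ A3) (n := a) (by omega)
  have hYc : ((A \ A3) \ W).card = 3 * a := by rw [card_sdiff_of_subset hW]; omega
  set Y := (A \ A3) \ W with hY
  have hWA : W ⊆ A := hW.trans sdiff_subset
  have hYA : Y ⊆ A := sdiff_subset.trans sdiff_subset
  have hM : (n ^ 2 / 100000) * 100000 ≤ n ^ 2 := Nat.div_mul_le_self _ _
  have hle : ∀ k, 100000 * k ≤ n ^ 2 → k ≤ n ^ 2 / 100000 := by intro k hk; omega
  have f1 : HasK4mFactorOn H (A3 ∪ B) := by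
    refine factor_partite h3 A3 B b (n ^ 2 / 100000) (disjoint_of_subset_left hA3 hd) hA3c hb
      ?_ ?_ (arith_final n b _ hn (by omega) hM)
    · intro w hw
      exact hle _ (g.ab w (hA3 hw))
    · intro y hy
      exact (missC_mono H y hA3 subset_rfl).trans (hle _ (g.bb y hy))
  have f2 : HasK4mFactorOn H (W ∪ Y) := by
    refine factor_partite h3 W Y a (n ^ 2 / 100000) disjoint_sdiff hWc hYc
      ?_ ?_ (arith_final n a _ hn (by omega) hM)
    · intro w hw
      exact (missC_mono H w hYA hYA).trans (hle _ (g.aa w (hWA hw)))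
    · intro y hy
      exact (missC_mono H y hWA hYA).trans (hle _ (g.aa y (hYA hy)))
  have hWY : W ∪ Y = A \ A3 := union_sdiff_of_subset hW
  rw [hWY] at f2
  have := factor_union f1 f2 (by
    rw [disjoint_union_left]
    exact ⟨disjoint_sdiff, (disjoint_of_subset_left sdiff_subset hd).symm⟩)
  have he : A3 ∪ B ∪ A \ A3 = A ∪ B := by
    rw [union_right_comm, union_sdiff_of_subset hA3]
  rwa [he] at this

/-- The cleaned-up structure: typical sets `A`, `B` and a small exceptional set `V`. -/
structure Setup {n : ℕ} (H : Finset (Finset (Fin n))) (A B V : Finset (Fin n)) : Prop where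
  dAB : Disjoint A B
  dAV : Disjoint A V
  dBV : Disjoint B V
  un : A ∪ B ∪ V = univ
  good : GoodPair H A B
  cA : 495 * n ≤ 1000 * A.card
  cB : 495 * n ≤ 1000 * B.card
  cV : 40000000 * V.card ≤ n
  rA : ∀ v ∈ V, ∀ W : Finset (Fin n), 10000000 * W.card ≤ n →
    ∃ S ⊆ A, S.card = 3 ∧ Disjoint S W ∧ SpansK4m H (insert v S)
  rB : ∀ v ∈ V, ∀ W : Finset (Fin n), 10000000 * W.card ≤ n →
    ∃ S ⊆ A ∪ B, S.card = 3 ∧ (S ∩ B).card = 2 ∧ Disjoint S W ∧ SpansK4m H (insert v S)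
  nB : ∀ v ∈ V, ∃ a ∈ A, ∃ b ∈ B, ({v, a, b} : Finset (Fin n)) ∉ H

theorem Setup.card_sum {n : ℕ} {H : Finset (Finset (Fin n))} {A B V : Finset (Fin n)}
    (s : Setup H A B V) : A.card + B.card + V.card = n := by
  have h := congrArg card s.un
  rw [card_union_of_disjoint (disjoint_union_left.2 ⟨s.dAV, s.dBV⟩),
    card_union_of_disjoint s.dAB] at h
  simpa using h

theorem greedy {n : ℕ} {H : Finset (Finset (Fin n))} {A B V : Finset (Fin n)}
    (s : Setup H A B V) (hn : 10 ^ 10 ≤ n) (T W0 : Finset (Fin n)) (hW0 : W0.card ≤ 8) :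
    ∀ S : Finset (Fin n), S ⊆ V → ∃ X ⊆ A ∪ B, Disjoint X W0 ∧ X.card = 3 * S.card ∧
      (X ∩ B).card = 2 * (S ∩ T).card ∧ HasK4mFactorOn H (S ∪ X) := by
  intro S
  induction S using Finset.induction_on with
  | empty => intro _; exact ⟨∅, by simp, by simp, by simp, by simp, by simpa using factor_empty⟩
  | insert v S hvS ih =>
    intro hSV
    have hvV : v ∈ V := hSV (mem_insert_self _ _)
    have hSV' : S ⊆ V := (subset_insert _ _).trans hSV
    obtain ⟨X, hX, hXW, hXc, hXB, hXf⟩ := ih hSV'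
    have hdV : ∀ Z ⊆ A ∪ B, Disjoint Z V := fun Z hZ =>
      disjoint_of_subset_left hZ (disjoint_union_left.2 ⟨s.dAV, s.dBV⟩)
    have hcS : S.card ≤ V.card := card_le_card hSV'
    have hWc : 10000000 * (X ∪ W0).card ≤ n := by
      have := card_union_le X W0
      have := s.cV
      omega
    have step : ∀ Q ⊆ A ∪ B, Q.card = 3 → (Q ∩ B).card = 2 * (if v ∈ T then 1 else 0) →
        Disjoint Q (X ∪ W0) → SpansK4m H (insert v Q) →
        ∃ X ⊆ A ∪ B, Disjoint X W0 ∧ X.card = 3 * (insert v S).card ∧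
          (X ∩ B).card = 2 * (insert v S ∩ T).card ∧ HasK4mFactorOn H (insert v S ∪ X) := by
      intro Q hQ hQc hQB hQd hQK
      rw [disjoint_union_right] at hQd
      refine ⟨X ∪ Q, union_subset hX hQ, disjoint_union_left.2 ⟨hXW, hQd.2⟩, ?_, ?_, ?_⟩
      · rw [card_union_of_disjoint hQd.1.symm, card_insert_of_notMem hvS]; omega
      · rw [union_inter_distrib_right, card_union_of_disjoint
          (disjoint_of_subset_left inter_subset_left
            (disjoint_of_subset_right inter_subset_left hQd.1.symm)), hXB, hQB]
        split_ifs with h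
        · rw [insert_inter_of_mem h, card_insert_of_notMem (by simp [hvS])]; ring
        · rw [insert_inter_of_notMem h]; ring
      · have hvX : v ∉ X := fun h => disjoint_left.1 (hdV X hX) h hvV
        have : insert v S ∪ (X ∪ Q) = (S ∪ X) ∪ insert v Q := by
          ext t; simp only [mem_union, mem_insert]; tauto
        rw [this]
        apply factor_union hXf (factor_single hQK)
        rw [disjoint_insert_right]
        refine ⟨by simp [hvS, hvX], disjoint_union_left.2 ⟨?_, hQd.1.symm⟩⟩
        exact (disjoint_of_subset_right hSV' (hdV Q hQ)).symm
    by_cases hvT : v ∈ T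
    · obtain ⟨Q, h1, h2, h3, h4, h5⟩ := s.rB v hvV _ hWc
      exact step Q h1 h2 (by simp [hvT, h3]) h4 h5
    · obtain ⟨Q, h1, h2, h4, h5⟩ := s.rA v hvV _ hWc
      refine step Q (h1.trans subset_union_left) h2 ?_ h4 h5
      have : Disjoint Q B := disjoint_of_subset_left h1 s.dAB
      rw [disjoint_iff_inter_eq_empty.1 this]
      simp [hvT]

/-- the conclusion of the divisibility step -/
def ModFix {n : ℕ} (H : Finset (Finset (Fin n))) (A B V : Finset (Fin n)) : Prop :=
  ∃ T ⊆ V, ∃ W0 ⊆ A ∪ B, HasK4mFactorOn H W0 ∧ W0.card ≤ 8 ∧ 4 ∣ W0.card ∧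
    (B.card + T.card) % 3 = (W0 ∩ B).card % 3

theorem assemble {n : ℕ} {H : Finset (Finset (Fin n))} (h3 : Is3Graph n H)
    {A B V : Finset (Fin n)} (s : Setup H A B V) (hn : 10 ^ 10 ≤ n) (h4 : 4 ∣ n)
    (hm : ModFix H A B V) : HasK4mFactorOn H univ := by
  obtain ⟨T, hT, W0, hW0, hf0, hc0, hd0, hmod⟩ := hm
  obtain ⟨X, hX, hXW, hXc, hXB, hXf⟩ := greedy s hn T W0 hc0 V subset_rfl
  rw [inter_eq_right.2 hT] at hXB
  have hsum := s.card_sum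
  have hV := s.cV
  have hVAB : Disjoint V (A ∪ B) := (disjoint_union_left.2 ⟨s.dAV, s.dBV⟩).symm
  set Z := W0 ∪ X with hZ
  have hZAB : Z ⊆ A ∪ B := union_subset hW0 hX
  have hZc : Z.card = W0.card + X.card := card_union_of_disjoint hXW.symm
  have hZB : (Z ∩ B).card = (W0 ∩ B).card + (X ∩ B).card := by
    rw [hZ, union_inter_distrib_right, card_union_of_disjoint]
    exact disjoint_of_subset_left inter_subset_left
            (disjoint_of_subset_right inter_subset_left hXW.symm)
  have cB' : (B \ Z).card + (Z ∩ B).card = B.card := by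
    rw [inter_comm]; exact card_sdiff_add_card_inter B Z
  have cA' : (A \ Z).card + (Z ∩ A).card = A.card := by
    rw [inter_comm]; exact card_sdiff_add_card_inter A Z
  have cAB : ((A \ Z) ∪ (B \ Z)).card + Z.card = A.card + B.card := by
    rw [← union_sdiff_distrib, card_sdiff_add_card_eq_card hZAB, card_union_of_disjoint s.dAB]
  have dAB' : Disjoint (A \ Z) (B \ Z) :=
    disjoint_of_subset_left sdiff_subset (disjoint_of_subset_right sdiff_subset s.dAB)
  rw [card_union_of_disjoint dAB'] at cAB
  have hzb : (Z ∩ B).card ≤ Z.card := card_le_card inter_subset_left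
  have hza : (Z ∩ A).card ≤ Z.card := card_le_card inter_subset_left
  have hA := s.cA
  have hB := s.cB
  have ff := final_factor h3 (by omega) (s.good.mono sdiff_subset sdiff_subset) dAB'
    (by omega) (by omega) (by omega) (by omega) (by omega)
  rw [← union_sdiff_distrib] at ff
  have f2 := factor_union hf0 hXf (by
    rw [disjoint_union_right]
    exact ⟨(disjoint_of_subset_right hW0 hVAB).symm, hXW.symm⟩)
  have f3 := factor_union f2 ff (by
    rw [disjoint_left]
    intro x hx hx'
    simp only [hZ, mem_union, mem_sdiff] at hx hx'
    rcases hx with h | h | h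
    · tauto
    · exact disjoint_left.1 hVAB h (mem_union.2 hx'.1)
    · tauto)
  convert f3
  rw [eq_comm, eq_univ_iff_forall]
  intro x
  have : x ∈ A ∪ B ∪ V := s.un ▸ mem_univ x
  simp only [hZ, mem_union, mem_sdiff] at this ⊢
  tauto

theorem card_filter_prod {σ τ : Type*} [DecidableEq σ] [DecidableEq τ] (X : Finset σ) (Y : Finset τ) (P : σ → τ → Prop)
    [∀ x y, Decidable (P x y)] :
    ((X ×ˢ Y).filter fun p => P p.1 p.2).card = ∑ x ∈ X, (Y.filter fun y => P x y).card := by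
  simp only [card_filter, sum_product]

theorem cherry {n : ℕ} (X Y : Finset (Fin n)) (L : Fin n → Fin n → Prop)
    (bad : Fin n → Fin n × Fin n → Prop) [∀ x y, Decidable (L x y)] [∀ x y, Decidable (bad x y)]
    (β : ℝ) (hβ : 0 ≤ β)
    (hL : β * (n : ℝ) ^ 2 ≤ (((X ×ˢ Y).filter fun p => L p.1 p.2).card : ℝ))
    (hb : (((X ×ˢ (Y ×ˢ Y)).filter fun p => bad p.1 p.2).card : ℝ) < β ^ 2 * (n : ℝ) ^ 3) :
    ∃ x ∈ X, ∃ y ∈ Y, ∃ z ∈ Y, L x y ∧ L x z ∧ ¬ bad x (y, z) := by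
  by_contra hno
  push Not at hno
  rw [card_filter_prod] at hL hb
  push_cast at hL hb
  have h1 : ∀ x ∈ X, ((Y.filter fun y => L x y).card : ℝ) ^ 2 ≤
      (((Y ×ˢ Y).filter fun p => bad x p).card : ℝ) := by
    intro x hx
    have : (Y.filter fun y => L x y) ×ˢ (Y.filter fun y => L x y) ⊆
        (Y ×ˢ Y).filter fun p => bad x p := by
      rintro ⟨y, z⟩ h
      simp only [mem_product, mem_filter] at h ⊢
      exact ⟨⟨h.1.1, h.2.1⟩, hno x hx y h.1.1 z h.2.1 h.1.2 h.2.2⟩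
    have := card_le_card this
    rw [card_product] at this
    rw [sq]
    exact_mod_cast this
  have h2 := sum_le_sum h1
  have h3 : ∀ x ∈ X, 2 * (β * n) * ((Y.filter fun y => L x y).card : ℝ) - (β * n) ^ 2 ≤
      ((Y.filter fun y => L x y).card : ℝ) ^ 2 := by
    intro x _
    nlinarith [sq_nonneg (((Y.filter fun y => L x y).card : ℝ) - β * n)]
  have h4 := sum_le_sum h3
  rw [sum_sub_distrib, ← mul_sum, sum_const, nsmul_eq_mul] at h4
  have hX : (X.card : ℝ) ≤ n := by
    have := card_le_univ X
    simp at this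
    exact_mod_cast this
  have h5 : (X.card : ℝ) * (β * n) ^ 2 ≤ n * (β * n) ^ 2 := by gcongr
  have h6 : 2 * (β * n) * (β * (n : ℝ) ^ 2) ≤
      2 * (β * n) * ∑ x ∈ X, ((Y.filter fun y => L x y).card : ℝ) := by gcongr
  nlinarith

theorem tri_comm1 {n : ℕ} (x y z : Fin n) : ({x, y, z} : Finset (Fin n)) = {y, x, z} :=
  insert_comm _ _ _
theorem tri_comm2 {n : ℕ} (x y z : Fin n) : ({x, y, z} : Finset (Fin n)) = {x, z, y} := by
  rw [pair_comm]
theorem tri_rot {n : ℕ} (x y z : Fin n) : ({x, y, z} : Finset (Fin n)) = {z, x, y} := by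
  ext; simp; tauto

/-- If `p` misses few pairs of `X × X`, any large subset contains an edge with `p`. -/
theorem exists_edge_of_large {n : ℕ} (H : Finset (Finset (Fin n))) (v : Fin n)
    (X Y : Finset (Fin n)) (h : missC H v X Y < X.card * Y.card) :
    ∃ x ∈ X, ∃ y ∈ Y, ({v, x, y} : Finset (Fin n)) ∈ H := by
  by_contra hno
  push Not at hno
  have : (X ×ˢ Y).filter (fun p => ({v, p.1, p.2} : Finset (Fin n)) ∉ H) = X ×ˢ Y := by
    apply filter_true_of_mem
    rintro ⟨x, y⟩ hp
    rw [mem_product] at hp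
    exact hno x hp.1 y hp.2
  unfold missC at h
  rw [this, card_product] at h
  omega

theorem heavyK {n : ℕ} {H : Finset (Finset (Fin n))} (h3 : Is3Graph n H)
    {A B V : Finset (Fin n)} (s : Setup H A B V) (hn : 10 ^ 10 ≤ n) {a b : Fin n}
    (ha : a ∈ A) (hb : b ∈ B) (hh : n ≤ 100 * degOn H a b A) (F : Finset (Fin n))
    (hF : F.card ≤ 8) : ∃ Q ⊆ A ∪ B, SpansK4m H Q ∧ (Q ∩ B).card = 1 ∧
      ∀ v ∈ Q, v = a ∨ v = b ∨ v ∉ F := by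
  set N := (A.filter fun z => ({a, b, z} : Finset (Fin n)) ∈ H) \ F with hN
  have hNc : n ≤ 200 * N.card := by
    have := le_card_sdiff F (A.filter fun z => ({a, b, z} : Finset (Fin n)) ∈ H)
    unfold degOn at hh
    rw [← hN] at this
    omega
  have hNA : N ⊆ A := sdiff_subset.trans (filter_subset _ _)
  have hmiss : missC H a N N < N.card * N.card := by
    have h1 := s.good.aa a ha
    have h2 := missC_mono H a hNA hNA
    have : n ^ 2 ≤ 40000 * (N.card * N.card) := by nlinarith
    have : 0 < N.card * N.card := by
      have : 0 < N.card := by omega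
      positivity
    omega
  obtain ⟨x, hx, y, hy, hxy⟩ := exists_edge_of_large H a N N hmiss
  simp only [hN, mem_sdiff, mem_filter] at hx hy
  refine ⟨{a, b, x, y}, ?_, k4m_mk h3 hx.1.2 hy.1.2 hxy, ?_, ?_⟩
  · intro t
    simp only [mem_insert, mem_singleton, mem_union]
    rintro (rfl | rfl | rfl | rfl)
    · exact Or.inl ha
    · exact Or.inr hb
    · exact Or.inl hx.1.1
    · exact Or.inl hy.1.1
  · have hA : ∀ t ∈ A, t ∉ B := fun t ht => disjoint_left.1 s.dAB ht
    have : ({a, b, x, y} : Finset (Fin n)) ∩ B = {b} := by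
      ext t
      simp only [mem_inter, mem_insert, mem_singleton]
      constructor
      · rintro ⟨rfl | rfl | rfl | rfl, h⟩
        · exact absurd h (hA _ ha)
        · rfl
        · exact absurd h (hA _ hx.1.1)
        · exact absurd h (hA _ hy.1.1)
      · rintro rfl
        exact ⟨by simp, hb⟩
    rw [this, card_singleton]
  · intro v
    simp only [mem_insert, mem_singleton]
    rintro (rfl | rfl | rfl | rfl) <;> tauto

theorem aabb_inter {n : ℕ} {A B : Finset (Fin n)} (hd : Disjoint A B) {a c b d : Fin n}
    (ha : a ∈ A) (hc : c ∈ A) (hb : b ∈ B) (hd' : d ∈ B) (hbd : b ≠ d) {Q : Finset (Fin n)}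
    (hQ : ∀ t, t ∈ Q ↔ t = a ∨ t = c ∨ t = b ∨ t = d) :
    Q ⊆ A ∪ B ∧ (Q ∩ B).card = 2 := by
  have hA : ∀ t ∈ A, t ∉ B := fun t ht => disjoint_left.1 hd ht
  constructor
  · intro t ht
    rw [mem_union]
    rcases (hQ t).1 ht with rfl | rfl | rfl | rfl <;> tauto
  · have : Q ∩ B = {b, d} := by
      ext t
      simp only [mem_inter, mem_insert, mem_singleton, hQ]
      constructor
      · rintro ⟨rfl | rfl | rfl | rfl, h⟩
        · exact absurd h (hA _ ha)
        · exact absurd h (hA _ hc)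
        · simp
        · simp
      · rintro (rfl | rfl) <;> tauto
    rw [this, card_pair hbd]

theorem deg_split {n : ℕ} {H : Finset (Finset (Fin n))} {A B V : Finset (Fin n)}
    (s : Setup H A B V) (x y : Fin n) :
    degOn H x y univ ≤ degOn H x y A + degOn H x y B + degOn H x y V := by
  unfold degOn
  rw [← s.un, filter_union, filter_union]
  exact (card_union_le _ _).trans (Nat.add_le_add_right (card_union_le _ _) _)

theorem deg_le {n : ℕ} (H : Finset (Finset (Fin n))) (x y : Fin n) (U : Finset (Fin n)) :
    degOn H x y U ≤ U.card := card_filter_le _ _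

theorem lightK {n : ℕ} {H : Finset (Finset (Fin n))} (h3 : Is3Graph n H)
    {A B V : Finset (Fin n)} (s : Setup H A B V) (hn : 10 ^ 10 ≤ n)
    (hcd : ∀ x y : Fin n, x ≠ y → n ≤ 2 * degOn H x y univ + 2) {a a' b : Fin n}
    (ha : a ∈ A) (ha' : a' ∈ A) (hb : b ∈ B) (he : ({a, a', b} : Finset (Fin n)) ∈ H)
    (h1 : 100 * degOn H a b A < n) (h2 : 100 * degOn H a' b A < n) (F : Finset (Fin n))
    (hF : F.card ≤ 8) : ∃ Q ⊆ A ∪ B, SpansK4m H Q ∧ (Q ∩ B).card = 2 ∧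
      ∀ v ∈ Q, v = a ∨ v = a' ∨ v = b ∨ v ∉ F := by
  obtain ⟨e1, e2, e3⟩ := edge_ne h3 he
  have c1 := hcd a b e2
  have c2 := hcd a' b e3
  have s1 := deg_split s a b
  have s2 := deg_split s a' b
  have v1 := deg_le H a b V
  have v2 := deg_le H a' b V
  have hV := s.cV
  have hA := s.cA
  have hsum := s.card_sum
  set N1 := B.filter fun z => ({a, b, z} : Finset (Fin n)) ∈ H with hN1
  set N2 := B.filter fun z => ({a', b, z} : Finset (Fin n)) ∈ H with hN2
  have d1 : degOn H a b B = N1.card := rfl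
  have d2 : degOn H a' b B = N2.card := rfl
  have hu : (N1 ∪ N2).card ≤ B.card :=
    card_le_card (union_subset (filter_subset _ _) (filter_subset _ _))
  have hi := card_union_add_card_inter N1 N2
  have hlt : F.card < (N1 ∩ N2).card := by omega
  obtain ⟨d, hd, hdF⟩ := exists_mem_notMem_of_card_lt_card hlt
  simp only [hN1, hN2, mem_inter, mem_filter] at hd
  have hbd : b ≠ d := (edge_ne h3 hd.1.2).2.2
  have hQ : ∀ t, t ∈ ({b, a, a', d} : Finset (Fin n)) ↔ t = a ∨ t = a' ∨ t = b ∨ t = d := by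
    intro t; simp only [mem_insert, mem_singleton]; tauto
  obtain ⟨q1, q2⟩ := aabb_inter s.dAB ha ha' hb hd.1.1 hbd hQ
  refine ⟨{b, a, a', d}, q1, ?_, q2, ?_⟩
  · apply k4m_mk h3
    · rwa [← tri_rot]
    · rw [tri_comm1]; exact hd.1.2
    · rw [tri_comm1]; exact hd.2.2
  · intro v hv
    rcases (hQ v).1 hv with h | h | h | rfl <;> tauto

theorem modfix_two {n : ℕ} {H : Finset (Finset (Fin n))} {A B V : Finset (Fin n)}
    {Q1 Q2 : Finset (Fin n)} (h1 : Q1 ⊆ A ∪ B) (h2 : Q2 ⊆ A ∪ B) (k1 : SpansK4m H Q1)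
    (k2 : SpansK4m H Q2) (hd : Disjoint Q1 Q2)
    (hm : B.card % 3 = ((Q1 ∩ B).card + (Q2 ∩ B).card) % 3) : ModFix H A B V := by
  have hc : (Q1 ∪ Q2).card = 8 := by rw [card_union_of_disjoint hd, k1.1, k2.1]
  refine ⟨∅, empty_subset _, Q1 ∪ Q2, union_subset h1 h2,
    factor_union (factor_single k1) (factor_single k2) hd, hc.le, by rw [hc]; norm_num, ?_⟩
  rw [union_inter_distrib_right, card_union_of_disjoint
          (disjoint_of_subset_left inter_subset_left
            (disjoint_of_subset_right inter_subset_left hd)), ← hm]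
  simp

theorem modfix_one {n : ℕ} {H : Finset (Finset (Fin n))} {A B V : Finset (Fin n)}
    {Q T : Finset (Fin n)} (h1 : Q ⊆ A ∪ B) (k1 : SpansK4m H Q) (hT : T ⊆ V)
    (hm : (B.card + T.card) % 3 = (Q ∩ B).card % 3) : ModFix H A B V :=
  ⟨T, hT, Q, h1, factor_single k1, by rw [k1.1]; norm_num, by rw [k1.1], hm⟩

theorem modfix_zero {n : ℕ} {H : Finset (Finset (Fin n))} {A B V : Finset (Fin n)}
    {T : Finset (Fin n)} (hT : T ⊆ V)
    (hm : (B.card + T.card) % 3 = 0) : ModFix H A B V :=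
  ⟨T, hT, ∅, empty_subset _, factor_empty, by simp, by simp, by simpa using hm⟩

theorem degA_le {n : ℕ} {H : Finset (Finset (Fin n))} (h3 : Is3Graph n H)
    {A : Finset (Fin n)} {x y : Fin n} (hx : x ∈ A) (hy : y ∈ A) (hxy : x ≠ y) :
    degOn H x y A + 2 ≤ A.card := by
  have : A.filter (fun z => ({x, y, z} : Finset (Fin n)) ∈ H) ⊆ (A.erase x).erase y := by
    intro z hz
    rw [mem_filter] at hz
    obtain ⟨_, h2, h3⟩ := edge_ne h3 hz.2
    simp [h2.symm, h3.symm, hz.1]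
  have := card_le_card this
  rw [card_erase_of_mem (by simp [hy, hxy.symm]), card_erase_of_mem hx] at this
  have : 1 < A.card := one_lt_card.2 ⟨x, hx, y, hy, hxy⟩
  unfold degOn
  omega

theorem degB_le {n : ℕ} {H : Finset (Finset (Fin n))} (h3 : Is3Graph n H)
    {B : Finset (Fin n)} {x y : Fin n} (hy : y ∈ B) :
    degOn H x y B + 1 ≤ B.card := by
  have : B.filter (fun z => ({x, y, z} : Finset (Fin n)) ∈ H) ⊆ B.erase y := by
    intro z hz
    rw [mem_filter] at hz
    obtain ⟨_, h2, h3⟩ := edge_ne h3 hz.2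
    simp [h3.symm, hz.1]
  have := card_le_card this
  rw [card_erase_of_mem hy] at this
  have : 0 < B.card := card_pos.2 ⟨y, hy⟩
  unfold degOn
  omega

theorem deg_zero {n : ℕ} {H : Finset (Finset (Fin n))} {x y : Fin n} {U : Finset (Fin n)}
    (h : ∀ z ∈ U, ({x, y, z} : Finset (Fin n)) ∉ H) : degOn H x y U = 0 := by
  unfold degOn
  rw [card_eq_zero, filter_eq_empty_iff]
  intro z hz; exact h z hz

/-- one exceptional vertex: there is an `AAB` edge. -/
theorem exists_aab_one {n : ℕ} {H : Finset (Finset (Fin n))} (h3 : Is3Graph n H)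
    {A B V : Finset (Fin n)} (s : Setup H A B V) (hn : 10 ^ 10 ≤ n)
    (hcd : ∀ x y : Fin n, x ≠ y → n ≤ 2 * degOn H x y univ + 2) (hV : V.card = 1) :
    ∃ a ∈ A, ∃ a' ∈ A, ∃ b ∈ B, ({a, a', b} : Finset (Fin n)) ∈ H := by
  by_contra hno
  push Not at hno
  obtain ⟨v, rfl⟩ := card_eq_one.1 hV
  obtain ⟨a, ha, b, hb, hab⟩ := s.nB v (by simp)
  have hA := s.cA
  have hsum := s.card_sum
  have hne : a ≠ b := fun h => disjoint_left.1 s.dAB ha (h ▸ hb)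
  obtain ⟨a', ha', haa'⟩ := exists_mem_ne (s := A) (by omega) a
  have c1 := hcd a b hne
  have c2 := hcd a a' haa'.symm
  have s1 := deg_split s a b
  have s2 := deg_split s a a'
  have z1 : degOn H a b A = 0 := deg_zero (by
    intro z hz; rw [tri_comm2]; exact hno a ha z hz b hb)
  have z2 : degOn H a b {v} = 0 := deg_zero (by
    intro z hz; rw [mem_singleton] at hz; subst hz; rwa [tri_rot])
  have z3 : degOn H a a' B = 0 := deg_zero (by
    intro z hz; exact hno a ha a' ha' z hz)
  have v2 := deg_le H a a' {v}
  have u1 := degA_le h3 ha ha' haa'.symm (H := H)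
  have u2 := degB_le h3 hb (H := H) (x := a)
  omega

theorem aab_zero {n : ℕ} {H : Finset (Finset (Fin n))} (h3 : Is3Graph n H)
    {A B V : Finset (Fin n)} (s : Setup H A B V)
    (hcd : ∀ x y : Fin n, x ≠ y → n ≤ 2 * degOn H x y univ + 2) (hV : V.card = 0) :
    (∀ a ∈ A, ∀ a' ∈ A, a ≠ a' → ∃ b ∈ B, ({a, a', b} : Finset (Fin n)) ∈ H) ∨
    (∀ a ∈ A, ∀ b ∈ B, ∃ a' ∈ A, ({a, a', b} : Finset (Fin n)) ∈ H) := by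
  by_contra hno
  push Not at hno
  obtain ⟨⟨a, ha, a', ha', haa', h1⟩, ⟨c, hc, b, hb, h2⟩⟩ := hno
  have hsum := s.card_sum
  have hne : c ≠ b := fun h => disjoint_left.1 s.dAB hc (h ▸ hb)
  have c1 := hcd c b hne
  have c2 := hcd a a' haa'
  have s1 := deg_split s c b
  have s2 := deg_split s a a'
  have v1 := deg_le H c b V
  have v2 := deg_le H a a' V
  have z1 : degOn H c b A = 0 := deg_zero (by
    intro z hz; rw [tri_comm2]; exact h2 z hz)
  have z3 : degOn H a a' B = 0 := deg_zero h1
  have u1 := degA_le h3 ha ha' haa' (H := H)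
  have u2 := degB_le h3 hb (H := H) (x := c)
  omega

theorem exists_avoid {n : ℕ} (X F : Finset (Fin n)) (h : F.card < X.card) :
    ∃ x ∈ X, x ∉ F := exists_mem_notMem_of_card_lt_card h

theorem two_aab {n : ℕ} {H : Finset (Finset (Fin n))} (h3 : Is3Graph n H)
    {A B V : Finset (Fin n)} (s : Setup H A B V) (hn : 10 ^ 10 ≤ n)
    (hcd : ∀ x y : Fin n, x ≠ y → n ≤ 2 * degOn H x y univ + 2) (hV : V.card = 0)
    (hl : ∀ a ∈ A, ∀ b ∈ B, 100 * degOn H a b A < n) :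
    ∃ a ∈ A, ∃ a' ∈ A, ∃ b ∈ B, ∃ c ∈ A, ∃ c' ∈ A, ∃ d ∈ B,
      ({a, a', b} : Finset (Fin n)) ∈ H ∧ ({c, c', d} : Finset (Fin n)) ∈ H ∧
      c ≠ a ∧ c ≠ a' ∧ c' ≠ a ∧ c' ≠ a' ∧ b ≠ d := by
  have hA := s.cA
  have hB := s.cB
  obtain ⟨a, ha⟩ : A.Nonempty := card_pos.1 (by omega)
  rcases aab_zero h3 s hcd hV with h | h
  · obtain ⟨a', ha', hne⟩ := exists_mem_ne (s := A) (by omega) a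
    obtain ⟨b, hb, he⟩ := h a ha a' ha' hne.symm
    obtain ⟨c, hc, hcF⟩ := exists_avoid A {a, a'} (by
      have := card_le_two (a := a) (b := a'); omega)
    obtain ⟨c', hc', hcF'⟩ := exists_avoid A
      ({a, a', c} ∪ A.filter fun z => ({c, b, z} : Finset (Fin n)) ∈ H) (by
      have h1 := card_union_le {a, a', c} (A.filter fun z => ({c, b, z} : Finset (Fin n)) ∈ H)
      have h2 := card_le_three (a := a) (b := a') (c := c)
      have h3 := hl c hc b hb
      unfold degOn at h3
      omega)
    simp only [mem_union, mem_insert, mem_singleton, mem_filter, not_or] at hcF hcF'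
    obtain ⟨d, hd, he'⟩ := h c hc c' hc' (fun h => hcF'.1.2.2 h.symm)
    refine ⟨a, ha, a', ha', b, hb, c, hc, c', hc', d, hd, he, he', hcF.1, hcF.2, hcF'.1.1,
      hcF'.1.2.1, ?_⟩
    rintro rfl
    rw [tri_comm2] at he'
    exact hcF'.2 ⟨hc', he'⟩
  · obtain ⟨b, hb⟩ : B.Nonempty := card_pos.1 (by omega)
    obtain ⟨a', ha', he⟩ := h a ha b hb
    obtain ⟨d, hd, hdb⟩ := exists_mem_ne (s := B) (by omega) b
    obtain ⟨c, hc, hcF⟩ := exists_avoid A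
      ({a, a'} ∪ ((A.filter fun z => ({a, d, z} : Finset (Fin n)) ∈ H) ∪
        (A.filter fun z => ({a', d, z} : Finset (Fin n)) ∈ H))) (by
      have h1 := card_union_le {a, a'} ((A.filter fun z => ({a, d, z} : Finset (Fin n)) ∈ H) ∪
        (A.filter fun z => ({a', d, z} : Finset (Fin n)) ∈ H))
      have h4 := card_union_le (A.filter fun z => ({a, d, z} : Finset (Fin n)) ∈ H)
        (A.filter fun z => ({a', d, z} : Finset (Fin n)) ∈ H)
      have h2 := card_le_two (a := a) (b := a')
      have h3 := hl a ha d hd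
      have h5 := hl a' ha' d hd
      unfold degOn at h3 h5
      omega)
    simp only [mem_union, mem_insert, mem_singleton, mem_filter, not_or] at hcF
    obtain ⟨c', hc', he'⟩ := h c hc d hd
    refine ⟨a, ha, a', ha', b, hb, c, hc, c', hc', d, hd, he, he', hcF.1.1, hcF.1.2, ?_, ?_,
      hdb.symm⟩
    · rintro rfl
      apply hcF.2.1
      refine ⟨hc, ?_⟩
      rw [tri_rot]; exact he'
    · rintro rfl
      apply hcF.2.2
      refine ⟨hc, ?_⟩
      rw [tri_rot]; exact he'

theorem s1_or_s22 {n : ℕ} {H : Finset (Finset (Fin n))} (h3 : Is3Graph n H)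
    {A B V : Finset (Fin n)} (s : Setup H A B V) (hn : 10 ^ 10 ≤ n)
    (hcd : ∀ x y : Fin n, x ≠ y → n ≤ 2 * degOn H x y univ + 2) (hV : V.card = 0)
    (hm : B.card % 3 = 1) : ModFix H A B V := by
  by_cases hl : ∀ a ∈ A, ∀ b ∈ B, 100 * degOn H a b A < n
  · obtain ⟨a, ha, a', ha', b, hb, c, hc, c', hc', d, hd, he, he', h1, h2, h4, h5, h6⟩ :=
      two_aab h3 s hn hcd hV hl
    obtain ⟨Q1, q1, k1, r1, t1⟩ := lightK h3 s hn hcd ha ha' hb he (hl a ha b hb) (hl a' ha' b hb)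
      {c, c', d} (by have := card_le_three (a := c) (b := c') (c := d); omega)
    obtain ⟨Q2, q2, k2, r2, t2⟩ := lightK h3 s hn hcd hc hc' hd he' (hl c hc d hd) (hl c' hc' d hd)
      Q1 (by have := k1.1; omega)
    refine modfix_two q1 q2 k1 k2 ?_ (by rw [r1, r2, hm])
    rw [disjoint_left]
    intro v hv1 hv2
    have nAB : ∀ x ∈ A, ∀ y ∈ B, x ≠ y := fun x hx y hy h => disjoint_left.1 s.dAB hx (h ▸ hy)
    have x1 := nAB a ha d hd
    have x2 := nAB a' ha' d hd
    have x3 := nAB c hc b hb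
    have x4 := nAB c' hc' b hb
    rcases t1 v hv1 with rfl | rfl | rfl | h <;> rcases t2 v hv2 with g | g | g | g <;>
      first
        | exact absurd hv1 g
        | (simp only [mem_insert, mem_singleton] at h; tauto)
        | (subst g; tauto)
  · push Not at hl
    obtain ⟨a, ha, b, hb, hh⟩ := hl
    obtain ⟨Q, q1, q2, q3, -⟩ := heavyK h3 s hn ha hb hh ∅ (by simp)
    exact modfix_one q1 q2 (empty_subset V) (by rw [q3]; simpa using hm)

theorem s2_or_s11 {n : ℕ} {H : Finset (Finset (Fin n))} (h3 : Is3Graph n H)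
    {A B V : Finset (Fin n)} (s : Setup H A B V) (hn : 10 ^ 10 ≤ n)
    (hcd : ∀ x y : Fin n, x ≠ y → n ≤ 2 * degOn H x y univ + 2) (hV : V.card = 0)
    (hm : B.card % 3 = 2) : ModFix H A B V := by
  by_contra hcon
  have nAB : ∀ x ∈ A, ∀ y ∈ B, x ≠ y := fun x hx y hy h => disjoint_left.1 s.dAB hx (h ▸ hy)
  have hno2 : ∀ Q ⊆ A ∪ B, SpansK4m H Q → (Q ∩ B).card = 2 → False := by
    intro Q q1 q2 q3
    exact hcon (modfix_one q1 q2 (empty_subset V) (by rw [q3]; simpa using hm))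
  have hheavy : ∀ a ∈ A, ∀ a' ∈ A, ∀ b ∈ B, ({a, a', b} : Finset (Fin n)) ∈ H →
      n ≤ 100 * degOn H a b A ∨ n ≤ 100 * degOn H a' b A := by
    intro a ha a' ha' b hb he
    by_contra hc
    push Not at hc
    obtain ⟨Q, q1, q2, q3, -⟩ := lightK h3 s hn hcd ha ha' hb he hc.1 hc.2 ∅ (by simp)
    exact hno2 Q q1 q2 q3
  have hno11 : ∀ a ∈ A, ∀ b ∈ B, ∀ c ∈ A, ∀ d ∈ B, n ≤ 100 * degOn H a b A →
      n ≤ 100 * degOn H c d A → c = a ∨ d = b := by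
    intro a ha b hb c hc d hd h1 h2
    by_contra hne
    push Not at hne
    obtain ⟨Q1, q1, k1, r1, t1⟩ := heavyK h3 s hn ha hb h1 {c, d} (by
      have := card_le_two (a := c) (b := d); omega)
    obtain ⟨Q2, q2, k2, r2, t2⟩ := heavyK h3 s hn hc hd h2 Q1 (by have := k1.1; omega)
    refine hcon (modfix_two q1 q2 k1 k2 ?_ (by rw [r1, r2, hm]))
    rw [disjoint_left]
    intro v hv1 hv2
    have x1 := nAB a ha d hd
    have x2 := nAB c hc b hb
    rcases t1 v hv1 with rfl | rfl | h <;> rcases t2 v hv2 with g | g | g <;>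
      first
        | exact absurd hv1 g
        | (simp only [mem_insert, mem_singleton] at h; tauto)
        | (subst g; tauto)
  have hA := s.cA
  have hB := s.cB
  have hsum := s.card_sum
  have hexh : ∃ a ∈ A, ∃ b ∈ B, n ≤ 100 * degOn H a b A := by
    have : ∃ a ∈ A, ∃ a' ∈ A, ∃ b ∈ B, ({a, a', b} : Finset (Fin n)) ∈ H := by
      obtain ⟨a, ha⟩ : A.Nonempty := card_pos.1 (by omega)
      rcases aab_zero h3 s hcd hV with h | h
      · obtain ⟨a', ha', hne⟩ := exists_mem_ne (s := A) (by omega) a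
        obtain ⟨b, hb, he⟩ := h a ha a' ha' hne.symm
        exact ⟨a, ha, a', ha', b, hb, he⟩
      · obtain ⟨b, hb⟩ : B.Nonempty := card_pos.1 (by omega)
        obtain ⟨a', ha', he⟩ := h a ha b hb
        exact ⟨a, ha, a', ha', b, hb, he⟩
    obtain ⟨a, ha, a', ha', b, hb, he⟩ := this
    rcases hheavy a ha a' ha' b hb he with h | h
    · exact ⟨a, ha, b, hb, h⟩
    · exact ⟨a', ha', b, hb, h⟩
  obtain ⟨a, ha, b, hb, hab⟩ := hexh
  rcases aab_zero h3 s hcd hV with h | h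
  · -- all pairs `c c'` form an edge with `b`
    have hall : ∀ c ∈ A, ∀ c' ∈ A, c ≠ c' → c ≠ a → c' ≠ a →
        ({c, c', b} : Finset (Fin n)) ∈ H := by
      intro c hc c' hc' hne hca hca'
      obtain ⟨d, hd, he⟩ := h c hc c' hc' hne
      have : d = b := by
        rcases hheavy c hc c' hc' d hd he with hh | hh
        · exact (hno11 a ha b hb c hc d hd hab hh).resolve_left hca
        · exact (hno11 a ha b hb c' hc' d hd hab hh).resolve_left hca'
      rwa [this] at he
    have hmiss := s.good.bb b hb
    -- choose `d` with two neighbours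
    have hch : ∃ d ∈ B, ∃ c ∈ A.erase a, ∃ c' ∈ A.erase a,
        ({b, c, d} : Finset (Fin n)) ∈ H ∧ ({b, c', d} : Finset (Fin n)) ∈ H ∧ c ≠ c' := by
      by_contra hbad
      push Not at hbad
      have hle : ∀ d ∈ B, ((A.erase a).filter fun c => ({b, c, d} : Finset (Fin n)) ∈ H).card ≤ 1 := by
        intro d hd
        rw [card_le_one]
        intro c hc c' hc'
        rw [mem_filter] at hc hc'
        exact hbad d hd c hc.1 c' hc'.1 hc.2 hc'.2
      have hsumm : missC H b A B ≥ B.card * (A.card - 2) := by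
        have h0 : missC H b A B ≥ ∑ d ∈ B, (A.card - 2) := by
          have : missC H b A B =
              ∑ d ∈ B, (A.filter fun c => ({b, c, d} : Finset (Fin n)) ∉ H).card := by
            unfold missC
            simp only [card_filter, sum_product_right]
          rw [this]
          apply sum_le_sum
          intro d hd
          have e1 := card_filter_add_card_filter_not (s := A.erase a) (fun c => ({b, c, d} : Finset (Fin n)) ∈ H)
          have e2 := hle d hd
          have e3 : ((A.erase a).filter fun c => ({b, c, d} : Finset (Fin n)) ∉ H).card ≤
            (A.filter fun c => ({b, c, d} : Finset (Fin n)) ∉ H).card :=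
            card_le_card (filter_subset_filter _ (erase_subset _ _))
          rw [card_erase_of_mem ha] at e1
          omega
        simpa using h0
      have h5 : n ≤ 3 * (A.card - 2) := by omega
      have h6 : n ≤ 3 * B.card := by omega
      have h7 : n * n ≤ (3 * B.card) * (3 * (A.card - 2)) := Nat.mul_le_mul h6 h5
      nlinarith
    obtain ⟨d, hd, c, hc, c', hc', e1, e2, hne⟩ := hch
    rw [mem_erase] at hc hc'
    have hbd : b ≠ d := (edge_ne h3 e1).2.1
    have hQ : ∀ t, t ∈ ({b, c, c', d} : Finset (Fin n)) ↔ t = c ∨ t = c' ∨ t = b ∨ t = d := by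
      intro t; simp only [mem_insert, mem_singleton]; tauto
    obtain ⟨q1, q2⟩ := aabb_inter s.dAB hc.2 hc'.2 hb hd hbd hQ
    refine hno2 _ q1 (k4m_mk h3 ?_ e1 e2) q2
    rw [← tri_rot]
    exact hall c hc.2 c' hc'.2 hne hc.1 hc'.1
  · have hall : ∀ c ∈ A, ∀ d ∈ B, c ≠ a → d ≠ b → ({a, c, d} : Finset (Fin n)) ∈ H := by
      intro c hc d hd hca hdb
      obtain ⟨c', hc', he⟩ := h c hc d hd
      rcases hheavy c hc c' hc' d hd he with hh | hh
      · exact absurd (hno11 a ha b hb c hc d hd hab hh) (by tauto)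
      · have : c' = a := (hno11 a ha b hb c' hc' d hd hab hh).resolve_right hdb
        subst this
        rwa [tri_comm1]
    obtain ⟨c, hc, hca⟩ := exists_mem_ne (s := A) (by omega) a
    have hmiss : missC H a (B.erase b) (B.erase b) < (B.erase b).card * (B.erase b).card := by
      have h1 := s.good.ab a ha
      have h2 := missC_mono H a (erase_subset b B) (erase_subset b B)
      have h5 : n ≤ 3 * (B.erase b).card := by rw [card_erase_of_mem hb]; omega
      nlinarith
    obtain ⟨d, hd, d', hd', e1⟩ := exists_edge_of_large H a _ _ hmiss
    rw [mem_erase] at hd hd'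
    have hdd : d ≠ d' := (edge_ne h3 e1).2.2
    have hQ : ∀ t, t ∈ ({a, c, d, d'} : Finset (Fin n)) ↔ t = a ∨ t = c ∨ t = d ∨ t = d' := by
      intro t; simp only [mem_insert, mem_singleton]
    obtain ⟨q1, q2⟩ := aabb_inter s.dAB ha hc hd.2 hd'.2 hdd hQ
    exact hno2 _ q1 (k4m_mk h3 (hall c hc d hd.2 hca hd.1) (hall c hc d' hd'.2 hca hd'.1) e1) q2

theorem modfix {n : ℕ} {H : Finset (Finset (Fin n))} (h3 : Is3Graph n H)
    {A B V : Finset (Fin n)} (s : Setup H A B V) (hn : 10 ^ 10 ≤ n)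
    (hcd : ∀ x y : Fin n, x ≠ y → n ≤ 2 * degOn H x y univ + 2) : ModFix H A B V := by
  have h012 : B.card % 3 = 0 ∨ B.card % 3 = 1 ∨ B.card % 3 = 2 := by omega
  by_cases hb0 : B.card % 3 = 0
  · exact modfix_zero (empty_subset V) (by simpa using hb0)
  by_cases hV0 : V.card = 0
  · rcases h012 with h | h | h
    · exact absurd h hb0
    · exact s1_or_s22 h3 s hn hcd hV0 h
    · exact s2_or_s11 h3 s hn hcd hV0 h
  by_cases hb2 : B.card % 3 = 2
  · obtain ⟨T, hT, hTc⟩ := exists_subset_card_eq (s := V) (n := 1) (by omega)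
    exact modfix_zero hT (by omega)
  by_cases hV1 : V.card = 1
  · obtain ⟨a, ha, a', ha', b, hb, he⟩ := exists_aab_one h3 s hn hcd hV1
    by_cases hh : n ≤ 100 * degOn H a b A
    · obtain ⟨Q, q1, q2, q3, -⟩ := heavyK h3 s hn ha hb hh ∅ (by simp)
      exact modfix_one q1 q2 (empty_subset V) (by rw [q3, card_empty]; omega)
    by_cases hh' : n ≤ 100 * degOn H a' b A
    · obtain ⟨Q, q1, q2, q3, -⟩ := heavyK h3 s hn ha' hb hh' ∅ (by simp)
      exact modfix_one q1 q2 (empty_subset V) (by rw [q3, card_empty]; omega)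
    obtain ⟨Q, q1, q2, q3, -⟩ := lightK h3 s hn hcd ha ha' hb he (by omega) (by omega) ∅ (by simp)
    exact modfix_one q1 q2 (subset_refl V) (by rw [q3]; omega)
  · obtain ⟨T, hT, hTc⟩ := exists_subset_card_eq (s := V) (n := 2) (by omega)
    exact modfix_zero hT (by omega)

/-- Number of pairs in `X × Y` in the link of `v`. -/
def linkC {n : ℕ} (H : Finset (Finset (Fin n))) (v : Fin n) (X Y : Finset (Fin n)) : ℕ :=
  ((X ×ˢ Y).filter fun p => ({v, p.1, p.2} : Finset (Fin n)) ∈ H).card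

theorem pert {n : ℕ} (R : Fin n × Fin n → Prop) [DecidablePred R] {X Y X0 Y0 U : Finset (Fin n)}
    (hX : X ⊆ X0 ∪ U) (hY : Y ⊆ Y0 ∪ U) :
    ((X ×ˢ Y).filter R).card ≤ ((X0 ×ˢ Y0).filter R).card + 2 * (U.card * n) := by
  have hsub : (X ×ˢ Y).filter R ⊆ (X0 ×ˢ Y0).filter R ∪ (U ×ˢ univ ∪ univ ×ˢ U) := by
    rintro ⟨x, y⟩ h
    simp only [mem_filter, mem_product] at h
    have h1 := mem_union.1 (hX h.1.1)
    have h2 := mem_union.1 (hY h.1.2)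
    simp only [mem_union, mem_filter, mem_product, mem_univ, and_true, true_and]
    tauto
  have h1 := card_le_card hsub
  have h2 := card_union_le ((X0 ×ˢ Y0).filter R) (U ×ˢ univ ∪ univ ×ˢ U)
  have h3 := card_union_le (U ×ˢ (univ : Finset (Fin n))) (univ ×ˢ U)
  rw [card_product, card_product, card_univ, Fintype.card_fin, mul_comm n] at h3
  omega

theorem triple_bound {n : ℕ} (H K : Finset (Finset (Fin n))) (X Y Z : Finset (Fin n))
    (hK : ∀ e ∈ K, e.card = 3)
    (h : ∀ x ∈ X, ∀ y ∈ Y, ∀ z ∈ Z, x ≠ y → x ≠ z → y ≠ z → ({x, y, z} : Finset (Fin n)) ∈ K) :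
    ∑ x ∈ X, missC H x Y Z ≤ (K \ H).card * 27 + 3 * n ^ 2 := by
  have e1 : ∑ x ∈ X, missC H x Y Z = ((X ×ˢ (Y ×ˢ Z)).filter fun t =>
      ({t.1, t.2.1, t.2.2} : Finset (Fin n)) ∉ H).card := by
    rw [card_filter_prod X (Y ×ˢ Z) (fun x p => ({x, p.1, p.2} : Finset (Fin n)) ∉ H)]
    rfl
  rw [e1]
  let G1 := univ.image fun t : Fin n × Fin n => (t.1, t.1, t.2)
  let G2 := univ.image fun t : Fin n × Fin n => (t.1, t.2, t.1)
  let G3 := univ.image fun t : Fin n × Fin n => (t.1, t.2, t.2)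
  have hG : ∀ f : Fin n × Fin n → Fin n × Fin n × Fin n, (univ.image f).card ≤ n ^ 2 := by
    intro f
    refine le_trans card_image_le ?_
    simp [sq]
  let F := (K \ H).biUnion fun e => e ×ˢ (e ×ˢ e)
  have hF : F.card ≤ (K \ H).card * 27 := by
    apply card_biUnion_le_card_mul
    intro e he
    rw [card_product, card_product, hK e (mem_sdiff.1 he).1]
  have hsub : ((X ×ˢ (Y ×ˢ Z)).filter fun t => ({t.1, t.2.1, t.2.2} : Finset (Fin n)) ∉ H) ⊆
      F ∪ (G1 ∪ (G2 ∪ G3)) := by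
    rintro ⟨x, y, z⟩ ht
    simp only [mem_filter, mem_product] at ht
    simp only [mem_union, F, G1, G2, G3, mem_biUnion, mem_image, mem_univ, true_and, mem_sdiff,
      Prod.exists, Prod.mk.injEq, mem_product]
    by_cases c1 : x = y
    · subst c1; simp
    by_cases c2 : x = z
    · subst c2; simp
    by_cases c3 : y = z
    · subst c3; simp
    left
    exact ⟨{x, y, z}, ⟨h x ht.1.1 y ht.1.2.1 z ht.1.2.2 c1 c2 c3, ht.2⟩, by simp⟩
  have c0 := card_le_card hsub
  have c1 := card_union_le F (G1 ∪ (G2 ∪ G3))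
  have c2 := card_union_le G1 (G2 ∪ G3)
  have c3 := card_union_le G2 G3
  have g1 : G1.card ≤ n ^ 2 := hG _
  have g2 : G2.card ≤ n ^ 2 := hG _
  have g3 : G3.card ≤ n ^ 2 := hG _
  omega

theorem markov {n : ℕ} (hn : 0 < n) (X : Finset (Fin n)) (f : Fin n → ℕ)
    (h : 10 ^ 14 * ∑ x ∈ X, f x ≤ n ^ 3) :
    500000000 * (X.filter fun x => ¬ 200000 * f x ≤ n ^ 2).card ≤ n := by
  set Y := X.filter fun x => ¬ 200000 * f x ≤ n ^ 2 with hY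
  have h1 : Y.card * n ^ 2 ≤ ∑ x ∈ Y, 200000 * f x := by
    rw [← smul_eq_mul]
    apply card_nsmul_le_sum
    intro x hx
    rw [hY, mem_filter] at hx
    omega
  have h2 : ∑ x ∈ Y, 200000 * f x ≤ ∑ x ∈ X, 200000 * f x :=
    sum_le_sum_of_subset (filter_subset _ _)
  have e : ∑ x ∈ X, 200000 * f x = 200000 * ∑ x ∈ X, f x := (mul_sum _ _ _).symm
  rw [e] at h2
  have h3 : (500000000 * Y.card) * n ^ 2 ≤ n * n ^ 2 := by
    have : n ^ 3 = n * n ^ 2 := by ring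
    rw [mul_assoc]
    omega
  exact Nat.le_of_mul_le_mul_right h3 (by positivity)

theorem miss_le_link {n : ℕ} (H : Finset (Finset (Fin n)))
    (hcd : ∀ x y : Fin n, x ≠ y → n ≤ 2 * degOn H x y univ + 2) (v : Fin n)
    (P Q1 Q2 : Finset (Fin n)) (hQ : Q1 ∪ Q2 = univ) (hc : 2 * Q1.card = n) :
    missC H v P Q1 ≤ linkC H v P Q2 + 2 * n := by
  have e1 : missC H v P Q1 =
      ∑ x ∈ P, (Q1.filter fun y => ({v, x, y} : Finset (Fin n)) ∉ H).card :=
    card_filter_prod P Q1 (fun x y => ({v, x, y} : Finset (Fin n)) ∉ H)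
  have e2 : linkC H v P Q2 =
      ∑ x ∈ P, (Q2.filter fun y => ({v, x, y} : Finset (Fin n)) ∈ H).card :=
    card_filter_prod P Q2 (fun x y => ({v, x, y} : Finset (Fin n)) ∈ H)
  have h1 : ∀ x ∈ P, (Q1.filter fun y => ({v, x, y} : Finset (Fin n)) ∉ H).card ≤
      (Q2.filter fun y => ({v, x, y} : Finset (Fin n)) ∈ H).card + (1 + if x = v then n else 0) := by
    intro x _
    have f1 := card_filter_add_card_filter_not (s := Q1)
      (fun y => ({v, x, y} : Finset (Fin n)) ∈ H)
    split_ifs with hxv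
    · omega
    · have f2 := hcd v x (Ne.symm hxv)
      have f3 : degOn H v x univ ≤ (Q1.filter fun y => ({v, x, y} : Finset (Fin n)) ∈ H).card +
          (Q2.filter fun y => ({v, x, y} : Finset (Fin n)) ∈ H).card := by
        unfold degOn
        rw [← hQ, filter_union]
        exact card_union_le _ _
      omega
  have h2 := sum_le_sum h1
  rw [sum_add_distrib, sum_add_distrib, ← e1, ← e2] at h2
  have h3 : ∑ x ∈ P, (if x = v then n else 0) ≤ n := by
    rw [sum_ite_eq']; split_ifs <;> simp
  have h4 : ∑ x ∈ P, 1 ≤ n := by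
    have := card_le_univ P
    simpa using this
  omega

theorem linkC_comm {n : ℕ} (H : Finset (Finset (Fin n))) (v : Fin n) (X Y : Finset (Fin n)) :
    linkC H v X Y ≤ linkC H v Y X := by
  unfold linkC
  apply card_le_card_of_injOn Prod.swap
  · rintro ⟨x, y⟩ h
    simp only [coe_filter, mem_product, Set.mem_ofPred_eq, Prod.swap_prod_mk] at h ⊢
    exact ⟨h.1.symm, by rw [tri_comm2]; exact h.2⟩
  · intro a _ b _ h
    exact Prod.swap_injective h

theorem robust {n : ℕ} {H : Finset (Finset (Fin n))} (h3 : Is3Graph n H) (hn : 10 ^ 20 ≤ n)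
    (v : Fin n) (P Q Z : Finset (Fin n)) (hZ : 8000000 * Z.card ≤ n)
    (hl : n ^ 2 ≤ 200000 * (linkC H v P Q + 2 * n))
    (hm : 10 ^ 14 * ∑ x ∈ P, missC H x Q Q ≤ n ^ 3) :
    ∃ x ∈ P \ Z, ∃ y ∈ Q \ Z, ∃ z ∈ Q \ Z, x ≠ y ∧ x ≠ z ∧ y ≠ z ∧ SpansK4m H {v, x, y, z} := by
  have hp : linkC H v P Q ≤ linkC H v (P \ Z) (Q \ Z) + 2 * (Z.card * n) :=
    pert _ (by intro t ht; simp [ht]) (by intro t ht; simp [ht])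
  have hzn : 8000000 * (Z.card * n) ≤ n ^ 2 := by
    rw [sq, ← mul_assoc]; exact Nat.mul_le_mul_right _ hZ
  have hnn : 10 ^ 20 * n ≤ n ^ 2 := by
    rw [sq]; exact Nat.mul_le_mul_right _ hn
  have hbig : n ^ 2 ≤ 250000 * linkC H v (P \ Z) (Q \ Z) := by omega
  have hbadN : 10 ^ 14 * (((P \ Z) ×ˢ ((Q \ Z) ×ˢ (Q \ Z))).filter fun p =>
      ({p.1, p.2.1, p.2.2} : Finset (Fin n)) ∉ H).card ≤ n ^ 3 := by
    refine le_trans (Nat.mul_le_mul_left _ ?_) hm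
    have e1 : ∑ x ∈ P, missC H x Q Q = ((P ×ˢ (Q ×ˢ Q)).filter fun t =>
        ({t.1, t.2.1, t.2.2} : Finset (Fin n)) ∉ H).card := by
      rw [card_filter_prod P (Q ×ˢ Q) (fun x p => ({x, p.1, p.2} : Finset (Fin n)) ∉ H)]
      rfl
    rw [e1]
    exact card_le_card (filter_subset_filter _ (product_subset_product sdiff_subset
      (product_subset_product sdiff_subset sdiff_subset)))
  obtain ⟨x, hx, y, hy, z, hz, l1, l2, l3⟩ := cherry (P \ Z) (Q \ Z)
    (fun x y => ({v, x, y} : Finset (Fin n)) ∈ H)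
    (fun x p => ({x, p.1, p.2} : Finset (Fin n)) ∉ H) (1 / 250000) (by norm_num)
    (by
      have : ((n : ℝ)) ^ 2 ≤ 250000 * (linkC H v (P \ Z) (Q \ Z) : ℝ) := by exact_mod_cast hbig
      unfold linkC at this
      linarith)
    (by
      have h1 : (10 : ℝ) ^ 14 * ((((P \ Z) ×ˢ ((Q \ Z) ×ˢ (Q \ Z))).filter fun p =>
        ({p.1, p.2.1, p.2.2} : Finset (Fin n)) ∉ H).card : ℝ) ≤ (n : ℝ) ^ 3 := by
        exact_mod_cast hbadN
      have h2 : (0 : ℝ) < (n : ℝ) ^ 3 := by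
        have : (0 : ℝ) < n := by
          have : 0 < n := by omega
          exact_mod_cast this
        positivity
      norm_num at h1 ⊢
      linarith)
  rw [not_not] at l3
  obtain ⟨n1, n2, n3⟩ := edge_ne h3 l3
  refine ⟨x, hx, y, hy, z, hz, n1, n2, n3, ?_⟩
  have : ({v, x, y, z} : Finset (Fin n)) = {x, v, y, z} := insert_comm _ _ _
  rw [this]
  apply k4m_mk h3
  · rw [tri_comm1]; exact l1
  · rw [tri_comm1]; exact l2
  · exact l3

set_option maxHeartbeats 1000000 in
theorem setup_exists {n : ℕ} {H : Finset (Finset (Fin n))} (h3 : Is3Graph n H) (hn : 10 ^ 20 ≤ n)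
    (heven : 2 ∣ n) (hcd : ∀ x y : Fin n, x ≠ y → n ≤ 2 * degOn H x y univ + 2)
    (A0 B0 : Finset (Fin n)) (hd : Disjoint A0 B0) (hu : A0 ∪ B0 = univ)
    (hA0 : A0.card = n / 2) (hB0 : B0.card = n - n / 2)
    (hK : 10 ^ 16 * (BGraph A0 B0 \ H).card ≤ n ^ 3) :
    ∃ A B V, Setup H A B V := by
  classical
  have hnn : 10 ^ 20 * n ^ 2 ≤ n ^ 3 := by
    rw [show n ^ 3 = n * n ^ 2 by ring]; exact Nat.mul_le_mul_right _ hn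
  have hnn1 : 10 ^ 20 * n ≤ n ^ 2 := by
    rw [sq]; exact Nat.mul_le_mul_right _ hn
  have hcA0 : 2 * A0.card = n := by omega
  have hcB0 : 2 * B0.card = n := by omega
  have hKc : ∀ e ∈ BGraph A0 B0, e.card = 3 := by
    intro e he
    exact (mem_powersetCard.1 (mem_filter.1 he).1).2
  have hBA : ∀ t ∈ B0, t ∉ A0 := fun t ht h => disjoint_left.1 hd h ht
  have hmem : ∀ x y z : Fin n, x ≠ y → x ≠ z → y ≠ z → x ∈ A0 → ((y ∈ A0 ∧ z ∈ A0) ∨ (y ∈ B0 ∧ z ∈ B0)) →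
      ({x, y, z} : Finset (Fin n)) ∈ BGraph A0 B0 := by
    intro x y z h1 h2 h4 hx hyz
    have hc : ({x, y, z} : Finset (Fin n)).card = 3 := card_eq_three.2 ⟨x, y, z, h1, h2, h4, rfl⟩
    unfold BGraph
    rw [mem_filter, mem_powersetCard, hu]
    refine ⟨⟨subset_univ _, hc⟩, ?_⟩
    rcases hyz with ⟨hy, hz⟩ | ⟨hy, hz⟩
    · rw [inter_eq_left.2, hc]
      intro t; simp only [mem_insert, mem_singleton]; rintro (rfl | rfl | rfl) <;> assumption
    · have : ({x, y, z} : Finset (Fin n)) ∩ A0 = {x} := by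
        rw [insert_inter_of_mem hx, insert_inter_of_notMem (hBA y hy),
          singleton_inter_of_notMem (hBA z hz)]
        rfl
      rw [this, card_singleton]
  have sAA : 10 ^ 14 * ∑ x ∈ A0, missC H x A0 A0 ≤ n ^ 3 := by
    have := triple_bound H (BGraph A0 B0) A0 A0 A0 hKc (fun x hx y hy z hz h1 h2 h4 =>
      hmem x y z h1 h2 h4 hx (Or.inl ⟨hy, hz⟩))
    omega
  have sAB : 10 ^ 14 * ∑ x ∈ A0, missC H x B0 B0 ≤ n ^ 3 := by
    have := triple_bound H (BGraph A0 B0) A0 B0 B0 hKc (fun x hx y hy z hz h1 h2 h4 =>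
      hmem x y z h1 h2 h4 hx (Or.inr ⟨hy, hz⟩))
    omega
  have sBB : 10 ^ 14 * ∑ x ∈ B0, missC H x A0 B0 ≤ n ^ 3 := by
    have := triple_bound H (BGraph A0 B0) B0 A0 B0 hKc (fun x hx y hy z hz h1 h2 h4 => by
      rw [tri_comm1]
      exact hmem y x z h1.symm h4 h2 hy (Or.inr ⟨hx, hz⟩))
    omega
  have npos : 0 < n := by omega
  have m1 := markov npos A0 _ sAA
  have m2 := markov npos A0 _ sAB
  have m3 := markov npos B0 _ sBB
  obtain ⟨al, hald⟩ : ∃ al : Fin n → Prop, ∀ v, al v ↔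
      (200000 * missC H v A0 A0 ≤ n ^ 2 ∧ 200000 * missC H v B0 B0 ≤ n ^ 2) := ⟨_, fun _ => Iff.rfl⟩
  obtain ⟨bl, hbld⟩ : ∃ bl : Fin n → Prop, ∀ v, bl v ↔
      200000 * missC H v A0 B0 ≤ n ^ 2 := ⟨_, fun _ => Iff.rfl⟩
  obtain ⟨U, memU⟩ : ∃ U : Finset (Fin n), ∀ t, t ∈ U ↔ (t ∈ A0 ∧ ¬ al t) ∨ (t ∈ B0 ∧ ¬ bl t) :=
    ⟨(A0.filter fun v => ¬ al v) ∪ (B0.filter fun v => ¬ bl v), fun t => by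
      simp only [mem_union, mem_filter]⟩
  have hU : 100000000 * U.card ≤ n := by
    have hs : U ⊆ (A0.filter fun x => ¬ 200000 * missC H x A0 A0 ≤ n ^ 2) ∪
        ((A0.filter fun x => ¬ 200000 * missC H x B0 B0 ≤ n ^ 2) ∪
        (B0.filter fun x => ¬ 200000 * missC H x A0 B0 ≤ n ^ 2)) := by
      intro t ht
      rw [memU, hald, hbld] at ht
      simp only [mem_union, mem_filter]
      generalize (200000 * missC H t A0 A0 ≤ n ^ 2) = p1 at ht ⊢
      generalize (200000 * missC H t B0 B0 ≤ n ^ 2) = p2 at ht ⊢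
      generalize (200000 * missC H t A0 B0 ≤ n ^ 2) = p3 at ht ⊢
      tauto
    have c0 := card_le_card hs
    have c1 := card_union_le (A0.filter fun x => ¬ 200000 * missC H x A0 A0 ≤ n ^ 2)
      ((A0.filter fun x => ¬ 200000 * missC H x B0 B0 ≤ n ^ 2) ∪
        (B0.filter fun x => ¬ 200000 * missC H x A0 B0 ≤ n ^ 2))
    have c2 := card_union_le (A0.filter fun x => ¬ 200000 * missC H x B0 B0 ≤ n ^ 2)
        (B0.filter fun x => ¬ 200000 * missC H x A0 B0 ≤ n ^ 2)
    omega
  have hUn : 100000000 * (U.card * n) ≤ n ^ 2 := by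
    rw [sq, ← mul_assoc]; exact Nat.mul_le_mul_right _ hU
  have hor : ∀ t, t ∈ A0 ∨ t ∈ B0 := fun t => mem_union.1 (hu ▸ mem_univ t)
  have hAB0 : ∀ t ∈ A0, t ∉ B0 := fun t ht => disjoint_left.1 hd ht
  obtain ⟨A, memA⟩ : ∃ A : Finset (Fin n), ∀ t, t ∈ A ↔
      (t ∈ A0 ∧ al t) ∨ (t ∈ B0 ∧ ¬ bl t ∧ al t) :=
    ⟨(A0.filter fun v => al v) ∪ (B0.filter fun v => ¬ bl v ∧ al v), fun t => by
      simp only [mem_union, mem_filter]⟩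
  obtain ⟨B, memB⟩ : ∃ B : Finset (Fin n), ∀ t, t ∈ B ↔
      (t ∈ B0 ∧ bl t) ∨ (t ∈ A0 ∧ ¬ al t ∧ bl t) :=
    ⟨(B0.filter fun v => bl v) ∪ (A0.filter fun v => ¬ al v ∧ bl v), fun t => by
      simp only [mem_union, mem_filter]⟩
  obtain ⟨V, memV⟩ : ∃ V : Finset (Fin n), ∀ t, t ∈ V ↔ ¬ al t ∧ ¬ bl t :=
    ⟨univ.filter fun v => ¬ al v ∧ ¬ bl v, fun t => by
      simp only [mem_filter, mem_univ, true_and]⟩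
  have hA1 : A ⊆ A0 ∪ U := by
    intro t; rw [mem_union, memA, memU]; tauto
  have hB1 : B ⊆ B0 ∪ U := by
    intro t; rw [mem_union, memB, memU]; tauto
  have hA2 : A0 \ U ⊆ A := by
    intro t; rw [mem_sdiff, memA, memU]; tauto
  have hB2 : B0 \ U ⊆ B := by
    intro t; rw [mem_sdiff, memB, memU]; tauto
  have hVU : V ⊆ U := by
    intro t; rw [memV, memU]; have := hor t; tauto
  have cVU := card_le_card hVU
  have cA2 := card_le_card hA2
  have cB2 := card_le_card hB2
  have cA3 := le_card_sdiff U A0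
  have cB3 := le_card_sdiff U B0
  have dAB : Disjoint A B := by
    rw [disjoint_left]; intro t; rw [memA, memB]; have := hAB0 t; tauto
  have hZsub : ∀ W : Finset (Fin n), 10000000 * W.card ≤ n → 8000000 * (W ∪ U).card ≤ n := by
    intro W hW
    have := card_union_le W U
    omega
  refine ⟨A, B, V, dAB, ?_, ?_, ?_, ⟨?_, ?_, ?_⟩, by omega, by omega, by omega, ?_, ?_, ?_⟩
  · rw [disjoint_left]; intro t; rw [memA, memV]; tauto
  · rw [disjoint_left]; intro t; rw [memB, memV]; tauto
  · rw [eq_univ_iff_forall]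
    intro t
    rw [mem_union, mem_union, memA, memB, memV]
    have := hor t
    tauto
  · intro a ha
    have hal : al a := by rw [memA] at ha; tauto
    have h1 : missC H a A A ≤ missC H a A0 A0 + 2 * (U.card * n) := pert _ hA1 hA1
    have := ((hald a).1 hal).1
    omega
  · intro a ha
    have hal : al a := by rw [memA] at ha; tauto
    have h1 : missC H a B B ≤ missC H a B0 B0 + 2 * (U.card * n) := pert _ hB1 hB1
    have := ((hald a).1 hal).2
    omega
  · intro b hb
    have hbl : bl b := by rw [memB] at hb; tauto
    have h1 : missC H b A B ≤ missC H b A0 B0 + 2 * (U.card * n) := pert _ hA1 hB1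
    have : 200000 * missC H b A0 B0 ≤ n ^ 2 := (hbld b).1 hbl
    omega
  · intro v hv W hW
    have hnb : ¬ 200000 * missC H v A0 B0 ≤ n ^ 2 := fun h => ((memV v).1 hv).2 ((hbld v).2 h)
    have hml := miss_le_link H hcd v A0 B0 A0 (by rw [union_comm]; exact hu) hcB0
    obtain ⟨x, hx, y, hy, z, hz, n1, n2, n3, hS⟩ := robust h3 hn v A0 A0 (W ∪ U) (hZsub W hW)
      (by omega) sAA
    simp only [mem_sdiff, mem_union, not_or] at hx hy hz
    have iA : ∀ t, t ∈ A0 → t ∉ U → t ∈ A := fun t h h' => hA2 (mem_sdiff.2 ⟨h, h'⟩)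
    refine ⟨{x, y, z}, ?_, card_eq_three.2 ⟨x, y, z, n1, n2, n3, rfl⟩, ?_, hS⟩
    · intro t; simp only [mem_insert, mem_singleton]
      rintro (rfl | rfl | rfl)
      · exact iA _ hx.1 hx.2.2
      · exact iA _ hy.1 hy.2.2
      · exact iA _ hz.1 hz.2.2
    · simp only [disjoint_insert_left, disjoint_singleton_left]
      exact ⟨hx.2.1, hy.2.1, hz.2.1⟩
  · intro v hv W hW
    have hna : ¬ al v := ((memV v).1 hv).1
    have hlink : n ^ 2 ≤ 200000 * (linkC H v A0 B0 + 2 * n) := by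
      by_cases h1 : 200000 * missC H v A0 A0 ≤ n ^ 2
      · have h2 : ¬ 200000 * missC H v B0 B0 ≤ n ^ 2 := fun h => hna ((hald v).2 ⟨h1, h⟩)
        have hml := miss_le_link H hcd v B0 B0 A0 (by rw [union_comm]; exact hu) hcB0
        have := linkC_comm H v B0 A0
        omega
      · have hml := miss_le_link H hcd v A0 A0 B0 hu hcA0
        omega
    obtain ⟨x, hx, y, hy, z, hz, n1, n2, n3, hS⟩ := robust h3 hn v A0 B0 (W ∪ U) (hZsub W hW)
      hlink sAB
    simp only [mem_sdiff, mem_union, not_or] at hx hy hz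
    have ixA : x ∈ A := hA2 (mem_sdiff.2 ⟨hx.1, hx.2.2⟩)
    have iyB : y ∈ B := hB2 (mem_sdiff.2 ⟨hy.1, hy.2.2⟩)
    have izB : z ∈ B := hB2 (mem_sdiff.2 ⟨hz.1, hz.2.2⟩)
    refine ⟨{x, y, z}, ?_, card_eq_three.2 ⟨x, y, z, n1, n2, n3, rfl⟩, ?_, ?_, hS⟩
    · intro t; simp only [mem_insert, mem_singleton, mem_union]
      rintro (rfl | rfl | rfl)
      · exact Or.inl ixA
      · exact Or.inr iyB
      · exact Or.inr izB
    · have : ({x, y, z} : Finset (Fin n)) ∩ B = {y, z} := by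
        rw [insert_inter_of_notMem (disjoint_left.1 dAB ixA), insert_inter_of_mem iyB,
          singleton_inter_of_mem izB]
      rw [this, card_pair n3]
    · simp only [disjoint_insert_left, disjoint_singleton_left]
      exact ⟨hx.2.1, hy.2.1, hz.2.1⟩
  · intro v hv
    have hnb : ¬ 200000 * missC H v A0 B0 ≤ n ^ 2 := fun h => ((memV v).1 hv).2 ((hbld v).2 h)
    by_contra hno
    push Not at hno
    have h1 : missC H v A0 B0 ≤ missC H v (A0 \ U) (B0 \ U) + 2 * (U.card * n) :=
      pert _ (by intro t ht; simp [ht]) (by intro t ht; simp [ht])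
    have h2 : missC H v (A0 \ U) (B0 \ U) = 0 := by
      unfold missC
      rw [card_eq_zero, filter_eq_empty_iff]
      rintro ⟨x, y⟩ hp
      rw [mem_product] at hp
      rw [not_not]
      exact hno x (hA2 hp.1) y (hB2 hp.2)
    omega

/-- the extremal case. -/
theorem stmt_3 :
    ∃ γ : ℝ, 0 < γ ∧ ∃ n₀ : ℕ, ∀ n : ℕ, n₀ ≤ n → 4 ∣ n →
      ∀ H : Finset (Finset (Fin n)), Is3Graph n H →
        CodegLB H ((n : ℝ) / 2 - 1) → IsExtremal H γ →
        HasK4mFactorOn H Finset.univ := by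
  refine ⟨1 / 10 ^ 16, by norm_num, 10 ^ 20, ?_⟩
  intro n hn h4 H h3 hcd hext
  obtain ⟨A0, B0, hd, hu, hA0, hB0, hK⟩ := hext
  have hcd' : ∀ x y : Fin n, x ≠ y → n ≤ 2 * degOn H x y univ + 2 := by
    intro x y hxy
    have h := hcd x y hxy
    have : (n : ℝ) ≤ 2 * (degOn H x y univ : ℝ) + 2 := by linarith
    exact_mod_cast this
  have hK' : 10 ^ 16 * (BGraph A0 B0 \ H).card ≤ n ^ 3 := by
    have : (10 : ℝ) ^ 16 * ((BGraph A0 B0 \ H).card : ℝ) ≤ (n : ℝ) ^ 3 := by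
      norm_num at hK ⊢
      linarith
    exact_mod_cast this
  obtain ⟨A, B, V, s⟩ := setup_exists h3 hn (by omega) hcd' A0 B0 hd hu hA0 hB0 hK'
  have hn' : 10 ^ 10 ≤ n := le_trans (by norm_num) hn
  exact assemble h3 s hn' h4 (modfix h3 s hn' hcd')
end

section
/- Let 0 < 1/n ≪ γ < 1/100. Suppose H is a 3-graph on n vertices with δ₂(H) ≥ (1/2 − γ)n, and let X, Y be a bipartition of V(H) with |X|, |Y| ≥ n/5. If H is not 3γ-extremal, then H has at least γ²n³ XXY-edges and at least γ²n³ XYY-edges. -/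
open Finset

lemma degOn_split {n : ℕ} (H : Finset (Finset (Fin n))) (X Y : Finset (Fin n))
    (hd : Disjoint X Y) (hu : X ∪ Y = Finset.univ) (a b : Fin n) :
    degOn H a b Finset.univ = degOn H a b X + degOn H a b Y := by
  unfold degOn
  rw [← hu, Finset.filter_union, Finset.card_union_of_disjoint]
  exact Finset.disjoint_filter_filter hd

/-- ordered triples with first pair in `P`, third in `U`, forming an edge. -/
def edgeT {n : ℕ} (H : Finset (Finset (Fin n))) (P : Finset (Fin n × Fin n))
    (U : Finset (Fin n)) : Finset ((Fin n × Fin n) × Fin n) :=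
  (P ×ˢ U).filter fun t => ({t.1.1, t.1.2, t.2} : Finset (Fin n)) ∈ H

def missT {n : ℕ} (H : Finset (Finset (Fin n))) (P : Finset (Fin n × Fin n))
    (U : Finset (Fin n)) : Finset ((Fin n × Fin n) × Fin n) :=
  (P ×ˢ U).filter fun t => ({t.1.1, t.1.2, t.2} : Finset (Fin n)) ∉ H

lemma edgeT_card {n : ℕ} (H : Finset (Finset (Fin n))) (P : Finset (Fin n × Fin n))
    (U : Finset (Fin n)) : (edgeT H P U).card = ∑ p ∈ P, degOn H p.1 p.2 U := by
  unfold edgeT degOn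
  simp only [Finset.card_filter]
  rw [Finset.sum_product]

lemma edge_miss {n : ℕ} (H : Finset (Finset (Fin n))) (P : Finset (Fin n × Fin n))
    (U : Finset (Fin n)) : (edgeT H P U).card + (missT H P U).card = P.card * U.card := by
  unfold edgeT missT
  rw [Finset.card_filter_add_card_filter_not, Finset.card_product]

lemma miss_bound {n : ℕ} (H : Finset (Finset (Fin n))) (X Y : Finset (Fin n))
    (hd : Disjoint X Y) (hu : X ∪ Y = Finset.univ) (δ : ℝ) (hH : CodegLB H δ)
    (P : Finset (Fin n × Fin n)) (hP : ∀ p ∈ P, p.1 ≠ p.2) :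
    ((missT H P X).card : ℝ) ≤ P.card * ((X.card : ℝ) - δ) + (edgeT H P Y).card := by
  have h1 : (P.card : ℝ) * δ ≤ (edgeT H P X).card + (edgeT H P Y).card := by
    rw [edgeT_card, edgeT_card, ← Nat.cast_add, ← Finset.sum_add_distrib, Nat.cast_sum,
      ← nsmul_eq_mul]
    apply Finset.card_nsmul_le_sum
    intro p hp
    rw [← degOn_split H X Y hd hu]
    exact hH _ _ (hP p hp)
  have h2 : ((edgeT H P X).card : ℝ) + (missT H P X).card = P.card * X.card := by
    exact_mod_cast edge_miss H P X
  linarith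

lemma edgeT_XX {n : ℕ} (H : Finset (Finset (Fin n))) (h3 : Is3Graph n H) (X Y : Finset (Fin n))
    (hd : Disjoint X Y) : (edgeT H X.offDiag Y).card ≤ 2 * eCount H X X Y := by
  unfold eCount
  apply Finset.card_le_mul_card_image_of_maps_to (f := fun t => ({t.1.1, t.1.2, t.2} : Finset (Fin n)))
  · rintro ⟨⟨a, b⟩, c⟩ ht
    simp only [edgeT, mem_filter, mem_product, mem_offDiag] at ht ⊢
    exact ⟨ht.2, a, ht.1.1.1, b, ht.1.1.2.1, c, ht.1.2, rfl⟩
  · intro e he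
    simp only [mem_filter] at he
    obtain ⟨heH, a, ha, b, hb, c, hc, rfl⟩ := he
    rw [Finset.disjoint_left] at hd
    refine le_trans (Finset.card_le_card (t := {((a, b), c), ((b, a), c)}) ?_)
      Finset.card_le_two
    rintro ⟨⟨a', b'⟩, c'⟩ ht
    simp only [edgeT, mem_filter, mem_product, mem_offDiag, mem_insert, mem_singleton,
      Prod.mk.injEq] at ht ⊢
    obtain ⟨⟨⟨⟨ha', hb', hab⟩, hc'⟩, hE⟩, heq⟩ := ht
    have e1 : a' ∈ ({a, b, c} : Finset (Fin n)) := by rw [← heq]; simp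
    have e2 : b' ∈ ({a, b, c} : Finset (Fin n)) := by rw [← heq]; simp
    have e3 : c' ∈ ({a, b, c} : Finset (Fin n)) := by rw [← heq]; simp
    simp only [mem_insert, mem_singleton] at e1 e2 e3
    grind

lemma edgeT_XY {n : ℕ} (H : Finset (Finset (Fin n))) (X Y : Finset (Fin n))
    (h3 : Is3Graph n H) : (edgeT H (X ×ˢ Y) X).card ≤ (edgeT H X.offDiag Y).card := by
  apply Finset.card_le_card_of_injOn (fun t => ((t.1.1, t.2), t.1.2))
  · rintro ⟨⟨a, b⟩, c⟩ ht
    simp only [edgeT, coe_filter, Set.mem_setOf_eq, mem_product, mem_offDiag] at ht ⊢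
    obtain ⟨⟨⟨ha, hb⟩, hc⟩, hE⟩ := ht
    have hs : ({a, c, b} : Finset (Fin n)) = {a, b, c} := by
      rw [Finset.pair_comm c b]
    refine ⟨⟨⟨ha, hc, ?_⟩, hb⟩, by rw [hs]; exact hE⟩
    rintro rfl
    have := h3 _ hE
    have h4 : ({a, b, a} : Finset (Fin n)) = {a, b} := by ext; simp; tauto
    rw [h4] at this
    have := Finset.card_le_two (a := a) (b := b)
    omega
  · rintro ⟨⟨a, b⟩, c⟩ _ ⟨⟨a', b'⟩, c'⟩ _ h
    simp only [Prod.mk.injEq] at h ⊢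
    tauto

lemma bgraph_sub {n : ℕ} (H : Finset (Finset (Fin n))) (X Y : Finset (Fin n))
    (hd : Disjoint X Y) (hu : X ∪ Y = Finset.univ) :
    (BGraph X Y \ H).card ≤ (missT H X.offDiag X).card + (missT H (X ×ˢ Y) Y).card := by
  classical
  refine le_trans ?_ (Finset.card_union_le _ _)
  refine le_trans (Finset.card_le_card (t := (missT H X.offDiag X ∪ missT H (X ×ˢ Y) Y).image
    (fun t => ({t.1.1, t.1.2, t.2} : Finset (Fin n)))) ?_) Finset.card_image_le
  intro e he
  simp only [BGraph, mem_sdiff, mem_filter, mem_powersetCard] at he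
  obtain ⟨⟨⟨_, hc⟩, hodd⟩, hE⟩ := he
  have hY : ∀ v, v ∉ X → v ∈ Y := by
    intro v hv
    have : v ∈ X ∪ Y := by rw [hu]; simp
    rw [mem_union] at this; tauto
  have key : ∃ a b c, e = {a, b, c} ∧ a ≠ b ∧ a ∈ X ∧ ((b ∈ X ∧ c ∈ X) ∨ (b ∈ Y ∧ c ∈ Y)) := by
    obtain ⟨p, q, r, hpq, hpr, hqr, rfl⟩ := Finset.card_eq_three.mp hc
    have p1 : ({p, q, r} : Finset (Fin n)) = {q, p, r} := Finset.insert_comm _ _ _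
    have p2 : ({p, q, r} : Finset (Fin n)) = {r, p, q} := by ext; simp; tauto
    by_cases hp : p ∈ X <;> by_cases hq : q ∈ X <;> by_cases hr : r ∈ X <;>
      simp [Finset.insert_inter_of_mem, Finset.insert_inter_of_notMem, hp, hq, hr, hpq, hpr, hqr,
        Finset.singleton_inter_of_mem, Finset.singleton_inter_of_notMem] at hodd
    · exact ⟨p, q, r, rfl, hpq, hp, Or.inl ⟨hq, hr⟩⟩
    · exact ⟨p, q, r, rfl, hpq, hp, Or.inr ⟨hY _ hq, hY _ hr⟩⟩
    · exact ⟨q, p, r, p1, hpq.symm, hq, Or.inr ⟨hY _ hp, hY _ hr⟩⟩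
    · exact ⟨r, p, q, p2, hpr.symm, hr, Or.inr ⟨hY _ hp, hY _ hq⟩⟩
  obtain ⟨a, b, c, rfl, hab, ha, h⟩ := key
  refine Finset.mem_image.mpr ⟨((a, b), c), ?_, rfl⟩
  simp only [missT, mem_union, mem_filter, mem_product, mem_offDiag]
  tauto

lemma bgraph_move {n : ℕ} (H : Finset (Finset (Fin n))) (X Y A B D : Finset (Fin n))
    (hu : X ∪ Y = Finset.univ) (hD : ∀ v, v ∉ D → (v ∈ A ↔ v ∈ X)) :
    (BGraph A B \ H).card ≤ (BGraph X Y \ H).card + D.card * n ^ 2 := by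
  classical
  have h2 : ((D ×ˢ (Finset.univ : Finset (Fin n × Fin n))).image
      (fun t => ({t.1, t.2.1, t.2.2} : Finset (Fin n)))).card ≤ D.card * n ^ 2 := by
    refine Finset.card_image_le.trans ?_
    rw [Finset.card_product]
    simp [sq]
  refine le_trans ?_ (Nat.add_le_add_left h2 _)
  refine le_trans (Finset.card_le_card ?_) (Finset.card_union_le _ _)
  intro e he
  simp only [BGraph, mem_sdiff, mem_filter, mem_powersetCard] at he
  obtain ⟨⟨⟨_, hc⟩, hodd⟩, hE⟩ := he
  rw [mem_union]
  by_cases h : ∃ d ∈ e, d ∈ D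
  · right
    obtain ⟨d, hde, hdD⟩ := h
    have : (e.erase d).card = 2 := by rw [Finset.card_erase_of_mem hde, hc]
    obtain ⟨q, r, _, hqr⟩ := Finset.card_eq_two.mp this
    refine Finset.mem_image.mpr ⟨(d, q, r), by simp [hdD], ?_⟩
    simp only
    rw [← hqr, Finset.insert_erase hde]
  · left
    push Not at h
    have hi : e ∩ A = e ∩ X := by
      ext v
      simp only [mem_inter]
      constructor
      · rintro ⟨h1, h2⟩; exact ⟨h1, (hD v (h v h1)).1 h2⟩
      · rintro ⟨h1, h2⟩; exact ⟨h1, (hD v (h v h1)).2 h2⟩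
    simp only [BGraph, mem_sdiff, mem_filter, mem_powersetCard]
    rw [hu, ← hi]
    exact ⟨⟨⟨Finset.subset_univ _, hc⟩, hodd⟩, hE⟩

lemma exists_balanced {n : ℕ} (X : Finset (Fin n)) :
    ∃ A D : Finset (Fin n), A.card = n / 2 ∧ (∀ v, v ∉ D → (v ∈ A ↔ v ∈ X)) ∧
      ((D.card = n / 2 - X.card ∧ X.card ≤ n / 2) ∨
       (D.card = X.card - n / 2 ∧ n / 2 ≤ X.card)) := by
  rcases le_total X.card (n / 2) with h | h
  · obtain ⟨A, hXA, hA⟩ := Finset.exists_superset_card_eq (s := X) (n := n / 2) h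
      (by rw [Fintype.card_fin]; omega)
    refine ⟨A, A \ X, hA, ?_, Or.inl ⟨by rw [Finset.card_sdiff_of_subset hXA, hA], h⟩⟩
    intro v hv
    rw [mem_sdiff] at hv
    exact ⟨fun h => by tauto, fun h => hXA h⟩
  · obtain ⟨A, hXA, hA⟩ := Finset.exists_subset_card_eq (s := X) (n := n / 2) h
    refine ⟨A, X \ A, hA, ?_, Or.inr ⟨by rw [Finset.card_sdiff_of_subset hXA, hA], h⟩⟩
    intro v hv
    rw [mem_sdiff] at hv
    exact ⟨fun h => hXA h, fun h => by tauto⟩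

set_option maxHeartbeats 1000000 in
lemma arith (γ n x y d m M : ℝ) (hγ0 : 0 < γ) (hγ : γ < 1 / 100) (hn : 100 ≤ γ * n)
    (hxy : x + y = n) (hx : n / 5 ≤ x) (hy : n / 5 ≤ y) (hm : m ≤ γ ^ 2 * n ^ 3)
    (h1 : 0 ≤ x * (x - 1) * (x - (1 / 2 - γ) * n) + 2 * m)
    (h2 : 0 ≤ x * y * (y - (1 / 2 - γ) * n) + 2 * m)
    (hd : d ≤ |x - n / 2| + 1)
    (hM : M ≤ x * (x - 1) * (x - (1 / 2 - γ) * n) + 2 * m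
      + (x * y * (y - (1 / 2 - γ) * n) + 2 * m) + d * n ^ 2) :
    M ≤ 3 * γ * n ^ 3 := by
  have hn1 : 10000 ≤ n := by nlinarith
  have hn0 : 0 < n := by linarith
  -- lower bounds
  have hγ2 : γ ^ 2 * n ^ 3 ≤ γ / 100 * n ^ 3 := by
    apply mul_le_mul_of_nonneg_right _ (by positivity)
    nlinarith
  have ht1 : (1 / 2 - 2 * γ) * n ≤ x := by
    by_contra hc
    push Not at hc
    have ha : x - (1 / 2 - γ) * n < - (γ * n) := by linarith
    have hb : n ^ 2 / 50 ≤ x * (x - 1) := by nlinarith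
    have hg : 0 < γ * n := by positivity
    have : x * (x - 1) * (x - (1 / 2 - γ) * n) < - (n ^ 2 / 50 * (γ * n)) := by
      have : 0 < n ^ 2 / 50 := by positivity
      nlinarith
    nlinarith
  have ht2 : (1 / 2 - 2 * γ) * n ≤ y := by
    by_contra hc
    push Not at hc
    have ha : y - (1 / 2 - γ) * n < - (γ * n) := by linarith
    have hb : n ^ 2 / 50 ≤ x * y := by nlinarith
    have hg : 0 < γ * n := by positivity
    have : x * y * (y - (1 / 2 - γ) * n) < - (n ^ 2 / 50 * (γ * n)) := by
      have : 0 < n ^ 2 / 50 := by positivity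
      nlinarith
    nlinarith
  obtain ⟨t, rfl⟩ : ∃ t, x = n / 2 + t := ⟨x - n / 2, by ring⟩
  obtain rfl : y = n / 2 - t := by linarith
  have hta : |n / 2 + t - n / 2| ≤ 2 * γ * n := by
    rw [abs_le]; constructor <;> linarith
  have htsq : t ^ 2 ≤ (2 * γ * n) ^ 2 := by
    apply sq_le_sq'
    · linarith
    · linarith
  have hD : d * n ^ 2 ≤ (2 * γ * n + 1) * n ^ 2 :=
    mul_le_mul_of_nonneg_right (by linarith) (by positivity)
  have hn2 : 100 * n ^ 2 ≤ γ * n ^ 3 := by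
    have := mul_le_mul_of_nonneg_right hn (by positivity : 0 ≤ n ^ 2)
    nlinarith
  have hmain : (n / 2 + t) * (n / 2 + t - 1) * (n / 2 + t - (1 / 2 - γ) * n)
      + (n / 2 + t) * (n / 2 - t) * (n / 2 - t - (1 / 2 - γ) * n)
      = (n / 2 + t) * (γ * n ^ 2 + 2 * t ^ 2) - (n / 2 + t) * (t + γ * n) := by ring
  have htn : n / 2 + t ≤ 13 / 25 * n := by nlinarith
  have hpos : 0 ≤ n / 2 + t := by linarith
  have hq : γ * n ^ 2 + 2 * t ^ 2 ≤ 27 / 25 * (γ * n ^ 2) := by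
    have : (2 * γ * n) ^ 2 = 4 * γ * (γ * n ^ 2) := by ring
    have h0 : 0 ≤ γ * n ^ 2 := by positivity
    nlinarith
  have e1 : (n / 2 + t) * (γ * n ^ 2 + 2 * t ^ 2) ≤ 13 / 25 * n * (27 / 25 * (γ * n ^ 2)) := by
    apply mul_le_mul htn hq (by positivity) (by positivity)
  have e2 : - ((n / 2 + t) * (t + γ * n)) ≤ n ^ 2 := by
    have : - (γ * n) ≤ t + γ * n := by linarith
    have h50 := mul_le_mul_of_nonneg_right hγ.le hn0.le
    have h5 : - (n / 50) ≤ t + γ * n := by linarith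
    have h6 := mul_le_mul_of_nonneg_left h5 hpos
    have h7 := mul_le_mul_of_nonneg_right htn hn0.le
    have h8 : 0 ≤ n ^ 2 := by positivity
    linarith
  have e3 : 13 / 25 * n * (27 / 25 * (γ * n ^ 2)) = 351 / 625 * (γ * n ^ 3) := by ring
  have e4 : (2 * γ * n + 1) * n ^ 2 = 2 * (γ * n ^ 3) + n ^ 2 := by ring
  have e5 : 0 ≤ γ * n ^ 3 := by positivity
  linarith

lemma main_case {n : ℕ} (γ : ℝ) (hγ0 : 0 < γ) (hγ : γ < 1 / 100) (hn : 100 ≤ γ * n)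
    (H : Finset (Finset (Fin n))) (h3 : Is3Graph n H) (hH : CodegLB H ((1 / 2 - γ) * n))
    (X Y : Finset (Fin n)) (hd : Disjoint X Y) (hu : X ∪ Y = Finset.univ)
    (hX : (n : ℝ) / 5 ≤ (X.card : ℝ)) (hY : (n : ℝ) / 5 ≤ (Y.card : ℝ))
    (hext : ¬ IsExtremal H (3 * γ)) :
    γ ^ 2 * (n : ℝ) ^ 3 ≤ (eCount H X X Y : ℝ) := by
  by_contra hc
  push Not at hc
  apply hext
  obtain ⟨A, D, hA, hAD, hDc⟩ := exists_balanced X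
  refine ⟨A, Aᶜ, disjoint_compl_right, Finset.union_compl A, hA, ?_, ?_⟩
  · rw [Finset.card_compl, hA, Fintype.card_fin]
  have hcard : X.card + Y.card = n := by
    rw [← Finset.card_union_of_disjoint hd, hu, Finset.card_univ, Fintype.card_fin]
  have b1 := miss_bound H X Y hd hu _ hH X.offDiag (by
    intro p hp; exact (mem_offDiag.mp hp).2.2)
  have b2 := miss_bound H Y X hd.symm (by rw [Finset.union_comm]; exact hu) _ hH (X ×ˢ Y) (by
    intro p hp h
    rw [mem_product] at hp
    exact Finset.disjoint_left.mp hd hp.1 (h ▸ hp.2))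
  have b3 : ((edgeT H X.offDiag Y).card : ℝ) ≤ 2 * eCount H X X Y := by
    exact_mod_cast edgeT_XX H h3 X Y hd
  have b4 : ((edgeT H (X ×ˢ Y) X).card : ℝ) ≤ (edgeT H X.offDiag Y).card := by
    exact_mod_cast edgeT_XY H X Y h3
  have b5 : ((BGraph X Y \ H).card : ℝ) ≤ (missT H X.offDiag X).card
      + (missT H (X ×ˢ Y) Y).card := by
    exact_mod_cast bgraph_sub H X Y hd hu
  have b6 : ((BGraph A Aᶜ \ H).card : ℝ) ≤ (BGraph X Y \ H).card + D.card * (n : ℝ) ^ 2 := by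
    exact_mod_cast bgraph_move H X Y A Aᶜ D hu hAD
  have o1 : ((X.offDiag.card : ℕ) : ℝ) = X.card * ((X.card : ℝ) - 1) := by
    rw [Finset.offDiag_card, Nat.cast_sub (Nat.le_mul_self _)]
    push_cast; ring
  have o2 : (((X ×ˢ Y).card : ℕ) : ℝ) = X.card * (Y.card : ℝ) := by
    rw [Finset.card_product]; push_cast; ring
  rw [o1] at b1
  rw [o2] at b2
  have p1 : (0 : ℝ) ≤ (missT H X.offDiag X).card := by positivity
  have p2 : (0 : ℝ) ≤ (missT H (X ×ˢ Y) Y).card := by positivity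
  have hDr : (D.card : ℝ) ≤ |(X.card : ℝ) - n / 2| + 1 := by
    have f1 : ((n / 2 : ℕ) : ℝ) ≤ n / 2 := by exact_mod_cast Nat.cast_div_le (α := ℝ)
    have f2 : (n : ℝ) / 2 - 1 ≤ ((n / 2 : ℕ) : ℝ) := by
      have : n ≤ 2 * (n / 2) + 1 := by omega
      have : (n : ℝ) ≤ 2 * ((n / 2 : ℕ) : ℝ) + 1 := by exact_mod_cast this
      linarith
    rcases hDc with ⟨h, hle⟩ | ⟨h, hle⟩
    · rw [h, Nat.cast_sub hle]
      have := neg_abs_le ((X.card : ℝ) - n / 2)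
      linarith
    · rw [h, Nat.cast_sub hle]
      have := le_abs_self ((X.card : ℝ) - n / 2)
      linarith
  refine arith γ n X.card Y.card D.card (eCount H X X Y) _ hγ0 hγ hn (by exact_mod_cast hcard)
    hX hY hc.le ?_ ?_ hDr ?_ <;> linarith

/-- non-extremal graphs have many `XXY`- and `XYY`-edges. -/
theorem stmt_6 (γ : ℝ) (hγ0 : 0 < γ) (hγ : γ < 1 / 100) :
    ∃ n₀ : ℕ, ∀ n : ℕ, n₀ ≤ n →
      ∀ H : Finset (Finset (Fin n)), Is3Graph n H →
        CodegLB H ((1 / 2 - γ) * n) →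
        ∀ X Y : Finset (Fin n), Disjoint X Y → X ∪ Y = Finset.univ →
          (n : ℝ) / 5 ≤ (X.card : ℝ) → (n : ℝ) / 5 ≤ (Y.card : ℝ) →
          ¬ IsExtremal H (3 * γ) →
          γ ^ 2 * (n : ℝ) ^ 3 ≤ (eCount H X X Y : ℝ) ∧
          γ ^ 2 * (n : ℝ) ^ 3 ≤ (eCount H X Y Y : ℝ) := by
  obtain ⟨n₀, hn₀⟩ := exists_nat_gt (100 / γ)
  refine ⟨n₀, fun n hn H h3 hH X Y hd hu hX hY hext => ?_⟩
  have hnn : 100 ≤ γ * n := by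
    have h1 : (n₀ : ℝ) ≤ n := by exact_mod_cast hn
    have h2 : 100 / γ < n := lt_of_lt_of_le hn₀ h1
    rw [div_lt_iff₀ hγ0] at h2
    linarith
  refine ⟨main_case γ hγ0 hγ hnn H h3 hH X Y hd hu hX hY hext, ?_⟩
  have h := main_case γ hγ0 hγ hnn H h3 hH Y X hd.symm
    (by rw [Finset.union_comm]; exact hu) hY hX hext
  have he : eCount H X Y Y = eCount H Y Y X := by
    unfold eCount
    congr 1
    apply Finset.filter_congr
    intro e _
    constructor
    · rintro ⟨a, ha, b, hb, c, hc, rfl⟩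
      exact ⟨b, hb, c, hc, a, ha, by ext; simp; tauto⟩
    · rintro ⟨a, ha, b, hb, c, hc, rfl⟩
      exact ⟨c, hc, a, ha, b, hb, by ext; simp; tauto⟩
  rw [he]
  exact h
end
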